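/- Crossover estimate: Let 0 < r ≤ 1 with r < R/2. Let u be a weak supersolution of −div(A(x,∇u)) + Lu = f in Ω with u ≥ 0 in B_R(x₀) ⊂ Ω, where f ∈ L^{q/p}(B_R(x₀)) and q > n. Then there exist constants ε = ε(n,p,q,s,C₁,C₂,Λ) > 0 and c = c(n,p,q,s,C₁,C₂,Λ,ε) > 0 such that for every d satisfying d > r^{p'} R^{−p'} Tail(u₋; x₀, R) + r^{(p−n)/(p−1)} R^{n(q−p)/(q(p−1))} ‖f‖_{L^{q/p}(B_R(x₀))}^{1/(p−1)}, setting v = u + d one has ( ⨍_{B_r(x₀)} v^{ε} dx )^{1/ε} ≤ c ( ⨍_{B_r(x₀)} v^{−ε} dx )^{−1/ε}, where u₋ = max{−u, 0}. -/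

import Mathlib

open MeasureTheory Real Set Metric
open scoped RealInnerProductSpace ENNReal Topology NNReal

noncomputable section

abbrev En (n : ℕ) := EuclideanSpace ℝ (Fin n)

/-- Smooth test function compactly supported in `s`. -/
def TestFun {n : ℕ} (s : Set (En n)) (φ : En n → ℝ) : Prop :=
  ContDiff ℝ (⊤ : ℕ∞) φ ∧ HasCompactSupport φ ∧ tsupport φ ⊆ s

/-- `J_p(t) = |t|^{p-2} t`. -/
def Jp (p t : ℝ) : ℝ := |t| ^ (p - 2) * t

/-- `G` is a weak gradient of `u` on the open set `Ω`. -/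
def HasWeakGradOn {n : ℕ} (u : En n → ℝ) (G : En n → En n) (Ω : Set (En n)) : Prop :=
  ∀ φ : En n → ℝ, TestFun Ω φ → ∫ x, u x • gradient φ x = - ∫ x, φ x • G x

/-- `u ∈ W^{1,p}_loc(Ω)` with weak gradient `G`. -/
def MemW1pLoc {n : ℕ} (p : ℝ) (u : En n → ℝ) (G : En n → En n) (Ω : Set (En n)) : Prop :=
  HasWeakGradOn u G Ω ∧
    ∀ k : Set (En n), IsCompact k → k ⊆ Ω →
      IntegrableOn (fun x => |u x| ^ p) k ∧ IntegrableOn (fun x => ‖G x‖ ^ p) k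

/-- `u` belongs to the tail space `L^{p-1}_{ps}(ℝⁿ)`. -/
def MemTailSpace {n : ℕ} (p s : ℝ) (u : En n → ℝ) : Prop :=
  Integrable (fun y : En n => |u y| ^ (p - 1) * (1 + ‖y‖) ^ (-((n : ℝ) + p * s)))

/-- The structural setting for the mixed local-nonlocal operator
`-div(A(x,∇u)) + L u` on a bounded open set `Ω ⊆ ℝⁿ`. -/
structure Setting (n : ℕ) (p s C₁ C₂ Λ : ℝ) where
  Ω : Set (En n)
  A : En n → En n → En n
  K : En n → En n → ℝ
  hΩopen : IsOpen Ω
  hΩbdd : Bornology.IsBounded Ω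
  hC₁ : 0 < C₁
  hC₂ : 0 < C₂
  hΛ : 1 ≤ Λ
  hAmeas : ∀ ξ, Measurable fun x => A x ξ
  hAcont : ∀ x, Continuous (A x)
  hAgrowth : ∀ᵐ x ∂(volume : Measure (En n)), x ∈ Ω → ∀ ξ, ‖A x ξ‖ ≤ C₂ * ‖ξ‖ ^ (p - 1)
  hAcoerc : ∀ᵐ x ∂(volume : Measure (En n)), x ∈ Ω → ∀ ξ, C₁ * ‖ξ‖ ^ p ≤ ⟪A x ξ, ξ⟫
  hKmeas : Measurable (Function.uncurry K)
  hKnonneg : ∀ x y, 0 ≤ K x y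
  hKsymm : ∀ x y, K x y = K y x
  hKlower : ∀ᵐ z ∂(volume : Measure (En n × En n)),
    Λ⁻¹ * ‖z.1 - z.2‖ ^ (-((n : ℝ) + p * s)) ≤ K z.1 z.2
  hKupper : ∀ᵐ z ∂(volume : Measure (En n × En n)),
    K z.1 z.2 ≤ Λ * ‖z.1 - z.2‖ ^ (-((n : ℝ) + p * s))

variable {n : ℕ} {p s C₁ C₂ Λ : ℝ}

/-- The mixed local-nonlocal energy form tested against `φ`. -/
def Eform (S : Setting n p s C₁ C₂ Λ) (u : En n → ℝ) (G : En n → En n) (φ : En n → ℝ) : ℝ :=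
  (∫ x, ⟪S.A x (G x), gradient φ x⟫) +
    ∫ x, ∫ y, Jp p (u x - u y) * (φ x - φ y) * S.K x y

/-- Weak supersolution of `-div(A(x,∇u)) + L u = f` in `Ω`. -/
def IsSupersol (S : Setting n p s C₁ C₂ Λ) (f u : En n → ℝ) (G : En n → En n) : Prop :=
  MemW1pLoc p u G S.Ω ∧ MemTailSpace p s u ∧
    ∀ φ : En n → ℝ, TestFun S.Ω φ → (∀ x, 0 ≤ φ x) → (∫ x, f x * φ x) ≤ Eform S u G φ

/-- Weak subsolution of `-div(A(x,∇u)) + L u = f` in `Ω`. -/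
def IsSubsol (S : Setting n p s C₁ C₂ Λ) (f u : En n → ℝ) (G : En n → En n) : Prop :=
  MemW1pLoc p u G S.Ω ∧ MemTailSpace p s u ∧
    ∀ φ : En n → ℝ, TestFun S.Ω φ → (∀ x, 0 ≤ φ x) → Eform S u G φ ≤ ∫ x, f x * φ x

/-- Weak solution of `-div(A(x,∇u)) + L u = f` in `Ω`. -/
def IsSol (S : Setting n p s C₁ C₂ Λ) (f u : En n → ℝ) (G : En n → En n) : Prop :=
  MemW1pLoc p u G S.Ω ∧ MemTailSpace p s u ∧
    ∀ φ : En n → ℝ, TestFun S.Ω φ → Eform S u G φ = ∫ x, f x * φ x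

/-- The nonlocal tail `Tail(v; x₀, ρ)`. -/
def Tail (n : ℕ) (p s : ℝ) (v : En n → ℝ) (x₀ : En n) (ρ : ℝ) : ℝ :=
  (ρ ^ p * ∫ y in (ball x₀ ρ)ᶜ, |v y| ^ (p - 1) * ‖y - x₀‖ ^ (-((n : ℝ) + p * s))) ^ (1 / (p - 1))

/-- `L^m`-norm of `f` on a set `B`. -/
def normLp {n : ℕ} (m : ℝ) (f : En n → ℝ) (B : Set (En n)) : ℝ :=
  (∫ x in B, |f x| ^ m) ^ (1 / m)

/-- Negative part `u₋ = max (−u) 0`. -/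
def nneg {n : ℕ} (u : En n → ℝ) : En n → ℝ := fun x => max (-u x) 0

/-- Positive part `u₊ = max u 0`. -/
def npos {n : ℕ} (u : En n → ℝ) : En n → ℝ := fun x => max (u x) 0

/-- The threshold quantity
`r^{p'} R^{−p'} Tail(u₋; x₀, R) + r^{(p−n)/(p−1)} R^{n(q−p)/(q(p−1))} ‖f‖_{L^{q/p}(B_R(x₀))}^{1/(p−1)}`. -/
def dBound (n : ℕ) (p s q : ℝ) (u f : En n → ℝ) (x₀ : En n) (r R : ℝ) : ℝ :=
  r ^ (p / (p - 1)) * R ^ (-(p / (p - 1))) * Tail n p s (nneg u) x₀ R +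
    r ^ ((p - n) / (p - 1)) * R ^ (n * (q - p) / (q * (p - 1))) *
      (normLp (q / p) f (ball x₀ R)) ^ (1 / (p - 1))

section Algebra

lemma Jp_neg (p t : ℝ) : Jp p (-t) = -Jp p t := by
  simp [Jp]

lemma Jp_of_pos {p t : ℝ} (ht : 0 < t) : Jp p t = t ^ (p - 1) := by
  rw [Jp, abs_of_pos ht, ← rpow_add_one ht.ne']
  congr 1; ring

lemma abs_Jp {p : ℝ} (hp : 1 < p) (t : ℝ) : |Jp p t| = |t| ^ (p - 1) := by
  rcases lt_trichotomy t 0 with h | h | h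
  · have : Jp p t = -(-t) ^ (p - 1) := by
      rw [← Jp_of_pos (by linarith), Jp_neg, neg_neg]
    rw [this, abs_neg, abs_of_nonneg (rpow_nonneg (by linarith) _), abs_of_neg h]
  · subst h
    simp [Jp, zero_rpow (by linarith : p - 1 ≠ 0)]
  · rw [Jp_of_pos h, abs_of_nonneg (rpow_nonneg h.le _), abs_of_pos h]

lemma measurable_Jp (p : ℝ) : Measurable (Jp p) := by
  unfold Jp
  fun_prop

lemma rpow_le_convex_split {p t α β : ℝ} (hp : 1 < p) (ht0 : 0 < t) (ht1 : t < 1) (hβ : 0 ≤ β)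
    (hαβ : β ≤ α) :
    α ^ p ≤ t ^ (1 - p) * β ^ p + (1 - t) ^ (1 - p) * (α - β) ^ p := by
  have h1t : 0 < 1 - t := by linarith
  have h := (convexOn_rpow hp.le).2 (x := β / t) (y := (α - β) / (1 - t))
    (Set.mem_Ici.2 (by positivity)) (Set.mem_Ici.2 (div_nonneg (by linarith) h1t.le))
    ht0.le h1t.le (by ring)
  simp only [smul_eq_mul] at h
  have e1 : t * (β / t) + (1 - t) * ((α - β) / (1 - t)) = α := by
    field_simp; ring
  rw [e1, div_rpow hβ ht0.le, div_rpow (by linarith) h1t.le] at h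
  rw [rpow_sub ht0, rpow_sub h1t, rpow_one, rpow_one]
  calc α ^ p ≤ _ := h
    _ = _ := by ring

lemma Jp_mul_log_test_le {p a b α β : ℝ} (hp : 1 < p) (ha : 0 < a) (hb : 0 < b) (hα : 0 ≤ α)
    (hβ : 0 ≤ β) :
    Jp p (a - b) * (α ^ p * a ^ (1 - p) - β ^ p * b ^ (1 - p)) ≤ |α - β| ^ p := by
  wlog hab : b ≤ a generalizing a b α β
  · have := this hb ha hβ hα (by linarith)
    rw [← neg_sub a b, Jp_neg, abs_sub_comm] at this
    linarith
  have hrhs : 0 ≤ |α - β| ^ p := by positivity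
  rcases hab.eq_or_lt with rfl | hlt
  · simpa [Jp] using hrhs
  rw [Jp_of_pos (by linarith)]
  have hJ : 0 ≤ (a - b) ^ (p - 1) := rpow_nonneg (by linarith) _
  rcases le_or_gt α β with hle | hgt
  · have h1 : α ^ p ≤ β ^ p := rpow_le_rpow hα hle (by linarith)
    have h2 : a ^ (1 - p) ≤ b ^ (1 - p) := rpow_le_rpow_of_nonpos hb hab (by linarith)
    have h3 : α ^ p * a ^ (1 - p) ≤ β ^ p * b ^ (1 - p) :=
      mul_le_mul h1 h2 (by positivity) (by positivity)
    nlinarith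
  · have ht0 : 0 < b / a := by positivity
    have ht1 : b / a < 1 := by rw [div_lt_one ha]; exact hlt
    have h1t : 0 < 1 - b / a := by linarith
    have h := rpow_le_convex_split hp ht0 ht1 hβ hgt.le
    rw [abs_of_pos (by linarith)]
    have e1 : (a - b) ^ (p - 1) * a ^ (1 - p) = (1 - b / a) ^ (p - 1) := by
      have : 1 - b / a = (a - b) / a := by field_simp
      rw [this, div_rpow (by linarith) ha.le, show 1 - p = -(p - 1) by ring, rpow_neg ha.le]
      rfl
    have e2 : b ^ (1 - p) = a ^ (1 - p) * (b / a) ^ (1 - p) := by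
      rw [← mul_rpow ha.le ht0.le]
      congr 1; field_simp
    have e3 : (1 - b / a) ^ (p - 1) * (1 - b / a) ^ (1 - p) = 1 := by
      rw [← rpow_add h1t]; simp
    calc (a - b) ^ (p - 1) * (α ^ p * a ^ (1 - p) - β ^ p * b ^ (1 - p))
        = ((a - b) ^ (p - 1) * a ^ (1 - p)) * (α ^ p - (b / a) ^ (1 - p) * β ^ p) := by
          rw [e2]; ring
      _ = (1 - b / a) ^ (p - 1) * (α ^ p - (b / a) ^ (1 - p) * β ^ p) := by rw [e1]
      _ ≤ (1 - b / a) ^ (p - 1) * ((1 - b / a) ^ (1 - p) * (α - β) ^ p) := by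
          apply mul_le_mul_of_nonneg_left _ (rpow_nonneg h1t.le _)
          linarith
      _ = (α - β) ^ p := by rw [← mul_assoc, e3, one_mul]

lemma add_rpow_le_two_rpow {a b t : ℝ} (ha : 0 ≤ a) (hb : 0 ≤ b) (ht : 0 ≤ t) :
    (a + b) ^ t ≤ 2 ^ t * (a ^ t + b ^ t) := by
  have h1 : (a + b) ^ t ≤ (2 * max a b) ^ t := by
    apply rpow_le_rpow (by positivity) _ ht
    linarith [le_max_left a b, le_max_right a b]
  rw [mul_rpow (by norm_num) (le_max_of_le_left ha)] at h1
  refine h1.trans (mul_le_mul_of_nonneg_left ?_ (by positivity))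
  have := rpow_nonneg ha t
  have := rpow_nonneg hb t
  rcases max_cases a b with h | h <;> rw [h.1] <;> linarith

lemma Jp_mul_log_test_le_of_neg {p U V d α : ℝ} (hp : 1 < p) (hd : 0 < d) (hα : 0 ≤ α)
    (hU : 0 ≤ U) (hV : V < 0) :
    Jp p (U - V) * (α ^ p * (U + d) ^ (1 - p)) ≤
      2 ^ p * (α ^ p + d ^ (1 - p) * (α ^ p * (-V) ^ (p - 1))) := by
  rw [Jp_of_pos (by linarith), sub_eq_add_neg]
  have h1 := add_rpow_le_two_rpow (t := p - 1) hU (by linarith : 0 ≤ -V) (by linarith)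
  have h2 : (2 : ℝ) ^ (p - 1) ≤ 2 ^ p := rpow_le_rpow_of_exponent_le (by norm_num) (by linarith)
  have h3 : U ^ (p - 1) * (U + d) ^ (1 - p) ≤ 1 := by
    have : U ^ (p - 1) ≤ (U + d) ^ (p - 1) := rpow_le_rpow hU (by linarith) (by linarith)
    calc U ^ (p - 1) * (U + d) ^ (1 - p) ≤ (U + d) ^ (p - 1) * (U + d) ^ (1 - p) := by gcongr
      _ = 1 := by rw [← rpow_add (by linarith)]; simp
  have h4 : (U + d) ^ (1 - p) ≤ d ^ (1 - p) :=
    rpow_le_rpow_of_nonpos hd (by linarith) (by linarith)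
  have hVn : 0 ≤ (-V) ^ (p - 1) := rpow_nonneg (by linarith) _
  have hαp : 0 ≤ α ^ p := by positivity
  have hUd : 0 ≤ (U + d) ^ (1 - p) := by positivity
  calc (U + -V) ^ (p - 1) * (α ^ p * (U + d) ^ (1 - p))
      ≤ 2 ^ p * (U ^ (p - 1) + (-V) ^ (p - 1)) * (α ^ p * (U + d) ^ (1 - p)) := by
        apply mul_le_mul_of_nonneg_right _ (by positivity)
        exact h1.trans (mul_le_mul_of_nonneg_right h2 (by positivity))
    _ = 2 ^ p * (α ^ p * (U ^ (p - 1) * (U + d) ^ (1 - p)) +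
          (U + d) ^ (1 - p) * (α ^ p * (-V) ^ (p - 1))) := by ring
    _ ≤ _ := by
        apply mul_le_mul_of_nonneg_left _ (by positivity)
        apply add_le_add
        · exact mul_le_of_le_one_right hαp h3
        · exact mul_le_mul_of_nonneg_right h4 (by positivity)

lemma Jp_mul_log_test_le_tail {p U V d α β : ℝ} (hp : 1 < p) (hd : 0 < d) (hα : 0 ≤ α)
    (hβ : 0 ≤ β) (hU : α = 0 ∨ 0 ≤ U) (hV : β = 0 ∨ 0 ≤ V) :
    Jp p (U - V) * (α ^ p * (U + d) ^ (1 - p) - β ^ p * (V + d) ^ (1 - p)) ≤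
      2 ^ p * (|α - β| ^ p +
        d ^ (1 - p) * (α ^ p * max (-V) 0 ^ (p - 1) + β ^ p * max (-U) 0 ^ (p - 1))) := by
  have h0 : (0 : ℝ) ^ p = 0 := zero_rpow (by linarith)
  have hrest : 0 ≤ d ^ (1 - p) *
      (α ^ p * max (-V) 0 ^ (p - 1) + β ^ p * max (-U) 0 ^ (p - 1)) := by positivity
  have h2 : (1 : ℝ) ≤ 2 ^ p := one_le_rpow (by norm_num) (by linarith)
  by_cases hU0 : 0 ≤ U <;> by_cases hV0 : 0 ≤ V
  · have h := Jp_mul_log_test_le hp (a := U + d) (b := V + d) (by linarith) (by linarith) hα hβ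
    rw [add_sub_add_right_eq_sub] at h
    have : 0 ≤ |α - β| ^ p := by positivity
    nlinarith
  · have hβ0 : β = 0 := by tauto
    subst hβ0
    rw [h0, zero_mul, zero_mul, sub_zero, sub_zero, abs_of_nonneg hα, add_zero,
      max_eq_left (by linarith)]
    exact Jp_mul_log_test_le_of_neg hp hd hα hU0 (by linarith)
  · have hα0 : α = 0 := by tauto
    subst hα0
    rw [h0, zero_mul, zero_mul, zero_sub, zero_sub, abs_neg, abs_of_nonneg hβ, zero_add,
      max_eq_left (by linarith : 0 ≤ -U), ← neg_sub V U, Jp_neg, neg_mul_neg]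
    exact Jp_mul_log_test_le_of_neg hp hd hβ hV0 (by linarith)
  · have hα0 : α = 0 := by tauto
    have hβ0 : β = 0 := by tauto
    subst hα0 hβ0
    simp [h0]

lemma rpow_mul_le_young {p δ Y Z : ℝ} (hp : 1 < p) (hδ : 0 < δ) (hY : 0 ≤ Y) (hZ : 0 ≤ Z) :
    Y ^ (p - 1) * Z ≤ δ * Y ^ p + δ ^ (1 - p) * Z ^ p := by
  have e : ∀ X : ℝ, 0 ≤ X → X ^ p = X ^ (p - 1) * X := fun X hX => by
    rcases hX.eq_or_lt with rfl | h
    · rw [mul_zero, zero_rpow (by linarith)]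
    · rw [← rpow_add_one h.ne']; congr 1; ring
  have hYp : 0 ≤ δ * Y ^ p := by positivity
  have hZp : 0 ≤ δ ^ (1 - p) * Z ^ p := by positivity
  rcases le_or_gt Z (δ * Y) with h | h
  · have : Y ^ (p - 1) * Z ≤ Y ^ (p - 1) * (δ * Y) := by gcongr
    rw [e Y hY] at *
    nlinarith
  · have h1 : Y ≤ Z / δ := by rw [le_div_iff₀ hδ]; linarith
    have h2 : Y ^ (p - 1) ≤ Z ^ (p - 1) * δ ^ (1 - p) := by
      refine (rpow_le_rpow hY h1 (by linarith)).trans_eq ?_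
      rw [div_rpow hZ hδ.le, show 1 - p = -(p - 1) by ring, rpow_neg hδ.le]
      rfl
    have : Y ^ (p - 1) * Z ≤ Z ^ (p - 1) * δ ^ (1 - p) * Z := by gcongr
    rw [e Z hZ] at *
    nlinarith

end Algebra

section MeasureTools

lemma enn_mul_le_split {p : ℝ} (hp : 1 < p) {c : ℝ≥0∞} (hc0 : c ≠ 0) (hct : c ≠ ⊤)
    (h g : ℝ≥0∞) :
    h * g ≤ min (h * g) (c * h ^ (p / (p - 1))) + c ^ (1 - p) * g ^ p := by
  have hp1 : 0 < p - 1 := by linarith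
  have hsucc : ∀ (X : ℝ≥0∞) (t : ℝ), 0 ≤ t → X ^ (t + 1) = X ^ t * X := fun X t ht => by
    rw [ENNReal.rpow_add_of_nonneg _ _ ht zero_le_one, ENNReal.rpow_one]
  have e1 : p / (p - 1) = 1 / (p - 1) + 1 := by field_simp; ring
  have e2 : p = (p - 1) + 1 := by ring
  rcases le_or_gt g (c * h ^ (1 / (p - 1))) with hg | hg
  · have : h * g ≤ c * h ^ (p / (p - 1)) := by
      rw [e1, hsucc h _ (by positivity)]
      calc h * g ≤ h * (c * h ^ (1 / (p - 1))) := by gcongr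
        _ = _ := by ring
    rw [min_eq_left this]
    exact le_self_add
  · refine le_add_left ?_
    have h1 : h ^ (1 / (p - 1)) ≤ c⁻¹ * g := by
      rw [mul_comm, ← div_eq_mul_inv, ENNReal.le_div_iff_mul_le (Or.inl hc0) (Or.inl hct), mul_comm]
      exact hg.le
    have h2 : h ≤ (c⁻¹ * g) ^ (p - 1) := by
      have := ENNReal.rpow_le_rpow h1 hp1.le
      rwa [← ENNReal.rpow_mul, one_div_mul_cancel hp1.ne', ENNReal.rpow_one] at this
    rw [ENNReal.mul_rpow_of_nonneg _ _ hp1.le, ENNReal.inv_rpow, ← ENNReal.rpow_neg] at h2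
    have e3 : g ^ p = g ^ (p - 1) * g := by
      conv_lhs => rw [e2]
      exact hsucc g _ hp1.le
    rw [e3, show 1 - p = -(p - 1) by ring]
    calc h * g ≤ (c ^ (-(p - 1)) * g ^ (p - 1)) * g := by gcongr
      _ = _ := by ring

lemma enn_mul_le_rpow_add {p : ℝ} (hp : 1 < p) (h g : ℝ≥0∞) :
    h * g ≤ h ^ (p / (p - 1)) + g ^ p := by
  have := enn_mul_le_split hp one_ne_zero ENNReal.one_ne_top h g
  rw [one_mul, ENNReal.one_rpow, one_mul] at this
  exact this.trans (by gcongr; exact min_le_right _ _)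

variable {α : Type*} [MeasurableSpace α] {μ : Measure α}

lemma tendsto_lintegral_mul_of_bounded {p : ℝ} (hp : 1 < p) {h : α → ℝ≥0∞}
    {g : ℕ → α → ℝ≥0∞} (hh : AEMeasurable h μ) (hg : ∀ k, AEMeasurable (g k) μ)
    (hfin : ∫⁻ x, h x ^ (p / (p - 1)) ∂μ ≠ ⊤) {M : ℝ≥0∞} (hM : M ≠ ⊤)
    (hgM : ∀ k, ∫⁻ x, g k x ^ p ∂μ ≤ M)
    (hlim : ∀ᵐ x ∂μ, Filter.Tendsto (fun k => g k x) Filter.atTop (𝓝 0)) :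
    Filter.Tendsto (fun k => ∫⁻ x, h x * g k x ∂μ) Filter.atTop (𝓝 0) := by
  have hp1 : 0 < p - 1 := by linarith
  have hp' : 0 < p / (p - 1) := by positivity
  have hdct : ∀ c : ℝ≥0∞, c ≠ ⊤ → Filter.Tendsto
      (fun k => ∫⁻ x, min (h x * g k x) (c * h x ^ (p / (p - 1))) ∂μ) Filter.atTop (𝓝 0) := by
    intro c hc
    have : (0 : ℝ≥0∞) = ∫⁻ x, (0 : ℝ≥0∞) ∂μ := by simp
    rw [this]
    refine tendsto_lintegral_of_dominated_convergence' (fun x => c * h x ^ (p / (p - 1)))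
      (fun k => (hh.mul (hg k)).min ((hh.pow_const _).const_mul c))
      (fun k => ae_of_all _ fun x => min_le_right _ _) ?_ ?_
    · rw [lintegral_const_mul'' _ (hh.pow_const _)]
      exact ENNReal.mul_ne_top hc hfin
    · have hfinite : ∀ᵐ x ∂μ, h x ^ (p / (p - 1)) < ⊤ := ae_lt_top' (hh.pow_const _) hfin
      filter_upwards [hlim, hfinite] with x hx hxf
      have hx' : h x ≠ ⊤ := by
        intro h0
        rw [h0, ENNReal.top_rpow_of_pos hp'] at hxf
        exact lt_irrefl _ hxf
      have h1 : Filter.Tendsto (fun k => h x * g k x) Filter.atTop (𝓝 (h x * 0)) :=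
        ENNReal.Tendsto.const_mul hx (Or.inr hx')
      rw [mul_zero] at h1
      exact tendsto_of_tendsto_of_tendsto_of_le_of_le tendsto_const_nhds h1
        (fun k => bot_le) (fun k => min_le_left _ _)
  rw [ENNReal.tendsto_atTop_zero]
  intro ε hε
  have hε2 : 0 < ε / 2 := ENNReal.half_pos hε.ne'
  obtain ⟨c, hc0, hct, hcM⟩ : ∃ c : ℝ≥0∞, c ≠ 0 ∧ c ≠ ⊤ ∧ c ^ (1 - p) * M ≤ ε / 2 := by
    have htend : Filter.Tendsto (fun k : ℕ => ENNReal.ofReal ((k : ℝ) ^ (1 - p)) * M)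
        Filter.atTop (𝓝 0) := by
      have h1 : Filter.Tendsto (fun k : ℕ => (k : ℝ) ^ (1 - p)) Filter.atTop (𝓝 0) := by
        have := (tendsto_rpow_neg_atTop hp1).comp tendsto_natCast_atTop_atTop
        refine this.congr fun k => ?_
        simp
      have h2 := ENNReal.Tendsto.mul_const (b := M) (ENNReal.tendsto_ofReal h1) (Or.inr hM)
      simpa using h2
    obtain ⟨k, hk⟩ := ((ENNReal.tendsto_atTop_zero.1 htend) (ε / 2) hε2)
    refine ⟨ENNReal.ofReal ((k + 1 : ℕ) : ℝ), by simp; positivity, ENNReal.ofReal_ne_top, ?_⟩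
    rw [ENNReal.ofReal_rpow_of_pos (by positivity)]
    exact hk (k + 1) (by omega)
  obtain ⟨N, hN⟩ := (ENNReal.tendsto_atTop_zero.1 (hdct c hct)) (ε / 2) hε2
  refine ⟨N, fun k hk => ?_⟩
  calc ∫⁻ x, h x * g k x ∂μ
      ≤ ∫⁻ x, (min (h x * g k x) (c * h x ^ (p / (p - 1))) + c ^ (1 - p) * g k x ^ p) ∂μ :=
        lintegral_mono fun x => enn_mul_le_split hp hc0 hct _ _
    _ = ∫⁻ x, min (h x * g k x) (c * h x ^ (p / (p - 1))) ∂μ +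
          c ^ (1 - p) * ∫⁻ x, g k x ^ p ∂μ := by
        rw [lintegral_add_right' _ (((hg k).pow_const _).const_mul _),
          lintegral_const_mul'' _ ((hg k).pow_const _)]
    _ ≤ ε / 2 + c ^ (1 - p) * M := by gcongr; exact hN k hk; exact hgM k
    _ ≤ ε / 2 + ε / 2 := by gcongr
    _ = ε := ENNReal.add_halves ε

lemma lintegral_enorm_rpow_le_of_tendsto {E : Type*} [NormedAddCommGroup E] {p : ℝ}
    {F : ℕ → α → E} {f : α → E} (hF : ∀ k, AEStronglyMeasurable (F k) μ) {M : ℝ≥0∞}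
    (hFM : ∀ k, ∫⁻ x, ‖F k x‖ₑ ^ p ∂μ ≤ M)
    (hlim : ∀ᵐ x ∂μ, Filter.Tendsto (fun k => F k x) Filter.atTop (𝓝 (f x))) :
    ∫⁻ x, ‖f x‖ₑ ^ p ∂μ ≤ M := by
  have h1 : ∀ᵐ x ∂μ, ‖f x‖ₑ ^ p = Filter.liminf (fun k => ‖F k x‖ₑ ^ p) Filter.atTop := by
    filter_upwards [hlim] with x hx
    exact (((ENNReal.continuous_rpow_const.tendsto _).comp hx.enorm).liminf_eq).symm
  rw [lintegral_congr_ae h1]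
  refine (lintegral_liminf_le' fun k => (hF k).enorm.pow_const _).trans ?_
  refine (Filter.liminf_le_liminf (v := fun _ => M) (Filter.Eventually.of_forall hFM)).trans ?_
  simp

lemma enn_add_rpow_le_two_rpow (a b : ℝ≥0∞) {t : ℝ} (ht : 0 ≤ t) :
    (a + b) ^ t ≤ 2 ^ t * (a ^ t + b ^ t) := by
  have h1 : a + b ≤ 2 * max a b := by
    rw [two_mul]; gcongr; exact le_max_left _ _; exact le_max_right _ _
  calc (a + b) ^ t ≤ (2 * max a b) ^ t := ENNReal.rpow_le_rpow h1 ht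
    _ = 2 ^ t * (max a b) ^ t := ENNReal.mul_rpow_of_nonneg _ _ ht
    _ ≤ _ := by
      gcongr
      rcases le_total a b with h | h
      · rw [max_eq_right h]; exact le_add_self
      · rw [max_eq_left h]; exact le_self_add

lemma tendsto_lintegral_mul_enorm_sub {E : Type*} [NormedAddCommGroup E] {p : ℝ} (hp : 1 < p)
    {h : α → ℝ≥0∞} {F : ℕ → α → E} {f : α → E} (hh : AEMeasurable h μ)
    (hF : ∀ k, AEStronglyMeasurable (F k) μ) (hf : AEStronglyMeasurable f μ)
    (hfin : ∫⁻ x, h x ^ (p / (p - 1)) ∂μ ≠ ⊤) {M : ℝ≥0∞} (hM : M ≠ ⊤)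
    (hFM : ∀ k, ∫⁻ x, ‖F k x‖ₑ ^ p ∂μ ≤ M)
    (hlim : ∀ᵐ x ∂μ, Filter.Tendsto (fun k => F k x) Filter.atTop (𝓝 (f x))) :
    Filter.Tendsto (fun k => ∫⁻ x, h x * ‖F k x - f x‖ₑ ∂μ) Filter.atTop (𝓝 0) := by
  have hfM := lintegral_enorm_rpow_le_of_tendsto hF hFM hlim
  refine tendsto_lintegral_mul_of_bounded hp hh (fun k => ((hF k).sub hf).enorm) hfin
    (M := 2 ^ p * (M + M)) ?_ ?_ ?_
  · exact ENNReal.mul_ne_top (ENNReal.rpow_ne_top_of_nonneg (by linarith) (by simp))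
      (ENNReal.add_ne_top.2 ⟨hM, hM⟩)
  · intro k
    calc ∫⁻ x, ‖F k x - f x‖ₑ ^ p ∂μ
        ≤ ∫⁻ x, 2 ^ p * (‖F k x‖ₑ ^ p + ‖f x‖ₑ ^ p) ∂μ := by
          refine lintegral_mono fun x => ?_
          refine (ENNReal.rpow_le_rpow (enorm_sub_le) (by linarith)).trans ?_
          exact enn_add_rpow_le_two_rpow _ _ (by linarith)
      _ = 2 ^ p * (∫⁻ x, ‖F k x‖ₑ ^ p ∂μ + ∫⁻ x, ‖f x‖ₑ ^ p ∂μ) := by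
          rw [lintegral_const_mul' _ _ (ENNReal.rpow_ne_top_of_nonneg (by linarith) (by simp)),
            lintegral_add_left' ((hF k).enorm.pow_const _)]
      _ ≤ _ := by gcongr; exact hFM k
  · filter_upwards [hlim] with x hx
    have : Filter.Tendsto (fun k => F k x - f x) Filter.atTop (𝓝 (f x - f x)) :=
      hx.sub tendsto_const_nhds
    simpa using this.enorm

lemma lintegral_comp_add_smul {n : ℕ} (f : En n → ℝ≥0∞) (a : En n) {τ : ℝ} (hτ : 0 < τ) :
    ∫⁻ z, f (a + τ • z) = ENNReal.ofReal ((τ ^ n)⁻¹) * ∫⁻ z, f z := by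
  have hemb : MeasurableEmbedding (fun z : En n => τ • z) :=
    (Homeomorph.smulOfNeZero τ hτ.ne').measurableEmbedding
  calc ∫⁻ z, f (a + τ • z) = ∫⁻ z, f (a + z) ∂(Measure.map (fun z : En n => τ • z) volume) := by
        rw [hemb.lintegral_map]
    _ = ENNReal.ofReal ((τ ^ n)⁻¹) * ∫⁻ z, f (a + z) := by
        rw [Measure.map_addHaar_smul _ hτ.ne', lintegral_smul_measure, smul_eq_mul,
          finrank_euclideanSpace_fin, abs_of_pos (by positivity)]
    _ = _ := by rw [lintegral_add_left_eq_self]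

lemma integrable_min_one_rpow_mul_norm_rpow {n : ℕ} (hn : 0 < n) {p s : ℝ} (hp : 1 < p)
    (hs0 : 0 < s) (hs1 : s < 1) :
    Integrable (fun h : En n => min 1 ‖h‖ ^ p * ‖h‖ ^ (-((n : ℝ) + p * s))) := by
  have : Nonempty (Fin n) := ⟨⟨0, hn⟩⟩
  rw [integrable_fun_norm_addHaar volume
    (f := fun y : ℝ => min 1 y ^ p * y ^ (-((n : ℝ) + p * s))), finrank_euclideanSpace_fin,
    ← Ioc_union_Ioi_eq_Ioi zero_le_one]
  have hpow : ∀ y : ℝ, y ^ (n - 1) = y ^ ((n : ℝ) - 1) := fun y => by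
    rw [← rpow_natCast, Nat.cast_sub hn]; simp
  have hps : 0 < p * s := by nlinarith
  refine IntegrableOn.union ?_ ?_
  · have hint : IntegrableOn (fun y : ℝ => y ^ (p * (1 - s) - 1)) (Ioc 0 1) := by
      rw [← intervalIntegrable_iff_integrableOn_Ioc_of_le zero_le_one]
      exact intervalIntegral.intervalIntegrable_rpow' (by nlinarith)
    refine hint.congr_fun (fun y hy => ?_) measurableSet_Ioc
    have hy0 : 0 < y := hy.1
    simp only [smul_eq_mul]
    rw [min_eq_right hy.2, hpow, ← rpow_add hy0, ← rpow_add hy0]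
    congr 1; ring
  · have hint : IntegrableOn (fun y : ℝ => y ^ (-1 - p * s)) (Ioi 1) :=
      integrableOn_Ioi_rpow_of_lt (by linarith) zero_lt_one
    refine hint.congr_fun (fun y hy => ?_) measurableSet_Ioi
    have hy1 : 1 < y := hy
    simp only [smul_eq_mul]
    rw [min_eq_left hy1.le, one_rpow, one_mul, hpow, ← rpow_add (by linarith)]
    congr 1; ring

end MeasureTools

section Mollification

lemma lintegral_mul_rpow_le {α : Type*} [MeasurableSpace α] {μ : Measure α} {p : ℝ} (hp : 1 < p)
    {w g : α → ℝ≥0∞} (hw : AEMeasurable w μ) (hg : AEMeasurable g μ) (hw1 : ∫⁻ x, w x ∂μ ≤ 1) :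
    (∫⁻ x, w x * g x ∂μ) ^ p ≤ ∫⁻ x, w x * g x ^ p ∂μ := by
  have hp0 : 0 < p := by linarith
  have hpq : (p / (p - 1)).HolderConjugate p := by
    rw [Real.holderConjugate_iff]
    refine ⟨by rw [lt_div_iff₀] <;> linarith, ?_⟩
    have : p - 1 ≠ 0 := by linarith
    field_simp; ring
  have hq0 : 0 < p / (p - 1) := hpq.pos
  have key := ENNReal.lintegral_mul_le_Lp_mul_Lq μ hpq (f := fun x => w x ^ (1 / (p / (p - 1))))
    (g := fun x => w x ^ (1 / p) * g x) (hw.pow_const _) ((hw.pow_const _).mul hg)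
  have e1 : ∀ x, ((fun x => w x ^ (1 / (p / (p - 1)))) * fun x => w x ^ (1 / p) * g x) x
      = w x * g x := fun x => by
    simp only [Pi.mul_apply]
    rw [← mul_assoc, ← ENNReal.rpow_add_of_nonneg _ _ (by positivity) (by positivity)]
    have := hpq.inv_add_inv_eq_one
    rw [one_div, one_div, this, ENNReal.rpow_one]
  have e2 : ∀ x, (w x ^ (1 / (p / (p - 1)))) ^ (p / (p - 1)) = w x := fun x => by
    rw [← ENNReal.rpow_mul, one_div_mul_cancel hq0.ne', ENNReal.rpow_one]
  have e3 : ∀ x, (w x ^ (1 / p) * g x) ^ p = w x * g x ^ p := fun x => by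
    rw [ENNReal.mul_rpow_of_nonneg _ _ hp0.le, ← ENNReal.rpow_mul, one_div_mul_cancel hp0.ne',
      ENNReal.rpow_one]
  simp only [e1, e2, e3] at key
  calc (∫⁻ x, w x * g x ∂μ) ^ p
      ≤ ((∫⁻ x, w x ∂μ) ^ (1 / (p / (p - 1))) * (∫⁻ x, w x * g x ^ p ∂μ) ^ (1 / p)) ^ p := by
        gcongr
    _ ≤ (1 * (∫⁻ x, w x * g x ^ p ∂μ) ^ (1 / p)) ^ p := by
        gcongr
        exact ENNReal.rpow_le_one hw1 (by positivity)
    _ = _ := by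
        rw [one_mul, ← ENNReal.rpow_mul, one_div_mul_cancel hp0.ne', ENNReal.rpow_one]

variable {E : Type*} [NormedAddCommGroup E] [NormedSpace ℝ E] {n : ℕ}

/-- Convolution of `g` with the kernel `ψ`. -/
def mollify (ψ : En n → ℝ) (g : En n → E) (x : En n) : E := ∫ t, ψ (x - t) • g t

lemma lintegral_enorm_mollify_rpow_le {p : ℝ} (hp : 1 < p) {ψ : En n → ℝ} (hψ : Continuous ψ)
    (hψ1 : ∫⁻ x, ‖ψ x‖ₑ ≤ 1) {g : En n → E} (hg : AEStronglyMeasurable g) :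
    ∫⁻ x, ‖mollify ψ g x‖ₑ ^ p ≤ ∫⁻ x, ‖g x‖ₑ ^ p := by
  have hp0 : 0 < p := by linarith
  calc ∫⁻ x, ‖mollify ψ g x‖ₑ ^ p
      ≤ ∫⁻ x, ∫⁻ t, ‖ψ (x - t)‖ₑ * ‖g t‖ₑ ^ p := by
        refine lintegral_mono fun x => ?_
        calc ‖mollify ψ g x‖ₑ ^ p ≤ (∫⁻ t, ‖ψ (x - t)‖ₑ * ‖g t‖ₑ) ^ p := by
              gcongr
              refine (enorm_integral_le_lintegral_enorm _).trans (le_of_eq ?_)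
              simp_rw [enorm_smul]
          _ ≤ _ := by
              refine lintegral_mul_rpow_le hp ?_ hg.enorm ?_
              · exact (hψ.comp (continuous_const.sub continuous_id)).enorm.measurable.aemeasurable
              · rwa [lintegral_sub_left_eq_self (fun t => ‖ψ t‖ₑ) x]
    _ = ∫⁻ t, ∫⁻ x, ‖ψ (x - t)‖ₑ * ‖g t‖ₑ ^ p := by
        refine lintegral_lintegral_swap ?_
        refine AEMeasurable.mul ?_ ((hg.enorm.pow_const p).comp_snd)
        exact (hψ.comp (continuous_fst.sub continuous_snd)).enorm.measurable.aemeasurable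
    _ ≤ ∫⁻ x, ‖g x‖ₑ ^ p := by
        refine lintegral_mono fun t => ?_
        have hm : Measurable fun x => ‖ψ (x - t)‖ₑ :=
          (hψ.comp (continuous_id.sub continuous_const)).enorm.measurable
        rw [lintegral_mul_const _ hm,
          lintegral_sub_right_eq_self (fun x => ‖ψ x‖ₑ) t]
        exact mul_le_of_le_one_left (by positivity) hψ1

lemma mollify_eq_convolution (ψ : En n → ℝ) (g : En n → E) (x : En n) :
    mollify ψ g x = (convolution ψ g (ContinuousLinearMap.lsmul ℝ ℝ) volume) x :=
  convolution_lsmul_swap.symm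

lemma mollify_eq_convolution_right (ψ g : En n → ℝ) (x : En n) :
    mollify ψ g x = (convolution g ψ (ContinuousLinearMap.lsmul ℝ ℝ) volume) x := by
  simp only [mollify, convolution_def, ContinuousLinearMap.lsmul_apply, smul_eq_mul, mul_comm]

lemma contDiff_mollify {ψ g : En n → ℝ} (hψ : ContDiff ℝ (⊤ : ℕ∞) ψ) (hc : HasCompactSupport ψ)
    (hg : LocallyIntegrable g) : ContDiff ℝ (⊤ : ℕ∞) (mollify ψ g) := by
  have : mollify ψ g = convolution g ψ (ContinuousLinearMap.lsmul ℝ ℝ) volume :=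
    funext (mollify_eq_convolution_right ψ g)
  rw [this]
  exact hc.contDiff_convolution_right _ hg hψ

lemma gradient_mollify {ψ : En n → ℝ} (hψ : ContDiff ℝ (⊤ : ℕ∞) ψ) (hc : HasCompactSupport ψ)
    {u : En n → ℝ} {G : En n → En n} {U : Set (En n)} (hU : MeasurableSet U)
    (hu : IntegrableOn u U) (huG : HasWeakGradOn u G U) {x : En n}
    (hx : ∀ t, t ∈ tsupport (fun t => ψ (x - t)) → t ∈ U) :
    gradient (mollify ψ (U.indicator u)) x = mollify ψ (U.indicator G) x := by
  have hui : Integrable (U.indicator u) := hu.integrable_indicator hU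
  have hφ : TestFun U (fun t => ψ (x - t)) := by
    refine ⟨hψ.comp (contDiff_const.sub contDiff_id), ?_, hx⟩
    exact hc.comp_homeomorph (Homeomorph.subLeft x)
  have hd := hc.hasFDerivAt_convolution_right (ContinuousLinearMap.lsmul ℝ ℝ)
    hui.locallyIntegrable (hψ.of_le (by exact_mod_cast le_top)) x
  have heq : mollify ψ (U.indicator u)
      = convolution (U.indicator u) ψ (ContinuousLinearMap.lsmul ℝ ℝ) volume :=
    funext (mollify_eq_convolution_right ψ _)
  rw [← heq] at hd
  have hgradφ : ∀ t, gradient (fun t => ψ (x - t)) t = - gradient ψ (x - t) := fun t => by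
    have h1 : HasFDerivAt ψ (fderiv ℝ ψ (x - t)) (x - t) :=
      (hψ.differentiable (by simp) _).hasFDerivAt
    have h2 : HasFDerivAt (fun t => ψ (x - t))
        ((fderiv ℝ ψ (x - t)).comp (-ContinuousLinearMap.id ℝ (En n))) t :=
      h1.comp t ((hasFDerivAt_id t).const_sub x)
    rw [gradient, h2.fderiv, gradient, ← map_neg]
    congr 1
    ext v; simp
  have hgψ : ∀ t, t ∉ U → gradient ψ (x - t) = 0 := fun t ht => by
    have h1 : t ∉ tsupport (fun t => ψ (x - t)) := fun h => ht (hx t h)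
    have h2 : (fun t => ψ (x - t)) =ᶠ[𝓝 t] 0 := notMem_tsupport_iff_eventuallyEq.1 h1
    have h3 : gradient (fun t => ψ (x - t)) t = 0 := by
      rw [gradient, h2.fderiv_eq]; simp
    rw [hgradφ] at h3
    simpa using h3
  have key := huG _ hφ
  have hR : ∫ t, ψ (x - t) • G t = mollify ψ (U.indicator G) x := by
    refine integral_congr_ae (Filter.Eventually.of_forall fun t => ?_)
    by_cases ht : t ∈ U
    · simp [ht]
    · have : ψ (x - t) = 0 := by
        by_contra hne
        exact ht (hx t (subset_tsupport _ hne))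
      simp [this]
  have hL : ∫ t, u t • gradient (fun t => ψ (x - t)) t
      = - ∫ t, U.indicator u t • gradient ψ (x - t) := by
    rw [← integral_neg]
    refine integral_congr_ae (Filter.Eventually.of_forall fun t => ?_)
    by_cases ht : t ∈ U
    · simp [ht, hgradφ]
    · simp [ht, hgradφ, hgψ t ht]
  rw [hL, hR, neg_inj] at key
  have hcf : Continuous (fderiv ℝ ψ) := hψ.continuous_fderiv (by simp)
  rw [gradient, hd.fderiv, ← key]
  have e : (convolution (U.indicator u) (fderiv ℝ ψ)
      (ContinuousLinearMap.precompR (En n) (ContinuousLinearMap.lsmul ℝ ℝ)) volume) x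
      = ∫ t, U.indicator u t • fderiv ℝ ψ (x - t) := by
    rw [convolution_def]
    congr 1
  rw [e]
  have hint : Integrable fun t => U.indicator u t • fderiv ℝ ψ (x - t) :=
    HasCompactSupport.convolutionExists_right
      (ContinuousLinearMap.lsmul ℝ ℝ : ℝ →L[ℝ] (En n →L[ℝ] ℝ) →L[ℝ] (En n →L[ℝ] ℝ))
      (hc.fderiv ℝ) hui.locallyIntegrable hcf x
  have := ContinuousLinearMap.integral_comp_commSL (σ := starRingEnd ℝ) (by simp)
    ((InnerProductSpace.toDual ℝ (En n)).symm.toContinuousLinearEquiv.toContinuousLinearMap) hint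
  refine Eq.trans this.symm ?_
  refine integral_congr_ae (Filter.Eventually.of_forall fun t => ?_)
  simp [gradient]

end Mollification

lemma exists_smooth_approx {n : ℕ} {p : ℝ} (hp : 1 < p) {x₀ : En n} {r : ℝ} (hr : 0 < r)
    {u : En n → ℝ} {G : En n → En n} (huG : HasWeakGradOn u G (ball x₀ (2 * r)))
    (hu : IntegrableOn u (ball x₀ (2 * r))) (hG : IntegrableOn G (ball x₀ (2 * r)))
    (hu0 : ∀ x ∈ ball x₀ (2 * r), 0 ≤ u x) :
    ∃ v : ℕ → En n → ℝ, (∀ k, ContDiff ℝ (⊤ : ℕ∞) (v k)) ∧ (∀ k x, 0 ≤ v k x) ∧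
      (∀ᵐ x, x ∈ ball x₀ (7 * r / 4) →
        Filter.Tendsto (fun k => v k x) Filter.atTop (𝓝 (u x))) ∧
      (∀ᵐ x, x ∈ ball x₀ (7 * r / 4) →
        Filter.Tendsto (fun k => gradient (v k) x) Filter.atTop (𝓝 (G x))) ∧
      ∀ k, ∫⁻ x in ball x₀ (7 * r / 4), ‖gradient (v k) x‖ₑ ^ p
        ≤ ∫⁻ x in ball x₀ (2 * r), ‖G x‖ₑ ^ p := by
  set U := ball x₀ (2 * r) with hU
  have hp0 : 0 < p := by linarith
  let b : ℕ → ContDiffBump (0 : En n) := fun k =>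
    { rIn := r / (8 * (k + 1))
      rOut := r / (4 * (k + 1))
      rIn_pos := by positivity
      rIn_lt_rOut := by
        apply div_lt_div_of_pos_left hr <;> nlinarith [(Nat.cast_nonneg k : (0:ℝ) ≤ k)] }
  have hrout : ∀ k, (b k).rOut = r / (4 * (k + 1)) := fun k => rfl
  have hrin : ∀ k, (b k).rIn = r / (8 * (k + 1)) := fun k => rfl
  have hout : Filter.Tendsto (fun k => (b k).rOut) Filter.atTop (𝓝 0) := by
    have h1 := (tendsto_one_div_add_atTop_nhds_zero_nat (𝕜 := ℝ)).const_mul (r / 4)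
    rw [mul_zero] at h1
    refine h1.congr fun k => ?_
    rw [hrout]; field_simp
  have hratio : ∀ᶠ k in Filter.atTop, (b k).rOut ≤ 2 * (b k).rIn :=
    Filter.Eventually.of_forall fun k => by
      rw [hrout, hrin]; apply le_of_eq; field_simp; norm_num
  let ψ : ℕ → En n → ℝ := fun k => (b k).normed volume
  have hψ : ∀ k, ContDiff ℝ (⊤ : ℕ∞) (ψ k) := fun k => (b k).contDiff_normed
  have hψc : ∀ k, HasCompactSupport (ψ k) := fun k => (b k).hasCompactSupport_normed
  have hψ0 : ∀ k x, 0 ≤ ψ k x := fun k x => (b k).nonneg_normed x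
  have hψ1 : ∀ k, ∫⁻ x, ‖ψ k x‖ₑ ≤ 1 := fun k => by
    have h1 : ∫⁻ x, ‖ψ k x‖ₑ = ENNReal.ofReal (∫ x, ψ k x) := by
      rw [ofReal_integral_eq_lintegral_ofReal (b k).integrable_normed
        (Filter.Eventually.of_forall (hψ0 k))]
      exact lintegral_congr fun x => Real.enorm_of_nonneg (hψ0 k x)
    rw [h1, (b k).integral_normed, ENNReal.ofReal_one]
  have hui : Integrable (U.indicator u) := hu.integrable_indicator measurableSet_ball
  have hGi : Integrable (U.indicator G) := hG.integrable_indicator measurableSet_ball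
  have hsub : ∀ x ∈ ball x₀ (7 * r / 4), x ∈ U := fun x hx =>
    ball_subset_ball (by linarith) hx
  have hgrad : ∀ k, ∀ x ∈ ball x₀ (7 * r / 4),
      gradient (mollify (ψ k) (U.indicator u)) x = mollify (ψ k) (U.indicator G) x := by
    intro k x hx
    refine gradient_mollify (hψ k) (hψc k) measurableSet_ball hu huG fun t ht => ?_
    have h1 : t ∈ closedBall x (b k).rOut := by
      have h2 : Function.support (fun t => ψ k (x - t)) ⊆ closedBall x (b k).rOut := by
        intro t ht
        have h3 : x - t ∈ Function.support (ψ k) := ht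
        rw [(b k).support_normed_eq, mem_ball_zero_iff] at h3
        rw [mem_closedBall, dist_comm, dist_eq_norm]
        exact h3.le
      exact closure_minimal h2 isClosed_closedBall ht
    have h3 : (b k).rOut ≤ r / 4 := by
      rw [hrout]
      apply div_le_div_of_nonneg_left hr.le (by norm_num)
      linarith [(Nat.cast_nonneg k : (0:ℝ) ≤ k)]
    rw [mem_closedBall] at h1
    rw [mem_ball] at hx
    rw [mem_ball]
    linarith [dist_triangle t x x₀]
  refine ⟨fun k => mollify (ψ k) (U.indicator u), fun k => contDiff_mollify (hψ k) (hψc k)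
    hui.locallyIntegrable, fun k x => ?_, ?_, ?_, fun k => ?_⟩
  · refine integral_nonneg fun t => smul_nonneg (hψ0 k _) ?_
    exact indicator_nonneg hu0 t
  · filter_upwards [ContDiffBump.ae_convolution_tendsto_right_of_locallyIntegrable hout hratio
      hui.locallyIntegrable] with x hx hxU
    rw [indicator_of_mem (hsub x hxU)] at hx
    exact hx.congr fun k => (mollify_eq_convolution _ _ _).symm
  · filter_upwards [ContDiffBump.ae_convolution_tendsto_right_of_locallyIntegrable hout hratio
      hGi.locallyIntegrable] with x hx hxU
    rw [indicator_of_mem (hsub x hxU)] at hx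
    refine hx.congr fun k => ?_
    rw [hgrad k x hxU, mollify_eq_convolution]
  · calc ∫⁻ x in ball x₀ (7 * r / 4), ‖gradient (mollify (ψ k) (U.indicator u)) x‖ₑ ^ p
        = ∫⁻ x in ball x₀ (7 * r / 4), ‖mollify (ψ k) (U.indicator G) x‖ₑ ^ p :=
          setLIntegral_congr_fun measurableSet_ball fun x hx => by
            simp only [hgrad k x hx]
      _ ≤ ∫⁻ x, ‖mollify (ψ k) (U.indicator G) x‖ₑ ^ p := setLIntegral_le_lintegral _ _
      _ ≤ ∫⁻ x, ‖U.indicator G x‖ₑ ^ p :=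
          lintegral_enorm_mollify_rpow_le hp (hψ k).continuous (hψ1 k) hGi.1
      _ = ∫⁻ x, U.indicator (fun x => ‖G x‖ₑ ^ p) x := by
          refine lintegral_congr fun x => ?_
          by_cases hx : x ∈ U <;> simp [hx, hp0]
      _ = _ := lintegral_indicator measurableSet_ball _

section Segments

variable {n : ℕ}

lemma continuous_gradient {f : En n → ℝ} (hf : ContDiff ℝ (⊤ : ℕ∞) f) :
    Continuous (gradient f) :=
  (InnerProductSpace.toDual ℝ (En n)).symm.continuous.comp (hf.continuous_fderiv (by simp))

lemma fderiv_apply_eq_inner_gradient (f : En n → ℝ) (x v : En n) :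
    fderiv ℝ f x v = ⟪gradient f x, v⟫ := by
  rw [inner_gradient_left]

lemma enorm_sub_le_lintegral_segment {f : En n → ℝ} (hf : ContDiff ℝ (⊤ : ℕ∞) f) (x y : En n) :
    ‖f x - f y‖ₑ ≤ ‖x - y‖ₑ * ∫⁻ t in Ioo (0 : ℝ) 1, ‖gradient f (x + t • (y - x))‖ₑ := by
  have hl : ∀ t : ℝ, HasDerivAt (fun t : ℝ => x + t • (y - x)) (y - x) t := fun t => by
    simpa using ((hasDerivAt_id t).smul_const (y - x)).const_add x
  have hd : ∀ t : ℝ, HasDerivAt (fun t : ℝ => f (x + t • (y - x)))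
      (⟪gradient f (x + t • (y - x)), y - x⟫) t := fun t => by
    rw [← fderiv_apply_eq_inner_gradient]
    exact ((hf.differentiable (by simp) _).hasFDerivAt).comp_hasDerivAt t (hl t)
  have hc : Continuous fun t : ℝ => gradient f (x + t • (y - x)) :=
    (continuous_gradient hf).comp (by fun_prop)
  have hint := intervalIntegral.integral_eq_sub_of_hasDerivAt (a := 0) (b := 1)
    (fun t _ => hd t) ((hc.inner continuous_const).intervalIntegrable _ _)
  simp only [one_smul, add_sub_cancel, zero_smul, add_zero] at hint
  rw [enorm_sub_rev, ← hint, intervalIntegral.integral_of_le zero_le_one,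
    integral_Ioc_eq_integral_Ioo,
    ← lintegral_const_mul _ hc.enorm.measurable]
  refine (enorm_integral_le_lintegral_enorm _).trans (lintegral_mono fun t => ?_)
  rw [mul_comm, enorm_sub_rev x y]
  rw [← ofReal_norm, ← ofReal_norm, ← ofReal_norm, ← ENNReal.ofReal_mul (norm_nonneg _)]
  exact ENNReal.ofReal_le_ofReal (norm_inner_le_norm _ _)

/-- The averaged Riesz-type potential of `g` over the ball `B = ball x₀ r`, restricted to
segment parameters in `T`. -/
def segPot (x₀ : En n) (r : ℝ) (T : Set ℝ) (g : En n → ℝ≥0∞) (x : En n) : ℝ≥0∞ :=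
  (volume (ball x₀ r))⁻¹ *
    ∫⁻ z in ball x₀ r, ∫⁻ t in T, ENNReal.ofReal (2 * r) * g (x + t • (z - x))

variable {x₀ : En n} {r : ℝ}

lemma measurable_segment_comp {g : En n → ℝ≥0∞} (hg : Measurable g) :
    Measurable fun q : En n × En n × ℝ =>
      ENNReal.ofReal (2 * r) * g (q.1 + q.2.2 • (q.2.1 - q.1)) :=
  (hg.comp (by fun_prop)).const_mul _

lemma measurable_segPot (T : Set ℝ) {g : En n → ℝ≥0∞} (hg : Measurable g) :
    Measurable (segPot x₀ r T g) := by
  refine Measurable.const_mul ?_ _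
  have h1 : Measurable fun q : (En n × En n) × ℝ =>
      ENNReal.ofReal (2 * r) * g (q.1.1 + q.2 • (q.1.2 - q.1.1)) :=
    (hg.comp (by fun_prop)).const_mul _
  have h2 : Measurable fun q : En n × En n =>
      ∫⁻ t in T, ENNReal.ofReal (2 * r) * g (q.1 + t • (q.2 - q.1)) :=
    h1.lintegral_prod_right'
  exact h2.lintegral_prod_right'

lemma segment_mem_ball {x z : En n} (hx : x ∈ ball x₀ r) (hz : z ∈ ball x₀ r) {t : ℝ}
    (ht : t ∈ Ioo (0 : ℝ) 1) : x + t • (z - x) ∈ ball x₀ r :=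
  (convex_ball x₀ r).add_smul_sub_mem hx hz ⟨ht.1.le, ht.2.le⟩

lemma volume_ball_pos_lt_top (hr : 0 < r) :
    volume (ball x₀ r) ≠ 0 ∧ volume (ball x₀ r) ≠ ⊤ :=
  ⟨(measure_ball_pos _ _ hr).ne', measure_ball_lt_top.ne⟩

lemma enorm_sub_le_segPot_add_segPot (hr : 0 < r) {f : En n → ℝ} (hf : ContDiff ℝ (⊤ : ℕ∞) f)
    {g : En n → ℝ≥0∞} (hg : Measurable g) (hfg : ∀ z, ‖gradient f z‖ₑ ≤ g z) {x y : En n}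
    (hx : x ∈ ball x₀ r) (hy : y ∈ ball x₀ r) :
    ‖f x - f y‖ₑ ≤ segPot x₀ r (Ioo 0 1) g x + segPot x₀ r (Ioo 0 1) g y := by
  obtain ⟨hB0, hBt⟩ := volume_ball_pos_lt_top (x₀ := x₀) hr
  have h1 : ∀ a ∈ ball x₀ r, ∀ z ∈ ball x₀ r, ‖f a - f z‖ₑ ≤
      ∫⁻ t in Ioo (0 : ℝ) 1, ENNReal.ofReal (2 * r) * g (a + t • (z - a)) := by
    intro a ha z hz
    have hm : Measurable fun t : ℝ => g (a + t • (z - a)) := hg.comp (by fun_prop)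
    rw [lintegral_const_mul _ hm]
    refine (enorm_sub_le_lintegral_segment hf a z).trans ?_
    gcongr with t
    · rw [← ofReal_norm]
      apply ENNReal.ofReal_le_ofReal
      rw [mem_ball] at ha hz
      rw [← dist_eq_norm]
      linarith [dist_triangle_right a z x₀]
    · exact hfg _
  have h2 : ∀ z ∈ ball x₀ r, ‖f x - f y‖ₑ ≤
      (∫⁻ t in Ioo (0 : ℝ) 1, ENNReal.ofReal (2 * r) * g (x + t • (z - x))) +
      ∫⁻ t in Ioo (0 : ℝ) 1, ENNReal.ofReal (2 * r) * g (y + t • (z - y)) := by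
    intro z hz
    have : f x - f y = (f x - f z) - (f y - f z) := by ring
    rw [this]
    exact (enorm_sub_le).trans (add_le_add (h1 x hx z hz) (h1 y hy z hz))
  have hm : Measurable fun z : En n =>
      ∫⁻ t in Ioo (0 : ℝ) 1, ENNReal.ofReal (2 * r) * g (x + t • (z - x)) := by
    have : Measurable fun q : En n × ℝ => ENNReal.ofReal (2 * r) * g (x + q.2 • (q.1 - x)) :=
      (hg.comp (by fun_prop)).const_mul _
    exact this.lintegral_prod_right'
  rw [segPot, segPot, ← mul_add, ← lintegral_add_left hm]
  calc ‖f x - f y‖ₑ = (volume (ball x₀ r))⁻¹ * ∫⁻ z in ball x₀ r, ‖f x - f y‖ₑ := by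
        rw [setLIntegral_const, mul_comm, mul_assoc, ENNReal.mul_inv_cancel hB0 hBt, mul_one]
    _ ≤ _ := by
        gcongr 1
        exact setLIntegral_mono' measurableSet_ball h2

lemma lintegral_ball_segment_le {e : En n → ℝ≥0∞} (he : Measurable e) {t : ℝ}
    (ht : t ∈ Ioo (0 : ℝ) 1) :
    ∫⁻ x in ball x₀ r, ∫⁻ z in ball x₀ r, e (x + t • (z - x))
      ≤ 2 ^ n * volume (ball x₀ r) * ∫⁻ x in ball x₀ r, e x := by
  set B := ball x₀ r
  have hBm : MeasurableSet B := measurableSet_ball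
  let e' := B.indicator e
  have he' : Measurable e' := he.indicator hBm
  have hfac : ∀ τ : ℝ, 1 / 2 ≤ τ → ENNReal.ofReal ((τ ^ n)⁻¹) ≤ 2 ^ n := fun τ hτ => by
    have h2 : (2 : ℝ≥0∞) ^ n = ENNReal.ofReal (2 ^ n) := by
      rw [ENNReal.ofReal_pow (by norm_num)]; norm_num
    rw [h2, ← inv_pow]
    apply ENNReal.ofReal_le_ofReal
    have : τ⁻¹ ≤ 2 := by
      rw [inv_le_comm₀ (by linarith) (by norm_num)]; linarith
    exact pow_le_pow_left₀ (by rw [inv_nonneg]; linarith) this n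
  have hind : ∫⁻ x, e' x = ∫⁻ x in B, e x := lintegral_indicator hBm _
  have step : ∀ (a : En n) (τ : ℝ), 1 / 2 ≤ τ → ∫⁻ z in B, e' (a + τ • z)
      ≤ 2 ^ n * ∫⁻ x in B, e x := fun a τ hτ => by
    refine (setLIntegral_le_lintegral _ _).trans ?_
    rw [lintegral_comp_add_smul e' a (by linarith), hind]
    gcongr
    exact hfac τ hτ
  have hrep : ∀ x ∈ B, ∀ z ∈ B, e (x + t • (z - x)) = e' (x + t • (z - x)) := fun x hx z hz =>
    (indicator_of_mem (segment_mem_ball hx hz ht) e).symm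
  have hle : ∫⁻ x in B, ∫⁻ z in B, e (x + t • (z - x))
      = ∫⁻ x in B, ∫⁻ z in B, e' (x + t • (z - x)) :=
    setLIntegral_congr_fun hBm fun x hx => setLIntegral_congr_fun hBm fun z hz => hrep x hx z hz
  rw [hle]
  rcases le_total (1 / 2) t with h | h
  · calc ∫⁻ x in B, ∫⁻ z in B, e' (x + t • (z - x))
        ≤ ∫⁻ _ in B, 2 ^ n * ∫⁻ x in B, e x := by
          refine lintegral_mono fun x => ?_
          refine le_trans (le_of_eq ?_) (step (x - t • x) t h)
          refine lintegral_congr fun z => ?_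
          congr 1; rw [smul_sub]; abel
      _ = _ := by rw [setLIntegral_const]; ring
  · rw [lintegral_lintegral_swap (by
      refine Measurable.aemeasurable ?_
      exact he'.comp (by fun_prop))]
    calc ∫⁻ z in B, ∫⁻ x in B, e' (x + t • (z - x))
        ≤ ∫⁻ _ in B, 2 ^ n * ∫⁻ x in B, e x := by
          refine lintegral_mono fun z => ?_
          refine le_trans (le_of_eq ?_) (step (t • z) (1 - t) (by linarith))
          refine lintegral_congr fun x => ?_
          congr 1; rw [smul_sub, sub_smul, one_smul]; abel
      _ = _ := by rw [setLIntegral_const]; ring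

lemma lintegral_segPot_le (hr : 0 < r) {T : Set ℝ} (hT : MeasurableSet T)
    (hT1 : T ⊆ Ioo 0 1) {e : En n → ℝ≥0∞}
    (he : Measurable e) : ∫⁻ x in ball x₀ r, segPot x₀ r T e x
      ≤ volume T * (2 ^ n * ENNReal.ofReal (2 * r)) * ∫⁻ x in ball x₀ r, e x := by
  obtain ⟨hB0, hBt⟩ := volume_ball_pos_lt_top (x₀ := x₀) hr
  have hm3 := measurable_segment_comp (r := r) he
  have h1 : Measurable fun q : (En n × En n) × ℝ =>
      ENNReal.ofReal (2 * r) * e (q.1.1 + q.2 • (q.1.2 - q.1.1)) :=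
    (he.comp (by fun_prop)).const_mul _
  have h2 : Measurable fun q : En n × En n =>
      ∫⁻ t in T, ENNReal.ofReal (2 * r) * e (q.1 + t • (q.2 - q.1)) := h1.lintegral_prod_right'
  have swap1 : ∀ x : En n,
      ∫⁻ z in ball x₀ r, ∫⁻ t in T, ENNReal.ofReal (2 * r) * e (x + t • (z - x))
      = ∫⁻ t in T, ∫⁻ z in ball x₀ r, ENNReal.ofReal (2 * r) * e (x + t • (z - x)) := fun x => by
    refine lintegral_lintegral_swap (Measurable.aemeasurable ?_)
    exact (he.comp (by fun_prop)).const_mul _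
  have swap2 : ∫⁻ x in ball x₀ r, ∫⁻ t in T, ∫⁻ z in ball x₀ r,
      ENNReal.ofReal (2 * r) * e (x + t • (z - x))
      = ∫⁻ t in T, ∫⁻ x in ball x₀ r, ∫⁻ z in ball x₀ r,
        ENNReal.ofReal (2 * r) * e (x + t • (z - x)) := by
    refine lintegral_lintegral_swap (Measurable.aemeasurable ?_)
    have h3 : Measurable fun q : (En n × ℝ) × En n =>
      ENNReal.ofReal (2 * r) * e (q.1.1 + q.1.2 • (q.2 - q.1.1)) :=
      (he.comp (by fun_prop)).const_mul _
    exact h3.lintegral_prod_right'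
  simp only [segPot]
  rw [lintegral_const_mul _ h2.lintegral_prod_right']
  simp_rw [swap1]
  rw [swap2]
  calc (volume (ball x₀ r))⁻¹ * ∫⁻ t in T, ∫⁻ x in ball x₀ r, ∫⁻ z in ball x₀ r,
        ENNReal.ofReal (2 * r) * e (x + t • (z - x))
      ≤ (volume (ball x₀ r))⁻¹ * ∫⁻ _ in T, ENNReal.ofReal (2 * r) *
        (2 ^ n * volume (ball x₀ r) * ∫⁻ x in ball x₀ r, e x) := by
        gcongr 1
        refine setLIntegral_mono' hT fun t ht => ?_
        have hmz : ∀ x : En n, Measurable fun z => e (x + t • (z - x)) :=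
          fun x => he.comp (by fun_prop)
        have hmx : Measurable fun q : En n × En n => e (q.1 + t • (q.2 - q.1)) :=
          he.comp (by fun_prop)
        simp_rw [fun x => lintegral_const_mul (μ := volume.restrict (ball x₀ r))
          (ENNReal.ofReal (2 * r)) (hmz x)]
        rw [lintegral_const_mul _ hmx.lintegral_prod_right']
        gcongr
        exact lintegral_ball_segment_le he (hT1 ht)
    _ = (volume (ball x₀ r))⁻¹ * volume (ball x₀ r) *
          (volume T * (2 ^ n * ENNReal.ofReal (2 * r)) * ∫⁻ x in ball x₀ r, e x) := by
        rw [setLIntegral_const]; ring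
    _ = _ := by rw [ENNReal.inv_mul_cancel hB0 hBt, one_mul]

end Segments

section Exponential

lemma exists_subseq_tendsto_ae_zero {α : Type*} [MeasurableSpace α] {μ : Measure α}
    {F : ℕ → α → ℝ≥0∞} (hF : ∀ k, AEMeasurable (F k) μ)
    (h : Filter.Tendsto (fun k => ∫⁻ x, F k x ∂μ) Filter.atTop (𝓝 0)) :
    ∃ φ : ℕ → ℕ, StrictMono φ ∧
      ∀ᵐ x ∂μ, Filter.Tendsto (fun j => F (φ j) x) Filter.atTop (𝓝 0) := by
  obtain ⟨φ, hφ, hle⟩ := Filter.extraction_forall_of_eventually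
    (P := fun j k => ∫⁻ x, F k x ∂μ ≤ (2⁻¹ : ℝ≥0∞) ^ j) fun j =>
      h.eventually_le_const (ENNReal.pow_pos (by simp) j)
  refine ⟨φ, hφ, ?_⟩
  have hsum : ∫⁻ x, ∑' j, F (φ j) x ∂μ ≠ ⊤ := by
    rw [lintegral_tsum fun j => hF _]
    refine ne_top_of_le_ne_top ?_ (ENNReal.tsum_le_tsum hle)
    rw [ENNReal.tsum_geometric]
    simp
  filter_upwards [ae_lt_top' (AEMeasurable.tsum fun j => hF _) hsum] with x hx
  exact ENNReal.tendsto_atTop_zero_of_tsum_ne_top hx.ne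

variable {n : ℕ} {x₀ : En n} {r : ℝ}

lemma segPot_add (T : Set ℝ) {g e : En n → ℝ≥0∞} (hg : Measurable g) (x : En n) :
    segPot x₀ r T (fun z => g z + e z) x = segPot x₀ r T g x + segPot x₀ r T e x := by
  have h2 : Measurable fun q : En n × ℝ =>
      ENNReal.ofReal (2 * r) * g (x + q.2 • (q.1 - x)) :=
    (hg.comp (by fun_prop)).const_mul _
  have h3 : ∀ z : En n, Measurable fun t : ℝ => ENNReal.ofReal (2 * r) * g (x + t • (z - x)) :=
    fun z => (hg.comp (by fun_prop)).const_mul _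
  simp only [segPot]
  rw [← mul_add, ← lintegral_add_left h2.lintegral_prod_right']
  congr 1
  refine lintegral_congr fun z => ?_
  rw [← lintegral_add_left (h3 z)]
  simp only [mul_add]

lemma exists_ae_enorm_sub_le_segPot (hr : 0 < r) {W : ℕ → En n → ℝ}
    (hW : ∀ k, ContDiff ℝ (⊤ : ℕ∞) (W k)) {w : En n → ℝ}
    (hlim : ∀ᵐ x ∂volume.restrict (ball x₀ r),
      Filter.Tendsto (fun k => W k x) Filter.atTop (𝓝 (w x)))
    {H : En n → En n} (hH : Measurable H)
    (hint : Filter.Tendsto (fun k => ∫⁻ x in ball x₀ r, ‖gradient (W k) x - H x‖ₑ)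
      Filter.atTop (𝓝 0)) :
    ∃ S : Set (En n), (∀ᵐ x ∂volume.restrict (ball x₀ r), x ∈ S) ∧ ∀ x ∈ S, ∀ y ∈ S,
      ‖w x - w y‖ₑ ≤ segPot x₀ r (Ioo 0 1) (fun z => ‖H z‖ₑ) x
        + segPot x₀ r (Ioo 0 1) (fun z => ‖H z‖ₑ) y := by
  let e : ℕ → En n → ℝ≥0∞ := fun k x => ‖gradient (W k) x - H x‖ₑ
  have he : ∀ k, Measurable (e k) := fun k =>
    ((continuous_gradient (hW k)).measurable.sub hH).enorm
  have hV : Filter.Tendsto (fun k => ∫⁻ x in ball x₀ r, segPot x₀ r (Ioo 0 1) (e k) x)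
      Filter.atTop (𝓝 0) := by
    have h1 : Filter.Tendsto (fun k => volume (Ioo (0:ℝ) 1) * (2 ^ n * ENNReal.ofReal (2 * r)) *
        ∫⁻ x in ball x₀ r, e k x) Filter.atTop (𝓝 0) := by
      have h2 : volume (Ioo (0:ℝ) 1) * (2 ^ n * ENNReal.ofReal (2 * r)) ≠ ⊤ := by
        refine ENNReal.mul_ne_top (by simp) (ENNReal.mul_ne_top ?_ ENNReal.ofReal_ne_top)
        exact ENNReal.pow_ne_top (by simp)
      simpa using ENNReal.Tendsto.const_mul hint (Or.inr h2)
    exact tendsto_of_tendsto_of_tendsto_of_le_of_le tendsto_const_nhds h1 (fun _ => bot_le)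
      fun k => lintegral_segPot_le hr measurableSet_Ioo Subset.rfl (he k)
  obtain ⟨φ, hφ, hae⟩ := exists_subseq_tendsto_ae_zero
    (fun k => (measurable_segPot (Ioo 0 1) (he k)).aemeasurable) hV
  refine ⟨{x | x ∈ ball x₀ r ∧ Filter.Tendsto (fun k => W k x) Filter.atTop (𝓝 (w x)) ∧
    Filter.Tendsto (fun j => segPot x₀ r (Ioo 0 1) (e (φ j)) x) Filter.atTop (𝓝 0)}, ?_, ?_⟩
  · filter_upwards [hlim, hae, ae_restrict_mem measurableSet_ball] with x h1 h2 h3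
    exact ⟨h3, h1, h2⟩
  · rintro x ⟨hxB, hxW, hxV⟩ y ⟨hyB, hyW, hyV⟩
    set g : En n → ℝ≥0∞ := fun z => ‖H z‖ₑ
    have hg : Measurable g := hH.enorm
    have h1 : ∀ j, ‖W (φ j) x - W (φ j) y‖ₑ ≤
        (segPot x₀ r (Ioo 0 1) g x + segPot x₀ r (Ioo 0 1) (e (φ j)) x) +
        (segPot x₀ r (Ioo 0 1) g y + segPot x₀ r (Ioo 0 1) (e (φ j)) y) := fun j => by
      rw [← segPot_add _ hg, ← segPot_add _ hg]
      refine enorm_sub_le_segPot_add_segPot hr (hW _) (hg.add (he _)) (fun z => ?_) hxB hyB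
      have : gradient (W (φ j)) z = H z + (gradient (W (φ j)) z - H z) := by abel
      calc ‖gradient (W (φ j)) z‖ₑ = ‖H z + (gradient (W (φ j)) z - H z)‖ₑ := by rw [← this]
        _ ≤ _ := enorm_add_le _ _
    have hl : Filter.Tendsto (fun j => ‖W (φ j) x - W (φ j) y‖ₑ) Filter.atTop
        (𝓝 ‖w x - w y‖ₑ) :=
      ((hxW.sub hyW).enorm).comp hφ.tendsto_atTop
    have hrr := ((tendsto_const_nhds (x := segPot x₀ r (Ioo 0 1) g x)).add hxV).add
      ((tendsto_const_nhds (x := segPot x₀ r (Ioo 0 1) g y)).add hyV)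
    rw [add_zero, add_zero] at hrr
    exact le_of_tendsto_of_tendsto' hl hrr h1

lemma volume_segPot_ge_le (hr : 0 < r) {g : En n → ℝ≥0∞} (hg : Measurable g) {a : ℝ} (ha : 0 < a)
    (hM : ∀ x ∈ ball x₀ r, ∀ t ∈ Ioc (0 : ℝ) 1,
      ENNReal.ofReal (2 * r) * ∫⁻ z in ball x₀ r ∩ ball x (2 * r * t), g z
        ≤ ENNReal.ofReal (a * t ^ ((n : ℝ) - 1)) * volume (ball x₀ r)) (j : ℕ) :
    volume {x ∈ ball x₀ r | ENNReal.ofReal (a * (j + 1)) ≤ segPot x₀ r (Ioo 0 1) g x}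
      ≤ 2 ^ n * ENNReal.ofReal (exp (-j)) * volume (ball x₀ r) := by
  obtain ⟨hB0, hBt⟩ := volume_ball_pos_lt_top (x₀ := x₀) hr
  set B := ball x₀ r
  set θ : ℝ := exp (-j)
  have hθ0 : 0 < θ := exp_pos _
  have hθ1 : θ ≤ 1 := exp_le_one_iff.2 (by simp)
  have hsplit : ∀ x, segPot x₀ r (Ioo 0 1) g x
      ≤ segPot x₀ r (Ioo 0 θ) g x + segPot x₀ r (Ico θ 1) g x := fun x => by
    simp only [segPot]
    rw [← mul_add]
    have hm1 : Measurable fun q : En n × ℝ => ENNReal.ofReal (2 * r) * g (x + q.2 • (q.1 - x)) :=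
      (hg.comp (by fun_prop)).const_mul _
    rw [← lintegral_add_left hm1.lintegral_prod_right']
    gcongr with z
    calc ∫⁻ t in Ioo (0 : ℝ) 1, ENNReal.ofReal (2 * r) * g (x + t • (z - x))
        ≤ ∫⁻ t in Ioo 0 θ ∪ Ico θ 1, ENNReal.ofReal (2 * r) * g (x + t • (z - x)) := by
          refine lintegral_mono_set fun t ht => ?_
          rcases lt_or_ge t θ with h | h
          · exact Or.inl ⟨ht.1, h⟩
          · exact Or.inr ⟨h, ht.2⟩
      _ ≤ _ := lintegral_union_le _ _ _
  have hlarge : ∀ x ∈ B, segPot x₀ r (Ico θ 1) g x ≤ ENNReal.ofReal (a * j) := by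
    intro x hx
    have hsw : ∫⁻ z in B, ∫⁻ t in Ico θ 1, ENNReal.ofReal (2 * r) * g (x + t • (z - x))
        = ∫⁻ t in Ico θ 1, ∫⁻ z in B, ENNReal.ofReal (2 * r) * g (x + t • (z - x)) := by
      refine lintegral_lintegral_swap (Measurable.aemeasurable ?_)
      exact (hg.comp (by fun_prop)).const_mul _
    have hin : ∀ t ∈ Ico θ 1, ∫⁻ z in B, ENNReal.ofReal (2 * r) * g (x + t • (z - x))
        ≤ ENNReal.ofReal (a * t⁻¹) * volume B := by
      intro t ht
      have ht0 : 0 < t := hθ0.trans_le ht.1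
      have hmz : Measurable fun z => g (x + t • (z - x)) := hg.comp (by fun_prop)
      set g' := (B ∩ ball x (2 * r * t)).indicator g
      have hBm : MeasurableSet (B ∩ ball x (2 * r * t)) := measurableSet_ball.inter
        measurableSet_ball
      rw [lintegral_const_mul _ hmz]
      have h1 : ∫⁻ z in B, g (x + t • (z - x)) ≤ ENNReal.ofReal ((t ^ n)⁻¹) *
          ∫⁻ z in B ∩ ball x (2 * r * t), g z := by
        calc ∫⁻ z in B, g (x + t • (z - x)) = ∫⁻ z in B, g' ((x - t • x) + t • z) := by
              refine setLIntegral_congr_fun measurableSet_ball fun z hz => ?_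
              have e1 : (x - t • x) + t • z = x + t • (z - x) := by rw [smul_sub]; abel
              simp only [e1]
              have hmem := segment_mem_ball hx hz ⟨ht0, ht.2⟩
              refine (indicator_of_mem (mem_inter hmem ?_) g).symm
              rw [mem_ball, dist_eq_norm, add_sub_cancel_left, norm_smul, norm_of_nonneg ht0.le,
                ← dist_eq_norm, mul_comm]
              have hx' : dist x x₀ < r := hx
              have hz' : dist z x₀ < r := hz
              refine mul_lt_mul_of_pos_right ?_ ht0
              linarith [dist_triangle_right z x x₀]
          _ ≤ ∫⁻ z, g' ((x - t • x) + t • z) := setLIntegral_le_lintegral _ _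
          _ = _ := by
              rw [lintegral_comp_add_smul g' _ ht0]
              congr 1
              exact lintegral_indicator hBm _
      calc ENNReal.ofReal (2 * r) * ∫⁻ z in B, g (x + t • (z - x))
          ≤ ENNReal.ofReal (2 * r) * (ENNReal.ofReal ((t ^ n)⁻¹) *
          ∫⁻ z in B ∩ ball x (2 * r * t), g z) := by gcongr
        _ = ENNReal.ofReal ((t ^ n)⁻¹) * (ENNReal.ofReal (2 * r) *
          ∫⁻ z in B ∩ ball x (2 * r * t), g z) := by ring
        _ ≤ ENNReal.ofReal ((t ^ n)⁻¹) * (ENNReal.ofReal (a * t ^ ((n : ℝ) - 1)) * volume B) := by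
            gcongr 1
            exact hM x hx t ⟨ht0, ht.2.le⟩
        _ = _ := by
            rw [← mul_assoc, ← ENNReal.ofReal_mul (by positivity)]
            congr 2
            rw [rpow_sub ht0, rpow_natCast, rpow_one]
            field_simp
    have hlog : ∫⁻ t in Ico θ 1, ENNReal.ofReal (a * t⁻¹) = ENNReal.ofReal (a * j) := by
      have hcont : ContinuousOn (fun t : ℝ => a * t⁻¹) (Icc θ 1) :=
        continuousOn_const.mul (continuousOn_inv₀.mono fun t ht => (hθ0.trans_le ht.1).ne')
      rw [← ofReal_integral_eq_lintegral_ofReal]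
      · congr 1
        rw [integral_Ico_eq_integral_Ioc, ← intervalIntegral.integral_of_le hθ1,
          intervalIntegral.integral_const_mul, integral_inv_of_pos hθ0 one_pos]
        simp [θ]
      · exact (hcont.integrableOn_Icc).mono_set Ico_subset_Icc_self
      · filter_upwards [ae_restrict_mem measurableSet_Ico] with t ht
        have : 0 < t := hθ0.trans_le ht.1
        positivity
    rw [segPot, hsw]
    calc (volume B)⁻¹ * ∫⁻ t in Ico θ 1, ∫⁻ z in B, ENNReal.ofReal (2 * r) * g (x + t • (z - x))
        ≤ (volume B)⁻¹ * ∫⁻ t in Ico θ 1, ENNReal.ofReal (a * t⁻¹) * volume B := by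
          gcongr 1
          exact setLIntegral_mono' measurableSet_Ico hin
      _ = ENNReal.ofReal (a * j) := by
          rw [lintegral_mul_const' _ _ hBt, hlog, mul_comm, mul_assoc,
            ENNReal.mul_inv_cancel hB0 hBt, mul_one]
  have hsmall : ∫⁻ x in B, segPot x₀ r (Ioo 0 θ) g x
      ≤ ENNReal.ofReal θ * 2 ^ n * ENNReal.ofReal a * volume B := by
    refine (lintegral_segPot_le hr measurableSet_Ioo (Ioo_subset_Ioo_right hθ1) hg).trans ?_
    have h1 := hM x₀ (mem_ball_self hr) 1 ⟨one_pos, le_rfl⟩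
    have h2 : B ∩ ball x₀ (2 * r * 1) = B :=
      inter_eq_left.2 (ball_subset_ball (by linarith))
    rw [h2, one_rpow, mul_one] at h1
    rw [Real.volume_Ioo, sub_zero]
    calc ENNReal.ofReal θ * (2 ^ n * ENNReal.ofReal (2 * r)) * ∫⁻ x in B, g x
        = ENNReal.ofReal θ * 2 ^ n * (ENNReal.ofReal (2 * r) * ∫⁻ x in B, g x) := by ring
      _ ≤ ENNReal.ofReal θ * 2 ^ n * (ENNReal.ofReal a * volume B) := by gcongr
      _ = _ := by ring
  have ha' : ENNReal.ofReal a ≠ 0 := by simpa using ha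
  have hmk := mul_meas_ge_le_lintegral (μ := volume.restrict B)
    (measurable_segPot (x₀ := x₀) (r := r) (Ioo 0 θ) hg) (ENNReal.ofReal a)
  have hsub : {x ∈ B | ENNReal.ofReal (a * (j + 1)) ≤ segPot x₀ r (Ioo 0 1) g x}
      ⊆ {x | ENNReal.ofReal a ≤ segPot x₀ r (Ioo 0 θ) g x} ∩ B := by
    rintro x ⟨hxB, hx⟩
    refine ⟨?_, hxB⟩
    have h1 := hx.trans ((hsplit x).trans (add_le_add_right (hlarge x hxB) _))
    rw [mul_add, mul_one, add_comm, ENNReal.ofReal_add ha.le (by positivity)] at h1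
    exact (ENNReal.add_le_add_iff_right ENNReal.ofReal_ne_top).1 h1
  calc volume {x ∈ B | ENNReal.ofReal (a * (j + 1)) ≤ segPot x₀ r (Ioo 0 1) g x}
      ≤ volume ({x | ENNReal.ofReal a ≤ segPot x₀ r (Ioo 0 θ) g x} ∩ B) := measure_mono hsub
    _ = (volume.restrict B) {x | ENNReal.ofReal a ≤ segPot x₀ r (Ioo 0 θ) g x} :=
        (Measure.restrict_apply' measurableSet_ball).symm
    _ ≤ _ := by
        have h3 := hmk.trans hsmall
        have h4 : ENNReal.ofReal θ * 2 ^ n * ENNReal.ofReal a * volume B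
          = ENNReal.ofReal a * (2 ^ n * ENNReal.ofReal θ * volume B) := by ring
        rw [h4] at h3
        exact (ENNReal.mul_le_mul_iff_right ha' ENNReal.ofReal_ne_top).1 h3

end Exponential

section ExponentialIntegrability

variable {n : ℕ} {x₀ : En n} {r : ℝ}

/-- The constant in the exponential integrability estimate for potentials. -/
def expConst (n : ℕ) : ℝ≥0∞ :=
  ∑' j : ℕ, ENNReal.ofReal (exp ((j + 1) / 2)) * (2 ^ n * ENNReal.ofReal (exp (1 - j)))

lemma expConst_ne_top (n : ℕ) : expConst n ≠ ⊤ := by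
  have h1 : ∀ j : ℕ, ENNReal.ofReal (exp ((j + 1) / 2)) * (2 ^ n * ENNReal.ofReal (exp (1 - j)))
      = 2 ^ n * ENNReal.ofReal (exp (3 / 2) * exp (-1 / 2) ^ j) := fun j => by
    rw [mul_left_comm, ← ENNReal.ofReal_mul (exp_pos _).le, ← exp_add, ← exp_nat_mul, ← exp_add]
    congr 3; ring
  unfold expConst
  simp_rw [h1]
  rw [ENNReal.tsum_mul_left]
  refine ENNReal.mul_ne_top (ENNReal.pow_ne_top (by simp)) (Summable.tsum_ofReal_ne_top ?_)
  refine (summable_geometric_of_lt_one (exp_pos _).le ?_).mul_left _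
  rw [exp_lt_one_iff]; norm_num

lemma ae_segPot_lt_top (hr : 0 < r) {g : En n → ℝ≥0∞} (hg : Measurable g)
    (hfin : ∫⁻ z in ball x₀ r, g z ≠ ⊤) :
    ∀ᵐ x ∂volume.restrict (ball x₀ r), segPot x₀ r (Ioo 0 1) g x < ⊤ := by
  refine ae_lt_top (measurable_segPot _ hg) (ne_top_of_le_ne_top ?_
    (lintegral_segPot_le hr measurableSet_Ioo Subset.rfl hg))
  refine ENNReal.mul_ne_top (ENNReal.mul_ne_top (by simp) (ENNReal.mul_ne_top ?_
    ENNReal.ofReal_ne_top)) hfin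
  exact ENNReal.pow_ne_top (by simp)

lemma lintegral_exp_segPot_le (hr : 0 < r) {g : En n → ℝ≥0∞} (hg : Measurable g) {a : ℝ}
    (ha : 0 < a)
    (hM : ∀ x ∈ ball x₀ r, ∀ t ∈ Ioc (0 : ℝ) 1,
      ENNReal.ofReal (2 * r) * ∫⁻ z in ball x₀ r ∩ ball x (2 * r * t), g z
        ≤ ENNReal.ofReal (a * t ^ ((n : ℝ) - 1)) * volume (ball x₀ r)) :
    ∫⁻ x in ball x₀ r, ENNReal.ofReal (exp ((segPot x₀ r (Ioo 0 1) g x).toReal / (2 * a)))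
      ≤ expConst n * volume (ball x₀ r) := by
  set V := segPot x₀ r (Ioo 0 1) g with hVdef
  have hV : Measurable V := measurable_segPot _ hg
  let L : ℕ → Set (En n) := fun j => {x ∈ ball x₀ r | ENNReal.ofReal (a * j) ≤ V x}
  have hL : ∀ j, MeasurableSet (L j) := fun j =>
    measurableSet_ball.inter (measurableSet_le measurable_const hV)
  have hLv : ∀ j, volume (L j) ≤ 2 ^ n * ENNReal.ofReal (exp (1 - j)) * volume (ball x₀ r) := by
    intro j
    rcases j with _ | j
    · calc volume (L 0) ≤ volume (ball x₀ r) := measure_mono fun x hx => hx.1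
        _ = 1 * 1 * volume (ball x₀ r) := by simp
        _ ≤ _ := by
          gcongr
          · exact one_le_pow₀ (by norm_num)
          · simp
    · have := volume_segPot_ge_le hr hg ha hM j
      have e : (1 : ℝ) - ((j + 1 : ℕ) : ℝ) = -j := by push_cast; ring
      rw [e]
      refine le_trans (le_of_eq ?_) this
      simp [L, hVdef]
  calc ∫⁻ x in ball x₀ r, ENNReal.ofReal (exp ((V x).toReal / (2 * a)))
      ≤ ∫⁻ x in ball x₀ r, ∑' j : ℕ,
          ENNReal.ofReal (exp ((j + 1) / 2)) * (L j).indicator 1 x := by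
        refine setLIntegral_mono' measurableSet_ball fun x hx => ?_
        set X := (V x).toReal
        have hX0 : 0 ≤ X := ENNReal.toReal_nonneg
        set j := ⌊X / a⌋₊
        have hj1 : (j : ℝ) ≤ X / a := Nat.floor_le (by positivity)
        have hj2 : X / a < j + 1 := Nat.lt_floor_add_one _
        have hmem : x ∈ L j := by
          refine ⟨hx, ?_⟩
          rw [le_div_iff₀ ha, mul_comm] at hj1
          exact (ENNReal.ofReal_le_ofReal hj1).trans ENNReal.ofReal_toReal_le
        refine le_trans ?_ (ENNReal.le_tsum j)
        rw [indicator_of_mem hmem, Pi.one_apply, mul_one]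
        apply ENNReal.ofReal_le_ofReal
        rw [exp_le_exp]
        have : X / (2 * a) = X / a / 2 := by field_simp
        rw [this]
        linarith
    _ = ∑' j : ℕ, ∫⁻ x in ball x₀ r,
          ENNReal.ofReal (exp ((j + 1) / 2)) * (L j).indicator 1 x :=
        lintegral_tsum fun j => ((measurable_one.indicator (hL j)).const_mul _).aemeasurable
    _ ≤ ∑' j : ℕ, ENNReal.ofReal (exp ((j + 1) / 2)) * (2 ^ n * ENNReal.ofReal (exp (1 - j)))
          * volume (ball x₀ r) := by
        refine ENNReal.tsum_le_tsum fun j => ?_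
        rw [lintegral_const_mul _ (measurable_one.indicator (hL j)), mul_assoc]
        gcongr
        refine (setLIntegral_le_lintegral _ _).trans ?_
        rw [lintegral_indicator_one (hL j)]
        exact hLv j
    _ = _ := by rw [ENNReal.tsum_mul_right, expConst]

lemma lintegral_exp_mul_lintegral_exp_neg_le (hr : 0 < r) {W : ℕ → En n → ℝ}
    (hW : ∀ k, ContDiff ℝ (⊤ : ℕ∞) (W k)) {w : En n → ℝ}
    (hlim : ∀ᵐ x ∂volume.restrict (ball x₀ r),
      Filter.Tendsto (fun k => W k x) Filter.atTop (𝓝 (w x)))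
    {H : En n → En n} (hH : Measurable H)
    (hint : Filter.Tendsto (fun k => ∫⁻ x in ball x₀ r, ‖gradient (W k) x - H x‖ₑ)
      Filter.atTop (𝓝 0)) {a : ℝ} (ha : 0 < a)
    (hM : ∀ x ∈ ball x₀ r, ∀ t ∈ Ioc (0 : ℝ) 1,
      ENNReal.ofReal (2 * r) * ∫⁻ z in ball x₀ r ∩ ball x (2 * r * t), ‖H z‖ₑ
        ≤ ENNReal.ofReal (a * t ^ ((n : ℝ) - 1)) * volume (ball x₀ r)) :
    (∫⁻ x in ball x₀ r, ENNReal.ofReal (exp (w x / (2 * a)))) *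
      (∫⁻ x in ball x₀ r, ENNReal.ofReal (exp (-(w x / (2 * a)))))
      ≤ (expConst n * volume (ball x₀ r)) * (expConst n * volume (ball x₀ r)) := by
  obtain ⟨hB0, hBt⟩ := volume_ball_pos_lt_top (x₀ := x₀) hr
  have hg : Measurable fun z => ‖H z‖ₑ := hH.enorm
  obtain ⟨S, hS, hSV⟩ := exists_ae_enorm_sub_le_segPot hr hW hlim hH hint
  set V := segPot x₀ r (Ioo 0 1) (fun z => ‖H z‖ₑ) with hVdef
  have hVm : Measurable V := measurable_segPot _ hg
  have hfin : ∫⁻ z in ball x₀ r, ‖H z‖ₑ ≠ ⊤ := by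
    have h1 := hM x₀ (mem_ball_self hr) 1 ⟨one_pos, le_rfl⟩
    have h2 : ball x₀ r ∩ ball x₀ (2 * r * 1) = ball x₀ r :=
      inter_eq_left.2 (ball_subset_ball (by linarith))
    rw [h2] at h1
    intro h
    rw [h, ENNReal.mul_top (by simpa using hr), top_le_iff] at h1
    exact ENNReal.mul_ne_top ENNReal.ofReal_ne_top hBt h1
  have hVt := ae_segPot_lt_top hr hg hfin
  have hwm : AEMeasurable w (volume.restrict (ball x₀ r)) :=
    aemeasurable_of_tendsto_metrizable_ae Filter.atTop
      (fun k => (hW k).continuous.measurable.aemeasurable) hlim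
  let E : En n → ℝ≥0∞ := fun x => ENNReal.ofReal (exp ((V x).toReal / (2 * a)))
  have hE : Measurable E := by fun_prop
  have hEle : ∫⁻ x in ball x₀ r, E x ≤ expConst n * volume (ball x₀ r) :=
    lintegral_exp_segPot_le hr hg ha hM
  have hpt : ∀ᵐ x ∂volume.restrict (ball x₀ r), ∀ᵐ y ∂volume.restrict (ball x₀ r),
      ENNReal.ofReal (exp (w x / (2 * a))) * ENNReal.ofReal (exp (-(w y / (2 * a))))
        ≤ E x * E y := by
    filter_upwards [hS, hVt] with x hxS hxV
    filter_upwards [hS, hVt] with y hyS hyV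
    have h1 := hSV x hxS y hyS
    rw [← ofReal_norm, ENNReal.ofReal_le_iff_le_toReal (ENNReal.add_ne_top.2 ⟨hxV.ne, hyV.ne⟩),
      ENNReal.toReal_add hxV.ne hyV.ne] at h1
    simp only [E]
    rw [← ENNReal.ofReal_mul (exp_pos _).le, ← ENNReal.ofReal_mul (exp_pos _).le, ← exp_add,
      ← exp_add]
    apply ENNReal.ofReal_le_ofReal
    rw [exp_le_exp, ← sub_eq_add_neg, ← sub_div, ← add_div]
    gcongr
    exact (le_abs_self _).trans h1
  have hFm : AEMeasurable (fun x => ENNReal.ofReal (exp (w x / (2 * a))))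
      (volume.restrict (ball x₀ r)) := by fun_prop
  calc (∫⁻ x in ball x₀ r, ENNReal.ofReal (exp (w x / (2 * a)))) *
      (∫⁻ x in ball x₀ r, ENNReal.ofReal (exp (-(w x / (2 * a)))))
      = ∫⁻ x in ball x₀ r, ∫⁻ y in ball x₀ r,
        ENNReal.ofReal (exp (w x / (2 * a))) * ENNReal.ofReal (exp (-(w y / (2 * a)))) := by
        rw [← lintegral_mul_const'' _ hFm]
        refine lintegral_congr fun x => ?_
        rw [lintegral_const_mul' _ _ ENNReal.ofReal_ne_top]
    _ ≤ ∫⁻ x in ball x₀ r, ∫⁻ y in ball x₀ r, E x * E y := by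
        refine lintegral_mono_ae ?_
        filter_upwards [hpt] with x hx
        exact lintegral_mono_ae hx
    _ = (∫⁻ x in ball x₀ r, E x) * ∫⁻ x in ball x₀ r, E x := by
        rw [← lintegral_mul_const _ hE]
        refine lintegral_congr fun x => ?_
        rw [lintegral_const_mul _ hE]
    _ ≤ _ := mul_le_mul' hEle hEle

end ExponentialIntegrability

section Gagliardo

variable {n : ℕ} {p s : ℝ}

lemma lintegral_gagliardo_le (hn : 0 < n) (hp : 1 < p) (hs0 : 0 < s) (hs1 : s < 1) (x₀ : En n)
    (ρ : ℝ) : ∃ C : ℝ≥0∞, C ≠ ⊤ ∧ ∀ f : En n → ℝ, ContDiff ℝ (⊤ : ℕ∞) f →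
      ∫⁻ z in ball x₀ ρ ×ˢ ball x₀ ρ,
        ‖f z.1 - f z.2‖ₑ ^ p * ENNReal.ofReal (‖z.1 - z.2‖ ^ (-((n : ℝ) + p * s)))
        ≤ C * ∫⁻ x in ball x₀ ρ, ‖gradient f x‖ₑ ^ p := by
  have hp0 : 0 < p := by linarith
  set D := ball x₀ ρ
  have hDm : MeasurableSet D := measurableSet_ball
  let κ : En n → ℝ≥0∞ := (ball (0 : En n) (2 * ρ)).indicator fun h =>
    ‖h‖ₑ ^ p * ENNReal.ofReal (‖h‖ ^ (-((n : ℝ) + p * s)))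
  have hκm : Measurable κ := by
    refine Measurable.indicator ?_ measurableSet_ball
    fun_prop
  have hκ : ∫⁻ h, κ h ≠ ⊤ := by
    have h1 := (integrable_min_one_rpow_mul_norm_rpow hn hp hs0 hs1).lintegral_lt_top
    refine ne_top_of_le_ne_top (ENNReal.mul_ne_top (ENNReal.ofReal_ne_top
      (r := (max 1 (2 * ρ)) ^ p)) h1.ne) ?_
    rw [← lintegral_const_mul' _ _ ENNReal.ofReal_ne_top]
    refine lintegral_mono fun h => ?_
    by_cases hh : h ∈ ball (0 : En n) (2 * ρ)
    · simp only [κ, indicator_of_mem hh]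
      rw [← ofReal_norm, ENNReal.ofReal_rpow_of_nonneg (norm_nonneg _) hp0.le,
        ← ENNReal.ofReal_mul (by positivity), ← ENNReal.ofReal_mul (by positivity)]
      apply ENNReal.ofReal_le_ofReal
      rw [← mul_assoc, ← mul_rpow (by positivity) (by positivity)]
      rw [mem_ball_zero_iff] at hh
      gcongr
      rcases le_total 1 ‖h‖ with h2 | h2
      · rw [min_eq_left h2, mul_one]; exact hh.le.trans (le_max_right _ _)
      · rw [min_eq_right h2]
        exact le_mul_of_one_le_left (norm_nonneg _) (le_max_left _ _)
    · simp only [κ, indicator_of_notMem hh]; exact bot_le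
  refine ⟨∫⁻ h, κ h, hκ, fun f hf => ?_⟩
  let g : En n → ℝ≥0∞ := D.indicator fun x => ‖gradient f x‖ₑ ^ p
  have hg : Measurable g :=
    ((continuous_gradient hf).measurable.enorm.pow_const p).indicator hDm
  have hgint : ∫⁻ x, g x = ∫⁻ x in D, ‖gradient f x‖ₑ ^ p := lintegral_indicator hDm _
  have hcg : Continuous (gradient f) := continuous_gradient hf
  let Φ : En n × En n → ℝ≥0∞ := fun z =>
    κ (z.2 - z.1) * ∫⁻ t in Ioo (0 : ℝ) 1, g (z.1 + t • (z.2 - z.1))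
  have hΦm : Measurable Φ := by
    refine Measurable.mul (hκm.comp (by fun_prop)) ?_
    have h1 : Measurable fun q : (En n × En n) × ℝ => g (q.1.1 + q.2 • (q.1.2 - q.1.1)) :=
      hg.comp (by fun_prop)
    exact h1.lintegral_prod_right'
  calc ∫⁻ z in D ×ˢ D,
        ‖f z.1 - f z.2‖ₑ ^ p * ENNReal.ofReal (‖z.1 - z.2‖ ^ (-((n : ℝ) + p * s)))
      ≤ ∫⁻ z in D ×ˢ D, Φ z := by
        refine setLIntegral_mono' (hDm.prod hDm) fun z hz => ?_
        obtain ⟨hx, hy⟩ := hz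
        have hball : z.2 - z.1 ∈ ball (0 : En n) (2 * ρ) := by
          rw [mem_ball_zero_iff, ← dist_eq_norm]
          have h1 : dist z.1 x₀ < ρ := hx
          have h2 : dist z.2 x₀ < ρ := hy
          linarith [dist_triangle_right z.2 z.1 x₀]
        simp only [Φ, κ, indicator_of_mem hball]
        have hJ : (∫⁻ t in Ioo (0 : ℝ) 1, ‖gradient f (z.1 + t • (z.2 - z.1))‖ₑ) ^ p
            ≤ ∫⁻ t in Ioo (0 : ℝ) 1, g (z.1 + t • (z.2 - z.1)) := by
          have hm : AEMeasurable (fun t : ℝ => ‖gradient f (z.1 + t • (z.2 - z.1))‖ₑ)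
              (volume.restrict (Ioo (0 : ℝ) 1)) :=
            (hcg.comp (by fun_prop)).enorm.measurable.aemeasurable
          have h1 := lintegral_mul_rpow_le hp (w := fun _ => 1) aemeasurable_const hm (by simp)
          simp only [one_mul] at h1
          refine h1.trans (setLIntegral_mono' measurableSet_Ioo fun t ht => ?_)
          simp only [g]
          rw [indicator_of_mem (segment_mem_ball hx hy ht)]
        calc ‖f z.1 - f z.2‖ₑ ^ p * ENNReal.ofReal (‖z.1 - z.2‖ ^ (-((n : ℝ) + p * s)))
            ≤ (‖z.1 - z.2‖ₑ * ∫⁻ t in Ioo (0 : ℝ) 1, ‖gradient f (z.1 + t • (z.2 - z.1))‖ₑ) ^ p *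
              ENNReal.ofReal (‖z.1 - z.2‖ ^ (-((n : ℝ) + p * s))) := by
              gcongr
              exact enorm_sub_le_lintegral_segment hf z.1 z.2
          _ = ‖z.2 - z.1‖ₑ ^ p * ENNReal.ofReal (‖z.2 - z.1‖ ^ (-((n : ℝ) + p * s))) *
              (∫⁻ t in Ioo (0 : ℝ) 1, ‖gradient f (z.1 + t • (z.2 - z.1))‖ₑ) ^ p := by
              rw [ENNReal.mul_rpow_of_nonneg _ _ hp0.le, enorm_sub_rev, norm_sub_rev]; ring
          _ ≤ _ := by gcongr
    _ ≤ ∫⁻ z, Φ z := setLIntegral_le_lintegral _ _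
    _ = ∫⁻ x, ∫⁻ y, Φ (x, y) := by
        rw [Measure.volume_eq_prod, lintegral_prod _ hΦm.aemeasurable]
    _ = ∫⁻ x, ∫⁻ h, κ h * ∫⁻ t in Ioo (0 : ℝ) 1, g (x + t • h) := by
        refine lintegral_congr fun x => ?_
        exact lintegral_sub_right_eq_self
          (fun h => κ h * ∫⁻ t in Ioo (0 : ℝ) 1, g (x + t • h)) x
    _ = ∫⁻ h, ∫⁻ x, κ h * ∫⁻ t in Ioo (0 : ℝ) 1, g (x + t • h) := by
        refine lintegral_lintegral_swap (Measurable.aemeasurable ?_)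
        refine Measurable.mul (hκm.comp measurable_snd) ?_
        have h1 : Measurable fun q : (En n × En n) × ℝ => g (q.1.1 + q.2 • q.1.2) :=
          hg.comp (by fun_prop)
        exact h1.lintegral_prod_right'
    _ = ∫⁻ h, κ h * ∫⁻ x in D, ‖gradient f x‖ₑ ^ p := by
        refine lintegral_congr fun h => ?_
        have h1 : Measurable fun q : En n × ℝ => g (q.1 + q.2 • h) := hg.comp (by fun_prop)
        rw [lintegral_const_mul _ h1.lintegral_prod_right', lintegral_lintegral_swap
          h1.aemeasurable]
        congr 1
        have h2 : ∀ t : ℝ, ∫⁻ x, g (x + t • h) = ∫⁻ x in D, ‖gradient f x‖ₑ ^ p := fun t => by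
          rw [lintegral_add_right_eq_self g (t • h), hgint]
        simp_rw [h2]
        simp
    _ = _ := by rw [lintegral_mul_const _ hκm]

end Gagliardo

section LogTest

variable {n : ℕ} {p d : ℝ}

lemma gradient_eq_add_of_hasFDerivAt {f g h : En n → ℝ} {x : En n} {a b : ℝ}
    (hf : HasFDerivAt f (a • fderiv ℝ g x + b • fderiv ℝ h x) x) :
    gradient f x = a • gradient g x + b • gradient h x := by
  rw [gradient, hf.fderiv]
  simp [gradient]

/-- The test function `ζ (v + d)^{1-p}`. -/
def logTest (p d : ℝ) (ζ v : En n → ℝ) (x : En n) : ℝ := ζ x * (v x + d) ^ (1 - p)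

lemma contDiff_logTest (hd : 0 < d) {ζ v : En n → ℝ} (hζ : ContDiff ℝ (⊤ : ℕ∞) ζ)
    (hv : ContDiff ℝ (⊤ : ℕ∞) v) (hv0 : ∀ x, 0 ≤ v x) :
    ContDiff ℝ (⊤ : ℕ∞) (logTest p d ζ v) :=
  hζ.mul ((hv.add contDiff_const).rpow_const_of_ne fun x => by have := hv0 x; positivity)

lemma gradient_logTest (hd : 0 < d) {ζ v : En n → ℝ} (hζ : ContDiff ℝ (⊤ : ℕ∞) ζ)
    (hv : ContDiff ℝ (⊤ : ℕ∞) v) (hv0 : ∀ x, 0 ≤ v x) (x : En n) :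
    gradient (logTest p d ζ v) x = (v x + d) ^ (1 - p) • gradient ζ x
      + (ζ x * ((1 - p) * (v x + d) ^ (-p))) • gradient v x := by
  have hvd : v x + d ≠ 0 := by have := hv0 x; positivity
  have h1 : HasFDerivAt ζ (fderiv ℝ ζ x) x := (hζ.differentiable (by simp) x).hasFDerivAt
  have h2 : HasFDerivAt v (fderiv ℝ v x) x := (hv.differentiable (by simp) x).hasFDerivAt
  have h3 := (h2.add_const d).rpow_const (p := 1 - p) (Or.inl hvd)
  have h4 := h1.mul h3
  refine gradient_eq_add_of_hasFDerivAt (h4.congr_fderiv ?_)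
  rw [show (1 : ℝ) - p - 1 = -p by ring, smul_smul, add_comm]

lemma gradient_log_add (hd : 0 < d) {v : En n → ℝ} (hv : ContDiff ℝ (⊤ : ℕ∞) v)
    (hv0 : ∀ x, 0 ≤ v x) (x : En n) :
    gradient (fun x => Real.log (v x + d)) x = (v x + d)⁻¹ • gradient v x := by
  have hvd : v x + d ≠ 0 := by have := hv0 x; positivity
  have h2 : HasFDerivAt v (fderiv ℝ v x) x := (hv.differentiable (by simp) x).hasFDerivAt
  have h3 := (h2.add_const d).log hvd
  rw [gradient, h3.fderiv]
  simp [gradient]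

lemma logTest_nonneg (hd : 0 < d) {ζ v : En n → ℝ} (hζ0 : ∀ x, 0 ≤ ζ x) {x : En n}
    (hv0 : 0 ≤ v x) : 0 ≤ logTest p d ζ v x :=
  mul_nonneg (hζ0 x) (by positivity)

lemma rpow_neg_add_le (hd : 0 < d) {t : ℝ} (ht : t ≤ 0) {V : ℝ} (hV : 0 ≤ V) :
    (V + d) ^ t ≤ d ^ t :=
  rpow_le_rpow_of_nonpos hd (by linarith) ht

lemma logTest_le (hp : 1 < p) (hd : 0 < d) {ζ v : En n → ℝ} {x : En n} (hζ0 : 0 ≤ ζ x)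
    (hv0 : 0 ≤ v x) : logTest p d ζ v x ≤ ζ x * d ^ (1 - p) :=
  mul_le_mul_of_nonneg_left (rpow_neg_add_le hd (by linarith) hv0) hζ0

lemma norm_gradient_logTest_le (hp : 1 < p) (hd : 0 < d) {ζ v : En n → ℝ}
    (hζ : ContDiff ℝ (⊤ : ℕ∞) ζ) (hζ0 : ∀ x, 0 ≤ ζ x) (hζ1 : ∀ x, ζ x ≤ 1)
    (hv : ContDiff ℝ (⊤ : ℕ∞) v) (hv0 : ∀ x, 0 ≤ v x) (x : En n) :
    ‖gradient (logTest p d ζ v) x‖ ≤ d ^ (1 - p) * ‖gradient ζ x‖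
      + ((p - 1) * d ^ (-p)) * ‖gradient v x‖ := by
  rw [gradient_logTest hd hζ hv hv0]
  have hV := hv0 x
  refine (norm_add_le _ _).trans (add_le_add ?_ ?_)
  · rw [norm_smul, norm_of_nonneg (by positivity)]
    exact mul_le_mul_of_nonneg_right (rpow_neg_add_le hd (by linarith) hV) (norm_nonneg _)
  · rw [norm_smul, norm_mul, norm_mul, norm_of_nonneg (hζ0 x),
      norm_of_nonneg (by positivity : 0 ≤ (v x + d) ^ (-p)),
      norm_of_nonpos (sub_nonpos.2 hp.le), neg_sub]
    refine mul_le_mul_of_nonneg_right ?_ (norm_nonneg _)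
    have h1 : (v x + d) ^ (-p) ≤ d ^ (-p) := rpow_neg_add_le hd (by linarith) hV
    have hp1 : 0 ≤ p - 1 := by linarith
    calc ζ x * ((p - 1) * (v x + d) ^ (-p)) ≤ 1 * ((p - 1) * d ^ (-p)) := by
          gcongr
          exact hζ1 x
      _ = _ := one_mul _

lemma exists_lintegral_gradient_logTest_le (hp : 1 < p) (hd : 0 < d) {ζ : En n → ℝ}
    (hζ : ContDiff ℝ (⊤ : ℕ∞) ζ) (hζc : HasCompactSupport ζ) (hζ0 : ∀ x, 0 ≤ ζ x)
    (hζ1 : ∀ x, ζ x ≤ 1) (D : Set (En n)) (hD : volume D ≠ ⊤) {M : ℝ≥0∞} (hM : M ≠ ⊤) :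
    ∃ M' : ℝ≥0∞, M' ≠ ⊤ ∧ ∀ v : En n → ℝ, ContDiff ℝ (⊤ : ℕ∞) v → (∀ x, 0 ≤ v x) →
      ∫⁻ x in D, ‖gradient v x‖ₑ ^ p ≤ M →
      ∫⁻ x in D, ‖gradient (logTest p d ζ v) x‖ₑ ^ p ≤ M' := by
  have hp0 : 0 < p := by linarith
  obtain ⟨L, hL⟩ : ∃ L, ∀ x, ‖gradient ζ x‖ ≤ L := by
    obtain ⟨L, hL⟩ := (hζc.fderiv ℝ).exists_bound_of_continuous (hζ.continuous_fderiv (by simp))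
    exact ⟨L, fun x => by simpa [gradient] using hL x⟩
  set c₁ := ENNReal.ofReal (d ^ (1 - p) * L)
  set c₂ := ENNReal.ofReal ((p - 1) * d ^ (-p))
  refine ⟨2 ^ p * (c₁ ^ p * volume D + c₂ ^ p * M), ?_, fun v hv hv0 hvM => ?_⟩
  · refine ENNReal.mul_ne_top (ENNReal.rpow_ne_top_of_nonneg hp0.le (by simp))
      (ENNReal.add_ne_top.2 ⟨ENNReal.mul_ne_top (ENNReal.rpow_ne_top_of_nonneg hp0.le
        ENNReal.ofReal_ne_top) hD, ENNReal.mul_ne_top (ENNReal.rpow_ne_top_of_nonneg hp0.le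
        ENNReal.ofReal_ne_top) hM⟩)
  · have hpt : ∀ x, ‖gradient (logTest p d ζ v) x‖ₑ ^ p
        ≤ 2 ^ p * (c₁ ^ p + c₂ ^ p * ‖gradient v x‖ₑ ^ p) := fun x => by
      rw [← ENNReal.mul_rpow_of_nonneg c₂ _ hp0.le]
      refine le_trans ?_ (enn_add_rpow_le_two_rpow _ _ hp0.le)
      gcongr
      rw [← ofReal_norm, ← ofReal_norm, ← ENNReal.ofReal_mul (by
        have : 0 < p - 1 := by linarith
        positivity)]
      refine (ENNReal.ofReal_le_ofReal (norm_gradient_logTest_le hp hd hζ hζ0 hζ1 hv hv0 x)).trans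
        ?_
      refine ENNReal.ofReal_add_le.trans ?_
      exact add_le_add (ENNReal.ofReal_le_ofReal (by have := hL x; gcongr)) le_rfl
    have hm : Measurable fun x => ‖gradient v x‖ₑ ^ p :=
      (continuous_gradient hv).enorm.measurable.pow_const p
    calc ∫⁻ x in D, ‖gradient (logTest p d ζ v) x‖ₑ ^ p
        ≤ ∫⁻ x in D, 2 ^ p * (c₁ ^ p + c₂ ^ p * ‖gradient v x‖ₑ ^ p) :=
          lintegral_mono fun x => hpt x
      _ = 2 ^ p * (c₁ ^ p * volume D + c₂ ^ p * ∫⁻ x in D, ‖gradient v x‖ₑ ^ p) := by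
          rw [lintegral_const_mul _ ((hm.const_mul _).const_add _),
            lintegral_add_left measurable_const, lintegral_const_mul _ hm, setLIntegral_const]
      _ ≤ _ := by gcongr

lemma tendsto_logTest (hd : 0 < d) {ζ u : En n → ℝ} {v : ℕ → En n → ℝ} {x : En n}
    (hu0 : 0 ≤ u x) (hlim : Filter.Tendsto (fun k => v k x) Filter.atTop (𝓝 (u x))) :
    Filter.Tendsto (fun k => logTest p d ζ (v k) x) Filter.atTop (𝓝 (logTest p d ζ u x)) :=
  ((hlim.add_const d).rpow_const (Or.inl (by positivity))).const_mul _

end LogTest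

section NonlocalLimit

variable {n : ℕ} {p s : ℝ}

lemma lintegral_tail_kernel_ne_top (hn : 0 < n) (hp : 1 < p) (hs0 : 0 < s) {u : En n → ℝ}
    (hu : AEMeasurable u) (hut : MemTailSpace p s u) {x₀ : En n} {r : ℝ} (hr : 0 < r) :
    ∫⁻ z in closedBall x₀ (3 * r / 2) ×ˢ (ball x₀ (7 * r / 4))ᶜ,
      ENNReal.ofReal ((|u z.1| ^ (p - 1) + |u z.2| ^ (p - 1)) *
        ‖z.1 - z.2‖ ^ (-((n : ℝ) + p * s))) ≠ ⊤ := by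
  have hn' : (0 : ℝ) < n := by exact_mod_cast hn
  set N : ℝ := (n : ℝ) + p * s
  have hps : 0 < p * s := by positivity
  have hN : 0 < N := by positivity
  set Q := closedBall x₀ (3 * r / 2)
  set c : ℝ := 1 + (1 + ‖x₀‖ + 3 * r / 2) * (4 / r)
  have hc : 0 < c := by positivity
  set ω : En n → ℝ := fun y => (1 + ‖y‖) ^ (-N)
  set c' : ℝ := 1 + ‖x₀‖ + 3 * r / 2
  have hc' : 0 < c' := by positivity
  have hum : AEMeasurable fun y => ENNReal.ofReal (|u y| ^ (p - 1)) :=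
    ((hu.norm).pow_const _).ennreal_ofReal
  have hωm : Measurable fun y => ENNReal.ofReal (ω y) := by fun_prop
  have hT : ∫⁻ y, ENNReal.ofReal (|u y| ^ (p - 1) * ω y) ≠ ⊤ := hut.lintegral_lt_top.ne
  have hω : ∫⁻ y : En n, ENNReal.ofReal (ω y) ≠ ⊤ := by
    have : Integrable ω := integrable_one_add_norm (by
      rw [finrank_euclideanSpace_fin]; linarith)
    exact this.lintegral_lt_top.ne
  have hQu : ∫⁻ x in Q, ENNReal.ofReal (|u x| ^ (p - 1)) ≠ ⊤ := by
    refine ne_top_of_le_ne_top (ENNReal.mul_ne_top (ENNReal.ofReal_ne_top (r := c' ^ N)) hT) ?_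
    rw [← lintegral_const_mul' _ _ ENNReal.ofReal_ne_top]
    refine (setLIntegral_mono' measurableSet_closedBall fun x hx => ?_).trans
      (setLIntegral_le_lintegral _ _)
    rw [← ENNReal.ofReal_mul (by positivity)]
    apply ENNReal.ofReal_le_ofReal
    have h1 : 1 + ‖x‖ ≤ c' := by
      have h2 : dist x x₀ ≤ 3 * r / 2 := hx
      rw [dist_eq_norm] at h2
      have h3 : ‖x‖ ≤ ‖x - x₀‖ + ‖x₀‖ := by simpa using norm_add_le (x - x₀) x₀
      simp only [c']; linarith
    have h2 : 1 ≤ c' ^ N * ω x := by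
      simp only [ω]
      rw [rpow_neg (by positivity), ← div_eq_mul_inv, one_le_div (by positivity)]
      exact rpow_le_rpow (by positivity) h1 hN.le
    calc |u x| ^ (p - 1) = |u x| ^ (p - 1) * 1 := (mul_one _).symm
      _ ≤ |u x| ^ (p - 1) * (c' ^ N * ω x) := by gcongr
      _ = _ := by ring
  have hpt : ∀ z ∈ Q ×ˢ (ball x₀ (7 * r / 4))ᶜ,
      ENNReal.ofReal ((|u z.1| ^ (p - 1) + |u z.2| ^ (p - 1)) * ‖z.1 - z.2‖ ^ (-N)) ≤
      ENNReal.ofReal (c ^ N) * (ENNReal.ofReal (|u z.1| ^ (p - 1)) * ENNReal.ofReal (ω z.2)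
        + 1 * ENNReal.ofReal (|u z.2| ^ (p - 1) * ω z.2)) := by
    rintro ⟨x, y⟩ ⟨hx, hy⟩
    simp only at hx hy ⊢
    have hx' : dist x x₀ ≤ 3 * r / 2 := hx
    have hy' : 7 * r / 4 ≤ dist y x₀ := by simpa using hy
    have h1 : r / 4 ≤ ‖x - y‖ := by
      rw [← dist_eq_norm]; linarith [dist_triangle_left y x₀ x]
    have h2 : 1 + ‖y‖ ≤ c * ‖x - y‖ := by
      rw [dist_eq_norm] at hx'
      have h3 : ‖y‖ ≤ ‖x - y‖ + (‖x - x₀‖ + ‖x₀‖) := by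
        have e : y = -(x - y) + ((x - x₀) + x₀) := by abel
        calc ‖y‖ = ‖-(x - y) + ((x - x₀) + x₀)‖ := by rw [← e]
          _ ≤ ‖-(x - y)‖ + ‖(x - x₀) + x₀‖ := norm_add_le _ _
          _ ≤ _ := by rw [norm_neg]; gcongr; exact norm_add_le _ _
      have h4 : c' ≤ c' * (4 / r) * ‖x - y‖ := by
        have : 1 ≤ 4 / r * ‖x - y‖ := by
          rw [div_mul_eq_mul_div, one_le_div hr]; linarith
        rw [mul_assoc]; exact le_mul_of_one_le_right hc'.le this
      have h5 : c * ‖x - y‖ = ‖x - y‖ + c' * (4 / r) * ‖x - y‖ := by simp only [c, c']; ring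
      rw [h5]; simp only [c'] at h4 ⊢; linarith
    have hxy : 0 < ‖x - y‖ := by linarith
    have h6 : ‖x - y‖ ^ (-N) ≤ c ^ N * ω y := by
      simp only [ω]
      rw [rpow_neg hxy.le, rpow_neg (by positivity), ← div_eq_mul_inv, inv_le_comm₀ (by positivity)
        (by positivity), inv_div, div_le_iff₀ (by positivity), ← mul_rpow hxy.le hc.le,
            mul_comm _ c]
      exact rpow_le_rpow (by positivity) h2 hN.le
    rw [one_mul, ← ENNReal.ofReal_mul (by positivity), ← ENNReal.ofReal_add (by positivity)
      (by positivity), ← ENNReal.ofReal_mul (by positivity)]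
    apply ENNReal.ofReal_le_ofReal
    calc (|u x| ^ (p - 1) + |u y| ^ (p - 1)) * ‖x - y‖ ^ (-N)
        ≤ (|u x| ^ (p - 1) + |u y| ^ (p - 1)) * (c ^ N * ω y) := by gcongr
      _ = _ := by ring
  refine ne_top_of_le_ne_top ?_ ((setLIntegral_mono' (measurableSet_closedBall.prod
    measurableSet_ball.compl) hpt).trans (lintegral_mono_set (prod_mono_right (subset_univ _))))
  rw [Measure.volume_eq_prod, ← Measure.prod_restrict, Measure.restrict_univ,
    lintegral_const_mul' _ _ ENNReal.ofReal_ne_top, lintegral_add_left' ?_,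
    lintegral_prod_mul hum.restrict hωm.aemeasurable,
    lintegral_prod_mul (f := fun _ => (1 : ℝ≥0∞)) aemeasurable_const
      hut.1.aemeasurable.ennreal_ofReal]
  · refine ENNReal.mul_ne_top ENNReal.ofReal_ne_top (ENNReal.add_ne_top.2
      ⟨ENNReal.mul_ne_top hQu hω, ENNReal.mul_ne_top ?_ hT⟩)
    rw [setLIntegral_one]
    exact measure_closedBall_lt_top.ne
  · exact (hum.restrict.comp_fst).mul (hωm.aemeasurable.comp_snd)

/-- The integrand of the nonlocal form. -/
def nonlocalIntegrand (p : ℝ) (K : En n → En n → ℝ) (u φ : En n → ℝ) (z : En n × En n) : ℝ :=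
  Jp p (u z.1 - u z.2) * (φ z.1 - φ z.2) * K z.1 z.2

lemma aestronglyMeasurable_nonlocalIntegrand {K : En n → En n → ℝ}
    (hK : Measurable (Function.uncurry K)) {u φ : En n → ℝ} (hu : AEMeasurable u)
    (hφ : AEMeasurable φ) : AEStronglyMeasurable (nonlocalIntegrand p K u φ) := by
  have hu1 : AEMeasurable fun z : En n × En n => u z.1 := hu.comp_fst
  have hu2 : AEMeasurable fun z : En n × En n => u z.2 := hu.comp_snd
  have hφ1 : AEMeasurable fun z : En n × En n => φ z.1 := hφ.comp_fst
  have hφ2 : AEMeasurable fun z : En n × En n => φ z.2 := hφ.comp_snd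
  exact ((((measurable_Jp p).comp_aemeasurable (hu1.sub hu2)).mul (hφ1.sub hφ2)).mul
    hK.aemeasurable).aestronglyMeasurable

end NonlocalLimit

section NonlocalConvergence

variable {n : ℕ} {p s Λ : ℝ} {K : En n → En n → ℝ} {u : En n → ℝ} {x₀ : En n} {r : ℝ}

lemma nonlocalIntegrand_sub (φ ψ : En n → ℝ) (z : En n × En n) :
    nonlocalIntegrand p K u φ z - nonlocalIntegrand p K u ψ z =
      nonlocalIntegrand p K u (φ - ψ) z := by
  simp only [nonlocalIntegrand, Pi.sub_apply]; ring

/-- The pairs that can contribute to the nonlocal form outside `ball × ball`, for test functions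
supported in the smaller closed ball. -/
def farPairs (x₀ : En n) (r : ℝ) : Set (En n × En n) :=
  closedBall x₀ (3 * r / 2) ×ˢ (ball x₀ (7 * r / 4))ᶜ ∪
    (ball x₀ (7 * r / 4))ᶜ ×ˢ closedBall x₀ (3 * r / 2)

lemma measurableSet_farPairs : MeasurableSet (farPairs x₀ r) :=
  (measurableSet_closedBall.prod measurableSet_ball.compl).union
    (measurableSet_ball.compl.prod measurableSet_closedBall)

lemma lintegral_farPairs_ne_top (hn : 0 < n) (hp : 1 < p) (hs0 : 0 < s)
    (hu : AEMeasurable u) (hut : MemTailSpace p s u) (hr : 0 < r) :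
    ∫⁻ z in farPairs x₀ r, ENNReal.ofReal ((|u z.1| ^ (p - 1) + |u z.2| ^ (p - 1)) *
        ‖z.1 - z.2‖ ^ (-((n : ℝ) + p * s))) ≠ ⊤ := by
  have h1 := lintegral_tail_kernel_ne_top hn hp hs0 hu hut (x₀ := x₀) hr
  refine ne_top_of_le_ne_top (ENNReal.add_ne_top.2 ⟨h1, ?_⟩) (lintegral_union_le _ _ _)
  have h2 := (Measure.measurePreserving_swap (μ := (volume : Measure (En n)))
    (ν := (volume : Measure (En n)))).setLIntegral_comp_preimage_emb
    MeasurableEquiv.prodComm.measurableEmbedding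
    (fun z => ENNReal.ofReal ((|u z.1| ^ (p - 1) + |u z.2| ^ (p - 1)) *
        ‖z.1 - z.2‖ ^ (-((n : ℝ) + p * s)))) (closedBall x₀ (3 * r / 2) ×ˢ (ball x₀ (7 * r / 4))ᶜ)
  rw [preimage_swap_prod] at h2
  refine ne_of_eq_of_ne ?_ h1
  rw [Measure.volume_eq_prod, ← h2]
  refine setLIntegral_congr_fun (measurableSet_ball.compl.prod measurableSet_closedBall)
    fun z _ => ?_
  simp only [Prod.fst_swap, Prod.snd_swap]
  rw [norm_sub_rev, add_comm (|u z.1| ^ (p - 1))]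

lemma enorm_nonlocalIntegrand_le_off (hp : 1 < p) (hΛ : 0 ≤ Λ) (hr : 0 < r)
    {φ : En n → ℝ} {m : ℝ}
    (hφm : ∀ x, |φ x| ≤ m) (hφ : ∀ x, x ∉ closedBall x₀ (3 * r / 2) → φ x = 0) {z : En n × En n}
    (hK0 : 0 ≤ K z.1 z.2) (hK : K z.1 z.2 ≤ Λ * ‖z.1 - z.2‖ ^ (-((n : ℝ) + p * s)))
    (hz : z ∉ ball x₀ (7 * r / 4) ×ˢ ball x₀ (7 * r / 4)) :
    ‖nonlocalIntegrand p K u φ z‖ₑ ≤ (farPairs x₀ r).indicator (fun z =>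
      ENNReal.ofReal (2 ^ (p - 1) * (2 * m) * Λ) *
      ENNReal.ofReal ((|u z.1| ^ (p - 1) + |u z.2| ^ (p - 1)) *
        ‖z.1 - z.2‖ ^ (-((n : ℝ) + p * s)))) z := by
  have hm : 0 ≤ m := (abs_nonneg _).trans (hφm x₀)
  have hQD : closedBall x₀ (3 * r / 2) ⊆ ball x₀ (7 * r / 4) :=
    closedBall_subset_ball (by linarith)
  by_cases hzf : z ∈ farPairs x₀ r
  · rw [indicator_of_mem hzf, ← ENNReal.ofReal_mul (by positivity), enorm_eq_ofReal_abs]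
    apply ENNReal.ofReal_le_ofReal
    rw [nonlocalIntegrand, abs_mul, abs_mul, abs_Jp hp, abs_of_nonneg hK0]
    have h1 : |u z.1 - u z.2| ^ (p - 1) ≤ 2 ^ (p - 1) * (|u z.1| ^ (p - 1) + |u z.2| ^ (p - 1)) :=
      (rpow_le_rpow (abs_nonneg _) (abs_sub _ _) (by linarith)).trans
        (add_rpow_le_two_rpow (abs_nonneg _) (abs_nonneg _) (by linarith))
    have h2 : |φ z.1 - φ z.2| ≤ 2 * m := (abs_sub _ _).trans (by linarith [hφm z.1, hφm z.2])
    calc |u z.1 - u z.2| ^ (p - 1) * |φ z.1 - φ z.2| * K z.1 z.2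
        ≤ (2 ^ (p - 1) * (|u z.1| ^ (p - 1) + |u z.2| ^ (p - 1))) * (2 * m) *
          (Λ * ‖z.1 - z.2‖ ^ (-((n : ℝ) + p * s))) := by
          refine mul_le_mul (mul_le_mul h1 h2 (abs_nonneg _) (by positivity)) hK hK0
            (by positivity)
      _ = _ := by ring
  · rw [indicator_of_notMem hzf]
    have : φ z.1 - φ z.2 = 0 := by
      simp only [farPairs, mem_union, mem_prod, mem_compl_iff, not_or, not_and, not_not] at hzf hz
      by_cases h1 : z.1 ∈ closedBall x₀ (3 * r / 2)
      · exact absurd (hzf.1 h1) (hz (hQD h1))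
      · by_cases h2 : z.2 ∈ closedBall x₀ (3 * r / 2)
        · exact absurd (hQD h2) (fun h => hzf.2 (fun h3 => hz h3 h) h2)
        · rw [hφ _ h1, hφ _ h2, sub_zero]
    simp [nonlocalIntegrand, this]

lemma enorm_nonlocalIntegrand_le_on (hΛ : 0 ≤ Λ) {φ : En n → ℝ} {z : En n × En n}
    (hK0 : 0 ≤ K z.1 z.2) (hK : K z.1 z.2 ≤ Λ * ‖z.1 - z.2‖ ^ (-((n : ℝ) + p * s))) :
    ‖nonlocalIntegrand p K u φ z‖ₑ ≤ ENNReal.ofReal Λ *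
      (ENNReal.ofReal (‖z.1 - z.2‖ ^ (-((n : ℝ) + p * s))) *
        (‖Jp p (u z.1 - u z.2)‖ₑ * ‖φ z.1 - φ z.2‖ₑ)) := by
  rw [nonlocalIntegrand, enorm_mul, enorm_mul, ← mul_assoc, ← ENNReal.ofReal_mul hΛ, mul_comm]
  gcongr
  rw [enorm_eq_ofReal_abs, abs_of_nonneg hK0]
  exact ENNReal.ofReal_le_ofReal hK

/-- The kernel measure on `ball × ball`. -/
def kernelMeasure (n : ℕ) (p s : ℝ) (x₀ : En n) (r : ℝ) : Measure (En n × En n) :=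
  (volume.restrict (ball x₀ (7 * r / 4) ×ˢ ball x₀ (7 * r / 4))).withDensity
    fun z => ENNReal.ofReal (‖z.1 - z.2‖ ^ (-((n : ℝ) + p * s)))

lemma kernelMeasure_ac : kernelMeasure n p s x₀ r ≪ volume :=
  (withDensity_absolutelyContinuous _ _).trans Measure.absolutelyContinuous_restrict

lemma lintegral_kernelMeasure {g : En n × En n → ℝ≥0∞} (hg : AEMeasurable g) :
    ∫⁻ z, g z ∂kernelMeasure n p s x₀ r =
    ∫⁻ z in ball x₀ (7 * r / 4) ×ˢ ball x₀ (7 * r / 4),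
      ENNReal.ofReal (‖z.1 - z.2‖ ^ (-((n : ℝ) + p * s))) * g z := by
  rw [kernelMeasure, lintegral_withDensity_eq_lintegral_mul₀ (by fun_prop) hg.restrict]
  rfl

lemma aemeasurable_enorm_Jp_sub (hu : AEMeasurable u) :
    AEMeasurable fun z : En n × En n => ‖Jp p (u z.1 - u z.2)‖ₑ :=
  ((measurable_Jp p).comp_aemeasurable ((hu.comp_fst (β := En n)).sub hu.comp_snd)).enorm

lemma aemeasurable_enorm_Jp_sub_mul (hu : AEMeasurable u) {w : En n × En n → ℝ}
    (hw : AEMeasurable w) :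
    AEMeasurable fun z : En n × En n => ‖Jp p (u z.1 - u z.2)‖ₑ * ‖w z‖ₑ :=
  (aemeasurable_enorm_Jp_sub hu).mul hw.enorm

lemma lintegral_enorm_Jp_rpow (hp : 1 < p) :
    ∫⁻ z, ‖Jp p (u z.1 - u z.2)‖ₑ ^ (p / (p - 1)) ∂kernelMeasure n p s x₀ r =
      ∫⁻ z, ‖u z.1 - u z.2‖ₑ ^ p ∂kernelMeasure n p s x₀ r := by
  refine lintegral_congr fun z => ?_
  have h1 : ‖Jp p (u z.1 - u z.2)‖ₑ = ‖u z.1 - u z.2‖ₑ ^ (p - 1) := by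
    rw [enorm_eq_ofReal_abs, abs_Jp hp, enorm_eq_ofReal_abs,
      ENNReal.ofReal_rpow_of_nonneg (abs_nonneg _) (by linarith)]
  rw [h1, ← ENNReal.rpow_mul, mul_div_cancel₀ _ (by linarith)]

lemma integrable_nonlocalIntegrand (hn : 0 < n) (hp : 1 < p) (hs0 : 0 < s) (hΛ : 0 ≤ Λ)
    (hKm : Measurable (Function.uncurry K)) (hK0 : ∀ x y, 0 ≤ K x y)
    (hK : ∀ᵐ z ∂(volume : Measure (En n × En n)),
      K z.1 z.2 ≤ Λ * ‖z.1 - z.2‖ ^ (-((n : ℝ) + p * s)))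
    (hu : AEMeasurable u) (hut : MemTailSpace p s u) (hr : 0 < r)
    (huD : ∫⁻ z, ‖u z.1 - u z.2‖ₑ ^ p ∂kernelMeasure n p s x₀ r ≠ ⊤)
    {φ : En n → ℝ} (hφ : AEMeasurable φ) {m : ℝ} (hφm : ∀ x, |φ x| ≤ m)
    (hφ0 : ∀ x, x ∉ closedBall x₀ (3 * r / 2) → φ x = 0)
    (hφD : ∫⁻ z, ‖φ z.1 - φ z.2‖ₑ ^ p ∂kernelMeasure n p s x₀ r ≠ ⊤) :
    Integrable (nonlocalIntegrand p K u φ) := by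
  refine ⟨aestronglyMeasurable_nonlocalIntegrand hKm hu hφ, ?_⟩
  have hDm : MeasurableSet (ball x₀ (7 * r / 4) ×ˢ ball x₀ (7 * r / 4)) :=
    measurableSet_ball.prod measurableSet_ball
  rw [HasFiniteIntegral, ← lintegral_add_compl _ hDm, ENNReal.add_lt_top]
  constructor
  · have h1 : ∫⁻ z, ‖Jp p (u z.1 - u z.2)‖ₑ * ‖φ z.1 - φ z.2‖ₑ ∂kernelMeasure n p s x₀ r ≠ ⊤ := by
      refine ne_top_of_le_ne_top (ENNReal.add_ne_top.2 ⟨huD, hφD⟩) ?_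
      rw [← lintegral_enorm_Jp_rpow hp, ← lintegral_add_left'
        (((aemeasurable_enorm_Jp_sub hu).pow_const _).mono_ac kernelMeasure_ac)]
      exact lintegral_mono fun z => enn_mul_le_rpow_add hp _ _
    have hφm2 : AEMeasurable fun z : En n × En n => φ z.1 - φ z.2 :=
      (hφ.comp_fst (β := En n)).sub hφ.comp_snd
    rw [lintegral_kernelMeasure (aemeasurable_enorm_Jp_sub_mul hu hφm2)] at h1
    refine lt_of_le_of_lt ?_ (ENNReal.mul_lt_top ENNReal.ofReal_lt_top h1.lt_top
      (a := ENNReal.ofReal Λ))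
    rw [← lintegral_const_mul' _ _ ENNReal.ofReal_ne_top]
    refine lintegral_mono_ae (ae_restrict_of_ae ?_)
    filter_upwards [hK] with z hz
    exact enorm_nonlocalIntegrand_le_on hΛ (hK0 _ _) hz
  · have h1 : ∀ᵐ z ∂volume.restrict (ball x₀ (7 * r / 4) ×ˢ ball x₀ (7 * r / 4))ᶜ, _ ≤ _ :=
      (ae_restrict_iff' hDm.compl).2 (by
        filter_upwards [hK] with z hz hzD
        exact enorm_nonlocalIntegrand_le_off (u := u) hp hΛ hr hφm hφ0 (hK0 _ _) hz hzD)
    refine (lintegral_mono_ae h1).trans_lt ((setLIntegral_le_lintegral _ _).trans_lt ?_)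
    rw [lintegral_indicator measurableSet_farPairs, lintegral_const_mul' _ _ ENNReal.ofReal_ne_top]
    exact ENNReal.mul_lt_top ENNReal.ofReal_lt_top
      (lintegral_farPairs_ne_top hn hp hs0 hu hut hr).lt_top

theorem tendsto_integral_nonlocalIntegrand (hn : 0 < n) (hp : 1 < p) (hs0 : 0 < s) (hΛ : 0 ≤ Λ)
    (hKm : Measurable (Function.uncurry K)) (hK0 : ∀ x y, 0 ≤ K x y)
    (hK : ∀ᵐ z ∂(volume : Measure (En n × En n)),
      K z.1 z.2 ≤ Λ * ‖z.1 - z.2‖ ^ (-((n : ℝ) + p * s)))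
    (hu : AEMeasurable u) (hut : MemTailSpace p s u) (hr : 0 < r)
    (huD : ∫⁻ z, ‖u z.1 - u z.2‖ₑ ^ p ∂kernelMeasure n p s x₀ r ≠ ⊤)
    {φ : ℕ → En n → ℝ} {ψ : En n → ℝ} (hφ : ∀ k, AEMeasurable (φ k)) (hψ : AEMeasurable ψ)
    {m : ℝ} (hφm : ∀ k x, |φ k x| ≤ m) (hψm : ∀ x, |ψ x| ≤ m)
    (hφ0 : ∀ k x, x ∉ closedBall x₀ (3 * r / 2) → φ k x = 0)
    (hψ0 : ∀ x, x ∉ closedBall x₀ (3 * r / 2) → ψ x = 0)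
    {M : ℝ≥0∞} (hM : M ≠ ⊤)
    (hφD : ∀ k, ∫⁻ z, ‖φ k z.1 - φ k z.2‖ₑ ^ p ∂kernelMeasure n p s x₀ r ≤ M)
    (hlim : ∀ᵐ x, Filter.Tendsto (fun k => φ k x) Filter.atTop (𝓝 (ψ x))) :
    (∀ k, Integrable (nonlocalIntegrand p K u (φ k))) ∧
    Integrable (nonlocalIntegrand p K u ψ) ∧
    Filter.Tendsto (fun k => ∫ z, nonlocalIntegrand p K u (φ k) z) Filter.atTop
      (𝓝 (∫ z, nonlocalIntegrand p K u ψ z)) := by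
  have hDm : MeasurableSet (ball x₀ (7 * r / 4) ×ˢ ball x₀ (7 * r / 4)) :=
    measurableSet_ball.prod measurableSet_ball
  have hlim2 : ∀ᵐ z : En n × En n, Filter.Tendsto (fun k => φ k z.1 - φ k z.2) Filter.atTop
      (𝓝 (ψ z.1 - ψ z.2)) := by
    filter_upwards [Measure.quasiMeasurePreserving_fst.ae hlim,
      Measure.quasiMeasurePreserving_snd.ae hlim] with z h1 h2
    exact h1.sub h2
  have hφm2 : ∀ k, AEMeasurable fun z : En n × En n => φ k z.1 - φ k z.2 :=
    fun k => ((hφ k).comp_fst (β := En n)).sub (hφ k).comp_snd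
  have hψm2 : AEMeasurable fun z : En n × En n => ψ z.1 - ψ z.2 :=
    (hψ.comp_fst (β := En n)).sub hψ.comp_snd
  have hψD : ∫⁻ z, ‖ψ z.1 - ψ z.2‖ₑ ^ p ∂kernelMeasure n p s x₀ r ≤ M :=
    lintegral_enorm_rpow_le_of_tendsto
      (fun k => ((hφm2 k).aestronglyMeasurable).mono_ac kernelMeasure_ac) hφD
      (kernelMeasure_ac.ae_le hlim2)
  have hint : ∀ k, Integrable (nonlocalIntegrand p K u (φ k)) := fun k =>
    integrable_nonlocalIntegrand hn hp hs0 hΛ hKm hK0 hK hu hut hr huD (hφ k) (hφm k) (hφ0 k)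
      (ne_top_of_le_ne_top hM (hφD k))
  have hint' : Integrable (nonlocalIntegrand p K u ψ) :=
    integrable_nonlocalIntegrand hn hp hs0 hΛ hKm hK0 hK hu hut hr huD hψ hψm hψ0
      (ne_top_of_le_ne_top hM hψD)
  refine ⟨hint, hint', tendsto_integral_of_L1 _ hint'.1 (.of_forall hint) ?_⟩
  have hsplit : ∀ k, ∫⁻ z, ‖nonlocalIntegrand p K u (φ k) z - nonlocalIntegrand p K u ψ z‖ₑ =
      (∫⁻ z in ball x₀ (7 * r / 4) ×ˢ ball x₀ (7 * r / 4), ‖nonlocalIntegrand p K u (φ k - ψ) z‖ₑ)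
      + ∫⁻ z in (ball x₀ (7 * r / 4) ×ˢ ball x₀ (7 * r / 4))ᶜ,
        ‖nonlocalIntegrand p K u (φ k - ψ) z‖ₑ := fun k => by
    simp_rw [nonlocalIntegrand_sub]
    rw [lintegral_add_compl _ hDm]
  simp_rw [hsplit]
  rw [← add_zero (0 : ℝ≥0∞)]
  refine Filter.Tendsto.add ?_ ?_
  · have h1 := tendsto_lintegral_mul_enorm_sub hp (μ := kernelMeasure n p s x₀ r)
      ((aemeasurable_enorm_Jp_sub (p := p) hu).mono_ac kernelMeasure_ac)
      (fun k => ((hφm2 k).aestronglyMeasurable).mono_ac kernelMeasure_ac)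
      (hψm2.aestronglyMeasurable.mono_ac kernelMeasure_ac)
      (by rw [lintegral_enorm_Jp_rpow hp]; exact huD) hM hφD (kernelMeasure_ac.ae_le hlim2)
    have h2 := ENNReal.Tendsto.const_mul h1 (Or.inr (ENNReal.ofReal_ne_top (r := Λ)))
    rw [mul_zero] at h2
    refine tendsto_of_tendsto_of_tendsto_of_le_of_le tendsto_const_nhds h2 (fun _ => bot_le)
      fun k => ?_
    simp only
    have hw : AEMeasurable fun z : En n × En n => φ k z.1 - φ k z.2 - (ψ z.1 - ψ z.2) :=
      (hφm2 k).sub hψm2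
    rw [lintegral_kernelMeasure (aemeasurable_enorm_Jp_sub_mul hu hw),
      ← lintegral_const_mul' _ _ ENNReal.ofReal_ne_top]
    refine lintegral_mono_ae (ae_restrict_of_ae ?_)
    filter_upwards [hK] with z hz
    refine (enorm_nonlocalIntegrand_le_on hΛ (hK0 _ _) hz).trans_eq ?_
    rw [Pi.sub_apply, Pi.sub_apply, sub_sub_sub_comm]
  · have hb : ∀ k x, |(φ k - ψ) x| ≤ m + m := fun k x =>
      (abs_sub _ _).trans (add_le_add (hφm k x) (hψm x))
    have h0 : ∀ k x, x ∉ closedBall x₀ (3 * r / 2) → (φ k - ψ) x = 0 := fun k x hx => by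
      simp [hφ0 k x hx, hψ0 x hx]
    have h1 : ∀ k, ∀ᵐ z ∂volume.restrict (ball x₀ (7 * r / 4) ×ˢ ball x₀ (7 * r / 4))ᶜ, _ ≤ _ :=
      fun k => (ae_restrict_iff' hDm.compl).2 (by
        filter_upwards [hK] with z hz hzD
        exact enorm_nonlocalIntegrand_le_off (u := u) hp hΛ hr (hb k) (h0 k) (hK0 _ _) hz hzD)
    rw [← lintegral_zero (μ := volume.restrict (ball x₀ (7 * r / 4) ×ˢ ball x₀ (7 * r / 4))ᶜ)]
    refine tendsto_lintegral_of_dominated_convergence' _ (fun k =>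
      (aestronglyMeasurable_nonlocalIntegrand hKm hu ((hφ k).sub hψ)).enorm.restrict) h1 ?_ ?_
    · refine ne_top_of_le_ne_top ?_ (setLIntegral_le_lintegral _ _)
      rw [lintegral_indicator measurableSet_farPairs,
        lintegral_const_mul' _ _ ENNReal.ofReal_ne_top]
      exact ENNReal.mul_ne_top ENNReal.ofReal_ne_top
        (lintegral_farPairs_ne_top hn hp hs0 hu hut hr)
    · refine ae_restrict_of_ae ?_
      filter_upwards [hlim2] with z hz
      have h3 : Filter.Tendsto (fun k => nonlocalIntegrand p K u (φ k - ψ) z) Filter.atTop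
          (𝓝 (Jp p (u z.1 - u z.2) * ((ψ z.1 - ψ z.2) - (ψ z.1 - ψ z.2)) * K z.1 z.2)) := by
        refine Filter.Tendsto.congr (fun k => ?_)
          (((hz.sub_const (ψ z.1 - ψ z.2)).const_mul _).mul_const _)
        simp only [nonlocalIntegrand, Pi.sub_apply]; ring
      simpa using h3.enorm

end NonlocalConvergence

section NonlocalLogTest

variable {n : ℕ} {p s Λ d : ℝ} {K : En n → En n → ℝ} {u ζ : En n → ℝ} {x₀ : En n} {r : ℝ}

lemma abs_logTest_le (hp : 1 < p) (hd : 0 < d) {v : En n → ℝ} (hζ0 : ∀ x, 0 ≤ ζ x)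
    (hζ1 : ∀ x, ζ x ≤ 1) (hv0 : ∀ x, ζ x ≠ 0 → 0 ≤ v x) (x : En n) :
    |logTest p d ζ v x| ≤ d ^ (1 - p) := by
  by_cases h : ζ x = 0
  · simp only [logTest, h, zero_mul, abs_zero]; positivity
  · rw [abs_of_nonneg (logTest_nonneg hd hζ0 (hv0 x h))]
    exact (logTest_le hp hd (hζ0 x) (hv0 x h)).trans (mul_le_of_le_one_left (by positivity) (hζ1 x))

lemma aemeasurable_logTest (hζ : Measurable ζ) (hu : AEMeasurable u) :
    AEMeasurable (logTest p d ζ u) :=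
  hζ.aemeasurable.mul ((hu.add_const d).pow_const _)

lemma exists_lintegral_kernelMeasure_le (hn : 0 < n) (hp : 1 < p) (hs0 : 0 < s) (hs1 : s < 1)
    (x₀ : En n) (r : ℝ) :
    ∃ C : ℝ≥0∞, C ≠ ⊤ ∧ ∀ f : En n → ℝ, ContDiff ℝ (⊤ : ℕ∞) f →
      ∫⁻ z, ‖f z.1 - f z.2‖ₑ ^ p ∂kernelMeasure n p s x₀ r ≤
        C * ∫⁻ x in ball x₀ (7 * r / 4), ‖gradient f x‖ₑ ^ p := by
  obtain ⟨C, hC, h⟩ := lintegral_gagliardo_le hn hp hs0 hs1 x₀ (7 * r / 4)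
  refine ⟨C, hC, fun f hf => ?_⟩
  have hm : Measurable fun z : En n × En n => ‖f z.1 - f z.2‖ₑ ^ p := by
    have := hf.continuous.measurable
    fun_prop
  rw [lintegral_kernelMeasure hm.aemeasurable]
  simp_rw [mul_comm (ENNReal.ofReal _)]
  exact h f hf

theorem tendsto_integral_nonlocalIntegrand_logTest (hn : 0 < n) (hp : 1 < p) (hs0 : 0 < s)
    (hs1 : s < 1) (hΛ : 0 ≤ Λ)
    (hKm : Measurable (Function.uncurry K)) (hK0 : ∀ x y, 0 ≤ K x y)
    (hK : ∀ᵐ z ∂(volume : Measure (En n × En n)),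
      K z.1 z.2 ≤ Λ * ‖z.1 - z.2‖ ^ (-((n : ℝ) + p * s)))
    (hu : AEMeasurable u) (hut : MemTailSpace p s u) (hr : 0 < r) (hd : 0 < d)
    (hu0 : ∀ x ∈ ball x₀ (2 * r), 0 ≤ u x) {v : ℕ → En n → ℝ}
    (hv : ∀ k, ContDiff ℝ (⊤ : ℕ∞) (v k)) (hv0 : ∀ k x, 0 ≤ v k x)
    (hlim : ∀ᵐ x, x ∈ ball x₀ (7 * r / 4) →
      Filter.Tendsto (fun k => v k x) Filter.atTop (𝓝 (u x)))
    {M : ℝ≥0∞} (hM : M ≠ ⊤) (hvM : ∀ k, ∫⁻ x in ball x₀ (7 * r / 4), ‖gradient (v k) x‖ₑ ^ p ≤ M)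
    (hζ : ContDiff ℝ (⊤ : ℕ∞) ζ) (hζ0 : ∀ x, 0 ≤ ζ x) (hζ1 : ∀ x, ζ x ≤ 1)
    (hζQ : ∀ x, x ∉ closedBall x₀ (3 * r / 2) → ζ x = 0) :
    (∀ k, Integrable (nonlocalIntegrand p K u (logTest p d ζ (v k)))) ∧
    Integrable (nonlocalIntegrand p K u (logTest p d ζ u)) ∧
    Filter.Tendsto (fun k => ∫ z, nonlocalIntegrand p K u (logTest p d ζ (v k)) z) Filter.atTop
      (𝓝 (∫ z, nonlocalIntegrand p K u (logTest p d ζ u) z)) := by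
  have hζc : HasCompactSupport ζ := HasCompactSupport.intro (isCompact_closedBall x₀ _) hζQ
  obtain ⟨C, hC, hgag⟩ := exists_lintegral_kernelMeasure_le hn hp hs0 hs1 x₀ r
  obtain ⟨M', hM', hgrad⟩ := exists_lintegral_gradient_logTest_le hp hd hζ hζc hζ0 hζ1
    (ball x₀ (7 * r / 4)) measure_ball_lt_top.ne hM
  have hDm := kernelMeasure_ac (n := n) (p := p) (s := s) (x₀ := x₀) (r := r)
  have hζ2 : ∀ x, ζ x ≠ 0 → x ∈ closedBall x₀ (3 * r / 2) := fun x hx => by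
    by_contra h; exact hx (hζQ x h)
  have hD : ∀ᵐ z ∂kernelMeasure n p s x₀ r,
      z ∈ ball x₀ (7 * r / 4) ×ˢ ball x₀ (7 * r / 4) :=
    (withDensity_absolutelyContinuous _ _).ae_le
      (ae_restrict_mem (measurableSet_ball.prod measurableSet_ball))
  have huD : ∫⁻ z, ‖u z.1 - u z.2‖ₑ ^ p ∂kernelMeasure n p s x₀ r ≤ C * M := by
    refine lintegral_enorm_rpow_le_of_tendsto (F := fun k z => v k z.1 - v k z.2) (fun k => ?_)
      (fun k => (hgag _ (hv k)).trans (by gcongr; exact hvM k)) ?_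
    · have := (hv k).continuous
      exact Continuous.aestronglyMeasurable (by fun_prop)
    · filter_upwards [hD, hDm.ae_le (Measure.quasiMeasurePreserving_fst.ae hlim),
        hDm.ae_le (Measure.quasiMeasurePreserving_snd.ae hlim)] with z hz h1 h2
      exact (h1 hz.1).sub (h2 hz.2)
  refine tendsto_integral_nonlocalIntegrand hn hp hs0 hΛ hKm hK0 hK hu hut hr
    (ne_top_of_le_ne_top (ENNReal.mul_ne_top hC hM) huD)
    (fun k => aemeasurable_logTest hζ.continuous.measurable (hv k).continuous.aemeasurable)
    (aemeasurable_logTest hζ.continuous.measurable hu) (m := d ^ (1 - p))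
    (fun k => abs_logTest_le hp hd hζ0 hζ1 fun x _ => hv0 k x)
    (abs_logTest_le hp hd hζ0 hζ1 fun x hx => hu0 x
      (closedBall_subset_ball (by linarith) (hζ2 x hx)))
    (fun k x hx => by simp [logTest, hζQ x hx]) (fun x hx => by simp [logTest, hζQ x hx])
    (ENNReal.mul_ne_top hC hM') (fun k => ?_) ?_
  · exact (hgag _ (contDiff_logTest hd hζ (hv k) (hv0 k))).trans
      (by gcongr; exact hgrad _ (hv k) (hv0 k) (hvM k))
  · filter_upwards [hlim] with x hx
    by_cases h : x ∈ closedBall x₀ (3 * r / 2)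
    · exact tendsto_logTest hd (hu0 x (closedBall_subset_ball (by linarith) h))
        (hx (closedBall_subset_ball (by linarith) h))
    · simp [logTest, hζQ x h]

end NonlocalLogTest

section Cutoff

variable {n : ℕ} {p : ℝ}

lemma gradient_pow {f : En n → ℝ} (hf : ContDiff ℝ (⊤ : ℕ∞) f) (m : ℕ) (x : En n) :
    gradient (fun y => f y ^ m) x = (m * f x ^ (m - 1)) • gradient f x := by
  have h := ((hf.differentiable (by simp) x).hasFDerivAt).pow m
  rw [gradient, h.fderiv, gradient, ← map_smul]
  simp

lemma gradient_comp_smul_sub {f : En n → ℝ} (hf : ContDiff ℝ (⊤ : ℕ∞) f) (c : ℝ) (z x : En n) :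
    gradient (fun y => f (c • (y - z))) x = c • gradient f (c • (x - z)) := by
  have h1 : HasFDerivAt (fun y : En n => c • (y - z)) (c • ContinuousLinearMap.id ℝ (En n)) x :=
    ((hasFDerivAt_id x).sub_const z).const_smul c
  have h := ((hf.differentiable (by simp) (c • (x - z))).hasFDerivAt).comp x h1
  have e : fderiv ℝ (fun y => f (c • (y - z))) x = c • fderiv ℝ f (c • (x - z)) := by
    rw [show (fun y => f (c • (y - z))) = f ∘ fun y => c • (y - z) from rfl, h.fderiv]
    ext y; simp
  rw [gradient, e, gradient, map_smul]

/-- A cutoff function `a` whose power `a ^ p` is smooth. -/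
lemma exists_unit_cutoff (n : ℕ) (hp : 1 < p) :
    ∃ (L : ℝ) (a : En n → ℝ), 0 < L ∧ ContDiff ℝ (⊤ : ℕ∞) (fun x => a x ^ p) ∧
      (∀ x, 0 ≤ a x) ∧ (∀ x, a x ≤ 1) ∧ (∀ x y, |a x - a y| ≤ L * ‖x - y‖) ∧
      (∀ x, ‖x‖ ≤ 1 → a x = 1) ∧ (∀ x, 5 / 4 < ‖x‖ → a x = 0) ∧
      ∀ x, ‖gradient (fun x => a x ^ p) x‖ ≤ L * a x ^ (p - 1) := by
  have hp0 : 0 < p := by linarith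
  let χ : ContDiffBump (0 : En n) := ⟨1, 5 / 4, by norm_num, by norm_num⟩
  obtain ⟨m, hm⟩ := exists_nat_ge p
  have ht : 1 ≤ (m : ℝ) / p := (one_le_div hp0).2 hm
  have hm1 : 1 ≤ m := by exact_mod_cast hp.le.trans hm
  set a : En n → ℝ := fun x => χ x ^ ((m : ℝ) / p)
  have hap : (fun x => a x ^ p) = fun x => χ x ^ m := by
    ext x
    simp only [a]
    rw [← rpow_mul χ.nonneg, div_mul_cancel₀ _ hp0.ne', rpow_natCast]
  have hχs : ContDiff ℝ (⊤ : ℕ∞) χ := χ.contDiff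
  have ha1 : ContDiff ℝ 1 a :=
    (χ.contDiff (n := (1 : ℕ))).rpow_const_of_le (f := fun x => χ x) (by simpa using ht)
  have hac : HasCompactSupport a := χ.hasCompactSupport.comp_left
    (g := fun y : ℝ => y ^ ((m : ℝ) / p)) (zero_rpow (by positivity))
  obtain ⟨L₁, hL₁⟩ := ha1.lipschitzWith_of_hasCompactSupport hac (by simp)
  obtain ⟨L₂, hL₂⟩ : ∃ L, ∀ x, ‖gradient χ x‖ ≤ L := by
    obtain ⟨L, hL⟩ := (χ.hasCompactSupport.fderiv ℝ).exists_bound_of_continuous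
      (hχs.continuous_fderiv (by simp))
    exact ⟨L, fun x => by simpa [gradient] using hL x⟩
  have hL₂0 : 0 ≤ L₂ := (norm_nonneg _).trans (hL₂ 0)
  refine ⟨L₁ + m * L₂ + 1, a, by positivity, ?_, fun x => rpow_nonneg χ.nonneg _,
    fun x => rpow_le_one χ.nonneg χ.le_one (by positivity), fun x y => ?_, fun x hx => ?_,
    fun x hx => ?_, fun x => ?_⟩
  · rw [hap]; exact hχs.pow m
  · have := hL₁.dist_le_mul x y
    rw [Real.dist_eq, dist_eq_norm] at this
    refine this.trans ?_
    gcongr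
    have : 0 ≤ (m : ℝ) * L₂ := by positivity
    linarith
  · simp only [a]
    rw [χ.one_of_mem_closedBall (by simpa [χ] using hx), one_rpow]
  · simp only [a]
    rw [χ.zero_of_le_dist (by simpa [χ] using hx.le), zero_rpow (by positivity)]
  · rw [hap, gradient_pow hχs, norm_smul, Real.norm_of_nonneg
      (mul_nonneg (Nat.cast_nonneg _) (pow_nonneg χ.nonneg _))]
    have h1 : χ x ^ (m - 1) ≤ a x ^ (p - 1) := by
      simp only [a]
      rw [← rpow_mul χ.nonneg, ← rpow_natCast, Nat.cast_sub hm1]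
      rcases χ.nonneg.eq_or_lt' (a := χ x) with h0 | h0
      · rw [h0]
        by_cases h2 : (m : ℝ) - (1 : ℕ) = 0
        · have h3 : (m : ℝ) = 1 := by push_cast at h2; linarith
          linarith
        · rw [zero_rpow h2]; positivity
      · refine rpow_le_rpow_of_exponent_ge h0 χ.le_one ?_
        have : (m : ℝ) / p * (p - 1) = m - m / p := by field_simp
        rw [this]; push_cast; linarith
    calc m * χ x ^ (m - 1) * ‖gradient χ x‖ ≤ m * a x ^ (p - 1) * L₂ := by
          refine mul_le_mul (mul_le_mul_of_nonneg_left h1 (Nat.cast_nonneg _)) (hL₂ x)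
            (norm_nonneg _) ?_
          exact mul_nonneg (Nat.cast_nonneg _) (rpow_nonneg (rpow_nonneg χ.nonneg _) _)
      _ = m * L₂ * a x ^ (p - 1) := by ring
      _ ≤ (L₁ + m * L₂ + 1) * a x ^ (p - 1) := by
          refine mul_le_mul_of_nonneg_right ?_ (rpow_nonneg (rpow_nonneg χ.nonneg _) _)
          have : (0 : ℝ) ≤ L₁ := L₁.2
          linarith

/-- `a` is a cutoff between the ball of radius `ρ` and the ball of radius `5ρ/4` about `z`,
with `a ^ p` smooth. -/
structure IsCutoff (p L : ℝ) (z : En n) (ρ : ℝ) (a : En n → ℝ) : Prop where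
  smooth : ContDiff ℝ (⊤ : ℕ∞) (fun x => a x ^ p)
  nonneg : ∀ x, 0 ≤ a x
  le_one : ∀ x, a x ≤ 1
  lipschitz : ∀ x y, |a x - a y| ≤ L / ρ * ‖x - y‖
  eq_one : ∀ x ∈ closedBall z ρ, a x = 1
  eq_zero : ∀ x, x ∉ closedBall z (5 * ρ / 4) → a x = 0
  norm_gradient_le : ∀ x, ‖gradient (fun x => a x ^ p) x‖ ≤ L / ρ * a x ^ (p - 1)

lemma exists_isCutoff (n : ℕ) (hp : 1 < p) :
    ∃ L : ℝ, 0 < L ∧ ∀ (z : En n) (ρ : ℝ), 0 < ρ → ∃ a, IsCutoff p L z ρ a := by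
  obtain ⟨L, a, hL, hs, h0, h1, hlip, hone, hzero, hgrad⟩ := exists_unit_cutoff n hp
  refine ⟨L, hL, fun z ρ hρ => ⟨fun x => a (ρ⁻¹ • (x - z)), ?_, fun x => h0 _, fun x => h1 _,
    fun x y => ?_, fun x hx => hone _ ?_, fun x hx => hzero _ ?_, fun x => ?_⟩⟩
  · exact hs.comp (f := fun x : En n => ρ⁻¹ • (x - z)) (by fun_prop)
  · refine (hlip _ _).trans_eq ?_
    rw [← smul_sub, sub_sub_sub_cancel_right, norm_smul, norm_inv, Real.norm_of_nonneg hρ.le]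
    ring
  · rw [mem_closedBall, dist_eq_norm] at hx
    rw [norm_smul, norm_inv, Real.norm_of_nonneg hρ.le, inv_mul_le_iff₀ hρ, mul_one]
    exact hx
  · rw [mem_closedBall, dist_eq_norm, not_le] at hx
    rw [norm_smul, norm_inv, Real.norm_of_nonneg hρ.le, lt_inv_mul_iff₀ hρ]
    linarith
  · rw [gradient_comp_smul_sub hs, norm_smul, norm_inv, Real.norm_of_nonneg hρ.le, div_eq_inv_mul,
      mul_assoc]
    gcongr
    exact hgrad _

end Cutoff

section NonlocalBound

variable {n : ℕ} {p s Λ d L : ℝ} {K : En n → En n → ℝ} {u a : En n → ℝ} {x₀ z : En n} {r R ρ : ℝ}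

lemma volume_closedBall_eq (hn : 0 < n) (z : En n) {t : ℝ} (ht : 0 ≤ t) :
    volume (closedBall z t) = ENNReal.ofReal (t ^ n) * volume (ball (0 : En n) 1) := by
  have : Nonempty (Fin n) := ⟨⟨0, hn⟩⟩
  rw [Measure.addHaar_closedBall _ _ ht, finrank_euclideanSpace_fin]

lemma IsCutoff.continuous (ha : IsCutoff p L z ρ a) (hL : 0 < L) (hρ : 0 < ρ) : Continuous a :=
  (Metric.uniformContinuous_iff.2 fun ε hε => by
    refine ⟨ε / (L / ρ), by positivity, fun {x y} hxy => ?_⟩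
    rw [lt_div_iff₀ (by positivity)] at hxy
    rw [Real.dist_eq]
    refine (ha.lipschitz x y).trans_lt ?_
    rwa [← dist_eq_norm, mul_comm]).continuous

lemma lintegral_min_scaled {c : ℝ} (hc : 0 < c) :
    ∫⁻ h : En n, ENNReal.ofReal (min 1 (c * ‖h‖) ^ p * ‖h‖ ^ (-((n : ℝ) + p * s))) =
      ENNReal.ofReal (c ^ (p * s)) *
        ∫⁻ h : En n, ENNReal.ofReal (min 1 ‖h‖ ^ p * ‖h‖ ^ (-((n : ℝ) + p * s))) := by
  have h1 := lintegral_comp_add_smul (n := n)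
    (fun h => ENNReal.ofReal (min 1 (c * ‖h‖) ^ p * ‖h‖ ^ (-((n : ℝ) + p * s)))) 0
    (inv_pos.2 hc)
  have h2 : ∀ h : En n, ENNReal.ofReal (min 1 (c * ‖(0 : En n) + c⁻¹ • h‖) ^ p *
      ‖(0 : En n) + c⁻¹ • h‖ ^ (-((n : ℝ) + p * s))) = ENNReal.ofReal (c ^ ((n : ℝ) + p * s)) *
      ENNReal.ofReal (min 1 ‖h‖ ^ p * ‖h‖ ^ (-((n : ℝ) + p * s))) := fun h => by
    rw [zero_add, norm_smul, norm_inv, Real.norm_of_nonneg hc.le, ← mul_assoc,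
      mul_inv_cancel₀ hc.ne', one_mul, mul_rpow (by positivity) (norm_nonneg _),
      ← ENNReal.ofReal_mul (by positivity), inv_rpow hc.le, rpow_neg hc.le, inv_inv]
    congr 1; ring
  simp_rw [h2] at h1
  rw [lintegral_const_mul' _ _ ENNReal.ofReal_ne_top, inv_pow, inv_inv] at h1
  have h3 : ENNReal.ofReal (c ^ ((n : ℝ) + p * s)) =
      ENNReal.ofReal (c ^ n) * ENNReal.ofReal (c ^ (p * s)) := by
    rw [← ENNReal.ofReal_mul (by positivity), rpow_add hc, rpow_natCast]
  rw [h3, mul_assoc] at h1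
  exact ((ENNReal.mul_right_inj (by simpa using pow_pos hc n) ENNReal.ofReal_ne_top).1 h1).symm

lemma exists_lintegral_cutoff_le (hn : 0 < n) (hp : 1 < p) (hs0 : 0 < s) (hs1 : s < 1)
    (hL : 0 < L) :
    ∃ C : ℝ, 0 ≤ C ∧ ∀ (z : En n) (ρ : ℝ) (a : En n → ℝ), 0 < ρ → IsCutoff p L z ρ a →
      ∫⁻ w : En n × En n, ENNReal.ofReal (|a w.1 - a w.2| ^ p *
        ‖w.1 - w.2‖ ^ (-((n : ℝ) + p * s))) ≤ ENNReal.ofReal (C * ρ ^ ((n : ℝ) - p * s)) := by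
  have hp0 : 0 < p := by linarith
  set I := ∫⁻ h : En n, ENNReal.ofReal (min 1 ‖h‖ ^ p * ‖h‖ ^ (-((n : ℝ) + p * s)))
  have hI : I ≠ ⊤ := (integrable_min_one_rpow_mul_norm_rpow hn hp hs0 hs1).lintegral_lt_top.ne
  set V := volume (ball (0 : En n) 1)
  have hV : V ≠ ⊤ := measure_ball_lt_top.ne
  refine ⟨2 * ((5 / 4) ^ n * V.toReal) * (L ^ (p * s) * I.toReal), by positivity,
    fun z ρ a hρ ha => ?_⟩
  set B := closedBall z (5 * ρ / 4)
  set g : En n → ℝ≥0∞ := fun h =>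
    ENNReal.ofReal (min 1 (L / ρ * ‖h‖) ^ p * ‖h‖ ^ (-((n : ℝ) + p * s)))
  have hg : Measurable g := by fun_prop
  have hpt : ∀ w : En n × En n, ENNReal.ofReal (|a w.1 - a w.2| ^ p *
        ‖w.1 - w.2‖ ^ (-((n : ℝ) + p * s))) ≤
      B.indicator 1 w.1 * g (w.1 - w.2) + B.indicator 1 w.2 * g (w.1 - w.2) := fun w => by
    have h1 : |a w.1 - a w.2| ≤ min 1 (L / ρ * ‖w.1 - w.2‖) := by
      refine le_min (abs_le.2 ⟨?_, ?_⟩) (ha.lipschitz _ _) <;>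
        linarith [ha.nonneg w.1, ha.nonneg w.2, ha.le_one w.1, ha.le_one w.2]
    have h2 : ENNReal.ofReal (|a w.1 - a w.2| ^ p * ‖w.1 - w.2‖ ^ (-((n : ℝ) + p * s))) ≤
        g (w.1 - w.2) := by
      apply ENNReal.ofReal_le_ofReal
      gcongr
    by_cases hw1 : w.1 ∈ B
    · rw [indicator_of_mem hw1, Pi.one_apply, one_mul]
      exact h2.trans le_self_add
    · by_cases hw2 : w.2 ∈ B
      · rw [indicator_of_mem hw2, Pi.one_apply, one_mul]
        exact h2.trans le_add_self
      · rw [ha.eq_zero _ hw1, ha.eq_zero _ hw2, sub_zero, abs_zero, zero_rpow hp0.ne', zero_mul,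
          ENNReal.ofReal_zero]
        exact bot_le
  have hB : MeasurableSet B := measurableSet_closedBall
  have hBm : Measurable (B.indicator (1 : En n → ℝ≥0∞)) := measurable_one.indicator hB
  have hgI : ∫⁻ h, g h = ENNReal.ofReal ((L / ρ) ^ (p * s)) * I :=
    lintegral_min_scaled (by positivity)
  have hgm2 : Measurable fun w : En n × En n => g (w.1 - w.2) := by fun_prop
  have hm1 : Measurable fun w : En n × En n => B.indicator 1 w.1 * g (w.1 - w.2) :=
    (hBm.comp measurable_fst).mul hgm2
  have hm2 : Measurable fun w : En n × En n => B.indicator 1 w.2 * g (w.1 - w.2) :=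
    (hBm.comp measurable_snd).mul hgm2
  have h1 : ∫⁻ w : En n × En n, B.indicator 1 w.1 * g (w.1 - w.2) = volume B * ∫⁻ h, g h := by
    rw [Measure.volume_eq_prod, lintegral_prod _ hm1.aemeasurable]
    simp only
    rw [← lintegral_indicator_one hB, ← lintegral_mul_const _ hBm]
    refine lintegral_congr fun x => ?_
    rw [lintegral_const_mul _ (by fun_prop), lintegral_sub_left_eq_self g x]
  have h2 : ∫⁻ w : En n × En n, B.indicator 1 w.2 * g (w.1 - w.2) = volume B * ∫⁻ h, g h := by
    rw [Measure.volume_eq_prod, lintegral_prod_symm _ hm2.aemeasurable]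
    simp only
    rw [← lintegral_indicator_one hB, ← lintegral_mul_const _ hBm]
    refine lintegral_congr fun x => ?_
    rw [lintegral_const_mul _ (by fun_prop), lintegral_sub_right_eq_self g x]
  calc _ ≤ ∫⁻ w : En n × En n,
        (B.indicator 1 w.1 * g (w.1 - w.2) + B.indicator 1 w.2 * g (w.1 - w.2)) :=
        lintegral_mono hpt
    _ = 2 * (volume B * ∫⁻ h, g h) := by
        rw [lintegral_add_left hm1, h1, h2, two_mul]
    _ = _ := by
        have key : ∀ v i : ℝ, 0 ≤ v → 0 ≤ i → 2 * (ENNReal.ofReal ((5 * ρ / 4) ^ n) *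
            ENNReal.ofReal v * (ENNReal.ofReal ((L / ρ) ^ (p * s)) * ENNReal.ofReal i)) =
            ENNReal.ofReal (2 * ((5 / 4) ^ n * v) * (L ^ (p * s) * i) * ρ ^ ((n : ℝ) - p * s)) := by
          intro v i hv hi
          rw [show (2 : ℝ≥0∞) = ENNReal.ofReal 2 by simp, ← ENNReal.ofReal_mul (by positivity),
            ← ENNReal.ofReal_mul (by positivity), ← ENNReal.ofReal_mul (by positivity),
            ← ENNReal.ofReal_mul (by positivity), div_rpow hL.le hρ.le, rpow_sub hρ, rpow_natCast,
            mul_div_right_comm, mul_pow]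
          congr 1
          ring
        have := key V.toReal I.toReal (by positivity) (by positivity)
        rwa [ENNReal.ofReal_toReal hI, ENNReal.ofReal_toReal hV, ← hgI,
          ← volume_closedBall_eq hn z (by positivity)] at this

end NonlocalBound

section NonlocalUpperBound

variable {n : ℕ} {p s Λ d L : ℝ} {K : En n → En n → ℝ} {u a : En n → ℝ} {x₀ z : En n} {r R ρ : ℝ}

lemma lintegral_cutoff_tail_le (hn : 0 < n) (hp : 1 < p) (hs0 : 0 < s) (hρ : 0 < ρ)
    (ha : IsCutoff p L z ρ a) (hu : AEMeasurable u) (hu0 : ∀ x ∈ ball x₀ R, 0 ≤ u x)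
    (hrR : 2 * r < R) (hr : 0 < r) (hz : closedBall z (5 * ρ / 4) ⊆ closedBall x₀ (3 * r / 2)) :
    ∫⁻ w : En n × En n, ENNReal.ofReal (a w.1 ^ p * nneg u w.2 ^ (p - 1) *
        ‖w.1 - w.2‖ ^ (-((n : ℝ) + p * s))) ≤
      ENNReal.ofReal (4 ^ ((n : ℝ) + p * s) * (5 * ρ / 4) ^ n) * volume (ball (0 : En n) 1) *
        ∫⁻ y in (ball x₀ R)ᶜ, ENNReal.ofReal (nneg u y ^ (p - 1) *
          ‖y - x₀‖ ^ (-((n : ℝ) + p * s))) := by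
  have hp0 : 0 < p := by linarith
  have hn' : (0 : ℝ) < n := by exact_mod_cast hn
  have hN : 0 < (n : ℝ) + p * s := by positivity
  set B := closedBall z (5 * ρ / 4)
  set g : En n → ℝ≥0∞ := fun y => ENNReal.ofReal (nneg u y ^ (p - 1) *
          ‖y - x₀‖ ^ (-((n : ℝ) + p * s)))
  have hum : AEMeasurable (nneg u) := hu.neg.max aemeasurable_const
  have hg : AEMeasurable g := ((hum.pow_const _).mul (by fun_prop)).ennreal_ofReal
  have hE : MeasurableSet (ball x₀ R)ᶜ := measurableSet_ball.compl
  have hpt : ∀ w : En n × En n, ENNReal.ofReal (a w.1 ^ p * nneg u w.2 ^ (p - 1) *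
        ‖w.1 - w.2‖ ^ (-((n : ℝ) + p * s))) ≤
      ENNReal.ofReal (4 ^ ((n : ℝ) + p * s)) *
        (B.indicator 1 w.1 * (ball x₀ R)ᶜ.indicator g w.2) := by
    rintro ⟨x, y⟩
    simp only
    by_cases hx : x ∈ B
    · by_cases hy : y ∈ ball x₀ R
      · have : nneg u y = 0 := max_eq_right (by linarith [hu0 y hy])
        rw [this, zero_rpow (by linarith), mul_zero, zero_mul, ENNReal.ofReal_zero]
        exact bot_le
      · rw [indicator_of_mem hx, Pi.one_apply, one_mul, indicator_of_mem hy,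
          ← ENNReal.ofReal_mul (by positivity)]
        apply ENNReal.ofReal_le_ofReal
        have h1 : dist x x₀ ≤ 3 * r / 2 := hz hx
        have h2 : R ≤ dist y x₀ := by simpa using hy
        have h3 : ‖y - x₀‖ / 4 ≤ ‖x - y‖ := by
          rw [← dist_eq_norm, ← dist_eq_norm]
          linarith [dist_triangle_left y x₀ x]
        have h4 : 0 < ‖y - x₀‖ / 4 := by rw [← dist_eq_norm]; linarith
        have hn0 : 0 ≤ nneg u y := le_max_right _ _
        have h5 : ‖x - y‖ ^ (-((n : ℝ) + p * s)) ≤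
            4 ^ ((n : ℝ) + p * s) * ‖y - x₀‖ ^ (-((n : ℝ) + p * s)) := by
          refine (rpow_le_rpow_of_nonpos h4 h3 (by linarith)).trans_eq ?_
          rw [div_rpow (norm_nonneg _) (by norm_num), rpow_neg (x := 4) (by norm_num),
            div_inv_eq_mul,
            mul_comm]
        have h6 : a x ^ p ≤ 1 := rpow_le_one (ha.nonneg x) (ha.le_one x) hp0.le
        calc a x ^ p * nneg u y ^ (p - 1) * ‖x - y‖ ^ (-((n : ℝ) + p * s))
            ≤ 1 * nneg u y ^ (p - 1) *
              (4 ^ ((n : ℝ) + p * s) * ‖y - x₀‖ ^ (-((n : ℝ) + p * s))) := by gcongr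
          _ = _ := by ring
    · rw [ha.eq_zero x hx, zero_rpow hp0.ne', zero_mul, zero_mul, ENNReal.ofReal_zero]
      exact bot_le
  refine (lintegral_mono hpt).trans_eq ?_
  rw [lintegral_const_mul' _ _ ENNReal.ofReal_ne_top, Measure.volume_eq_prod,
    lintegral_prod_mul (measurable_one.indicator measurableSet_closedBall).aemeasurable
      (hg.indicator hE), lintegral_indicator_one measurableSet_closedBall, lintegral_indicator hE,
    volume_closedBall_eq hn z (by positivity), ENNReal.ofReal_mul (by positivity)]
  ring

lemma integral_le_of_lintegral_ofReal_le {α : Type*} [MeasurableSpace α] {μ : Measure α}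
    {f : α → ℝ} (hf : Integrable f μ) {c : ℝ} (hc : 0 ≤ c)
    (h : ∫⁻ x, ENNReal.ofReal (f x) ∂μ ≤ ENNReal.ofReal c) : ∫ x, f x ∂μ ≤ c := by
  rw [integral_eq_lintegral_pos_part_sub_lintegral_neg_part hf]
  exact (sub_le_self _ ENNReal.toReal_nonneg).trans (ENNReal.toReal_le_of_le_ofReal hc h)

theorem exists_integral_nonlocalIntegrand_logTest_le (hn : 0 < n) (hp : 1 < p) (hs0 : 0 < s)
    (hs1 : s < 1) (hL : 0 < L) (hΛ : 0 ≤ Λ) :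
    ∃ C : ℝ, 0 ≤ C ∧ ∀ (K : En n → En n → ℝ) (u a : En n → ℝ) (x₀ z : En n) (r R ρ d : ℝ),
      (∀ x y, 0 ≤ K x y) →
      (∀ᵐ z ∂(volume : Measure (En n × En n)),
        K z.1 z.2 ≤ Λ * ‖z.1 - z.2‖ ^ (-((n : ℝ) + p * s))) →
      AEMeasurable u → (∀ x ∈ ball x₀ R, 0 ≤ u x) → 0 < ρ → ρ ≤ r → r ≤ 1 → 2 * r < R → 0 < d →
      IsCutoff p L z ρ a → closedBall z (5 * ρ / 4) ⊆ closedBall x₀ (3 * r / 2) →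
      ∫⁻ y in (ball x₀ R)ᶜ, ENNReal.ofReal (nneg u y ^ (p - 1) *
          ‖y - x₀‖ ^ (-((n : ℝ) + p * s))) ≤ ENNReal.ofReal (d ^ (p - 1) * r ^ (-p)) →
      Integrable (nonlocalIntegrand p K u (logTest p d (fun x => a x ^ p) u)) →
      ∫ w, nonlocalIntegrand p K u (logTest p d (fun x => a x ^ p) u) w ≤
        C * ρ ^ ((n : ℝ) - p) := by
  have hp0 : 0 < p := by linarith
  obtain ⟨C₁, hC₁, hcut⟩ := exists_lintegral_cutoff_le hn hp hs0 hs1 hL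
  set V := volume (ball (0 : En n) 1)
  have hV : V ≠ ⊤ := measure_ball_lt_top.ne
  set C₂ : ℝ := 4 ^ ((n : ℝ) + p * s) * (5 / 4) ^ n * V.toReal
  have hC₂ : 0 ≤ C₂ := by positivity
  refine ⟨2 ^ p * Λ * (C₁ + 2 * C₂), by positivity, ?_⟩
  intro K u a x₀ z r R ρ d hK0 hK hu hu0 hρ hρr hr1 hrR hd ha hz hT hint
  have hr : 0 < r := hρ.trans_le hρr
  have ham := (ha.continuous hL hρ).measurable
  have hum : AEMeasurable (nneg u) := hu.neg.max aemeasurable_const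
  set t₁ : En n × En n → ℝ := fun w => |a w.1 - a w.2| ^ p *
        ‖w.1 - w.2‖ ^ (-((n : ℝ) + p * s))
  set t₂ : En n × En n → ℝ := fun w => a w.1 ^ p * nneg u w.2 ^ (p - 1) *
        ‖w.1 - w.2‖ ^ (-((n : ℝ) + p * s))
  have ht₁ : ∀ w, 0 ≤ t₁ w := fun w => by positivity
  have ht₂ : ∀ w, 0 ≤ t₂ w := fun w => mul_nonneg (mul_nonneg (rpow_nonneg (ha.nonneg _) _)
    (rpow_nonneg (le_max_right _ _) _)) (by positivity)
  have ht₁m : AEMeasurable t₁ := Measurable.aemeasurable (by fun_prop)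
  have ht₂m : AEMeasurable t₂ :=
    ((Measurable.aemeasurable (by fun_prop)).mul ((hum.comp_snd (α := En n)).pow_const _)).mul
      (Measurable.aemeasurable (by fun_prop))
  have ht₂s : ∫⁻ w : En n × En n, ENNReal.ofReal (t₂ w.swap) =
      ∫⁻ w, ENNReal.ofReal (t₂ w) :=
    (Measure.measurePreserving_swap (μ := (volume : Measure (En n)))
      (ν := (volume : Measure (En n)))).lintegral_comp_emb
      MeasurableEquiv.prodComm.measurableEmbedding fun w => ENNReal.ofReal (t₂ w)
  have hpt : ∀ᵐ w : En n × En n,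
      ENNReal.ofReal (nonlocalIntegrand p K u (logTest p d (fun x => a x ^ p) u) w) ≤
      ENNReal.ofReal (2 ^ p * Λ) * (ENNReal.ofReal (t₁ w) + ENNReal.ofReal (d ^ (1 - p)) *
        (ENNReal.ofReal (t₂ w) + ENNReal.ofReal (t₂ w.swap))) := by
    filter_upwards [hK] with w hw
    rw [← ENNReal.ofReal_add (ht₂ _) (ht₂ _), ← ENNReal.ofReal_mul (by positivity),
      ← ENNReal.ofReal_add (ht₁ _) (mul_nonneg (by positivity) (add_nonneg (ht₂ _) (ht₂ _))),
      ← ENNReal.ofReal_mul (by positivity)]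
    apply ENNReal.ofReal_le_ofReal
    have hsupp : ∀ x, a x = 0 ∨ 0 ≤ u x := fun x => by
      by_cases hx : x ∈ closedBall z (5 * ρ / 4)
      · exact Or.inr (hu0 x (closedBall_subset_ball (by linarith) (hz hx)))
      · exact Or.inl (ha.eq_zero x hx)
    have h1 := Jp_mul_log_test_le_tail hp hd (ha.nonneg w.1) (ha.nonneg w.2) (hsupp w.1)
      (hsupp w.2)
    have h0 : 0 ≤ 2 ^ p * (|a w.1 - a w.2| ^ p + d ^ (1 - p) *
        (a w.1 ^ p * nneg u w.2 ^ (p - 1) + a w.2 ^ p * nneg u w.1 ^ (p - 1))) := by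
      have := fun x => rpow_nonneg (ha.nonneg x) p
      have h2 : ∀ x, 0 ≤ nneg u x ^ (p - 1) := fun x => rpow_nonneg (le_max_right _ _) _
      have h3 := this w.1
      have h4 := this w.2
      have h5 := h2 w.1
      have h6 := h2 w.2
      positivity
    calc nonlocalIntegrand p K u (logTest p d (fun x => a x ^ p) u) w
        ≤ 2 ^ p * (|a w.1 - a w.2| ^ p + d ^ (1 - p) *
          (a w.1 ^ p * nneg u w.2 ^ (p - 1) + a w.2 ^ p * nneg u w.1 ^ (p - 1))) * K w.1 w.2 :=
          mul_le_mul_of_nonneg_right h1 (hK0 _ _)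
      _ ≤ 2 ^ p * (|a w.1 - a w.2| ^ p + d ^ (1 - p) *
          (a w.1 ^ p * nneg u w.2 ^ (p - 1) + a w.2 ^ p * nneg u w.1 ^ (p - 1))) *
          (Λ * ‖w.1 - w.2‖ ^ (-((n : ℝ) + p * s))) := mul_le_mul_of_nonneg_left hw h0
      _ = _ := by
          simp only [t₁, t₂, Prod.fst_swap, Prod.snd_swap]
          rw [norm_sub_rev w.2 w.1]
          ring
  have hρp : ρ ^ ((n : ℝ) - p * s) ≤ ρ ^ ((n : ℝ) - p) :=
    rpow_le_rpow_of_exponent_ge hρ (hρr.trans hr1) (by nlinarith)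
  have hI₁ : ∫⁻ w, ENNReal.ofReal (t₁ w) ≤ ENNReal.ofReal (C₁ * ρ ^ ((n : ℝ) - p)) :=
    (hcut z ρ a hρ ha).trans (ENNReal.ofReal_le_ofReal (by gcongr))
  have hI₂ : ENNReal.ofReal (d ^ (1 - p)) * ∫⁻ w, ENNReal.ofReal (t₂ w) ≤
      ENNReal.ofReal (C₂ * ρ ^ ((n : ℝ) - p)) := by
    have h1 := (lintegral_cutoff_tail_le hn hp hs0 hρ ha hu hu0 hrR hr hz).trans
      (mul_le_mul_right hT _)
    refine (mul_le_mul_right h1 _).trans ?_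
    rw [show volume (ball (0 : En n) 1) = ENNReal.ofReal V.toReal from
      (ENNReal.ofReal_toReal hV).symm, ← ENNReal.ofReal_mul (by positivity),
      ← ENNReal.ofReal_mul (by positivity), ← ENNReal.ofReal_mul (by positivity)]
    apply ENNReal.ofReal_le_ofReal
    have h2 : r ^ (-p) ≤ ρ ^ (-p) := rpow_le_rpow_of_nonpos hρ hρr (by linarith)
    have h3 : d ^ (1 - p) * d ^ (p - 1) = 1 := by
      rw [← rpow_add hd]; simp
    calc d ^ (1 - p) * (4 ^ ((n : ℝ) + p * s) * (5 * ρ / 4) ^ n * V.toReal *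
          (d ^ (p - 1) * r ^ (-p)))
        = (d ^ (1 - p) * d ^ (p - 1)) * (C₂ * ρ ^ n * r ^ (-p)) := by
          simp only [C₂]; rw [mul_div_right_comm, mul_pow]; ring
      _ ≤ C₂ * ρ ^ n * ρ ^ (-p) := by rw [h3, one_mul]; gcongr
      _ = C₂ * ρ ^ ((n : ℝ) - p) := by
          rw [sub_eq_add_neg, rpow_add hρ, rpow_natCast, mul_assoc]
  refine integral_le_of_lintegral_ofReal_le hint (by positivity)
    ((lintegral_mono_ae hpt).trans ?_)
  have ht₂sm : AEMeasurable fun w : En n × En n => ENNReal.ofReal (t₂ w.swap) :=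
    (ht₂m.comp_quasiMeasurePreserving
      Measure.measurePreserving_swap.quasiMeasurePreserving).ennreal_ofReal
  rw [lintegral_const_mul' _ _ ENNReal.ofReal_ne_top, lintegral_add_left' ht₁m.ennreal_ofReal,
    lintegral_const_mul' _ _ ENNReal.ofReal_ne_top, lintegral_add_left' ht₂m.ennreal_ofReal, ht₂s,
    mul_add (ENNReal.ofReal (d ^ (1 - p)))]
  refine (mul_le_mul_right (add_le_add hI₁ (add_le_add hI₂ hI₂)) _).trans_eq ?_
  rw [← ENNReal.ofReal_add (by positivity) (by positivity),
    ← ENNReal.ofReal_add (by positivity) (by positivity), ← ENNReal.ofReal_mul (by positivity)]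
  congr 1; ring

end NonlocalUpperBound

section LocalPart

variable {n : ℕ} {p d L C₁ C₂ : ℝ} {A : En n → En n → En n} {G : En n → En n} {u a ζ : En n → ℝ}
  {x₀ z : En n} {r ρ : ℝ}

lemma measurable_caratheodory (hAm : ∀ ξ, Measurable fun x => A x ξ) (hAc : ∀ x, Continuous (A x)) :
    Measurable (Function.uncurry A) := by
  have h := stronglyMeasurable_uncurry_of_continuous_of_stronglyMeasurable (u := fun ξ x => A x ξ)
    hAc fun ξ => (hAm ξ).stronglyMeasurable
  exact h.measurable.comp measurable_swap

lemma aemeasurable_comp_caratheodory (hAm : ∀ ξ, Measurable fun x => A x ξ)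
    (hAc : ∀ x, Continuous (A x)) {μ : Measure (En n)} (hG : AEMeasurable G μ) :
    AEMeasurable (fun x => A x (G x)) μ :=
  (measurable_caratheodory hAm hAc).comp_aemeasurable (aemeasurable_id.prodMk hG)

/-- The gradient of `logTest p d ζ u`, expressed through a weak gradient `G` of `u`. -/
def logTestGrad (p d : ℝ) (ζ u : En n → ℝ) (G : En n → En n) (x : En n) : En n :=
  (u x + d) ^ (1 - p) • gradient ζ x + (ζ x * ((1 - p) * (u x + d) ^ (-p))) • G x

lemma tendsto_gradient_logTest (hd : 0 < d) {v : ℕ → En n → ℝ} (hζ : ContDiff ℝ (⊤ : ℕ∞) ζ)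
    (hv : ∀ k, ContDiff ℝ (⊤ : ℕ∞) (v k)) (hv0 : ∀ k x, 0 ≤ v k x) {x : En n}
    (hu0 : 0 ≤ u x) (hlim : Filter.Tendsto (fun k => v k x) Filter.atTop (𝓝 (u x)))
    (hlimG : Filter.Tendsto (fun k => gradient (v k) x) Filter.atTop (𝓝 (G x))) :
    Filter.Tendsto (fun k => gradient (logTest p d ζ (v k)) x) Filter.atTop
      (𝓝 (logTestGrad p d ζ u G x)) := by
  have h : ∀ t : ℝ, Filter.Tendsto (fun k => (v k x + d) ^ t) Filter.atTop (𝓝 ((u x + d) ^ t)) :=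
    fun t => (hlim.add_const d).rpow_const (Or.inl (by positivity))
  refine Filter.Tendsto.congr (fun k => (gradient_logTest hd hζ (hv k) (hv0 k) x).symm) ?_
  exact ((h _).smul_const _).add ((((h _).const_mul _).const_mul _).smul hlimG)

theorem tendsto_integral_inner_gradient_logTest (hp : 1 < p) (hd : 0 < d)
    (hAm : ∀ ξ, Measurable fun x => A x ξ) (hAc : ∀ x, Continuous (A x)) (hC₂ : 0 ≤ C₂)
    (hA : ∀ᵐ x, x ∈ ball x₀ (7 * r / 4) → ∀ ξ, ‖A x ξ‖ ≤ C₂ * ‖ξ‖ ^ (p - 1))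
    (hr : 0 < r) (hu0 : ∀ x ∈ ball x₀ (2 * r), 0 ≤ u x)
    (hG : AEMeasurable G (volume.restrict (ball x₀ (7 * r / 4))))
    (hGp : ∫⁻ x in ball x₀ (7 * r / 4), ‖G x‖ₑ ^ p ≠ ⊤) {v : ℕ → En n → ℝ}
    (hv : ∀ k, ContDiff ℝ (⊤ : ℕ∞) (v k)) (hv0 : ∀ k x, 0 ≤ v k x)
    (hlim : ∀ᵐ x, x ∈ ball x₀ (7 * r / 4) →
      Filter.Tendsto (fun k => v k x) Filter.atTop (𝓝 (u x)))
    (hlimG : ∀ᵐ x, x ∈ ball x₀ (7 * r / 4) →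
      Filter.Tendsto (fun k => gradient (v k) x) Filter.atTop (𝓝 (G x)))
    {M : ℝ≥0∞} (hM : M ≠ ⊤) (hvM : ∀ k, ∫⁻ x in ball x₀ (7 * r / 4), ‖gradient (v k) x‖ₑ ^ p ≤ M)
    (hζ : ContDiff ℝ (⊤ : ℕ∞) ζ) (hζ0 : ∀ x, 0 ≤ ζ x) (hζ1 : ∀ x, ζ x ≤ 1)
    (hζQ : ∀ x, x ∉ closedBall x₀ (3 * r / 2) → ζ x = 0) :
    IntegrableOn (fun x => ⟪A x (G x), logTestGrad p d ζ u G x⟫) (ball x₀ (7 * r / 4)) ∧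
    Filter.Tendsto (fun k => ∫ x, ⟪A x (G x), gradient (logTest p d ζ (v k)) x⟫) Filter.atTop
      (𝓝 (∫ x in ball x₀ (7 * r / 4), ⟪A x (G x), logTestGrad p d ζ u G x⟫)) := by
  have hp1 : 0 < p - 1 := by linarith
  have hQD : closedBall x₀ (3 * r / 2) ⊆ ball x₀ (7 * r / 4) := closedBall_subset_ball (by linarith)
  have hDu : ball x₀ (7 * r / 4) ⊆ ball x₀ (2 * r) := ball_subset_ball (by linarith)
  set D := ball x₀ (7 * r / 4)
  have hDm : MeasurableSet D := measurableSet_ball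
  have hζc : HasCompactSupport ζ := HasCompactSupport.intro (isCompact_closedBall x₀ _) hζQ
  obtain ⟨M', hM', hgrad⟩ := exists_lintegral_gradient_logTest_le hp hd hζ hζc hζ0 hζ1 D
    measure_ball_lt_top.ne hM
  have hAGm : AEMeasurable (fun x => A x (G x)) (volume.restrict D) :=
    aemeasurable_comp_caratheodory hAm hAc hG
  have hAG : ∫⁻ x in D, ‖A x (G x)‖ₑ ^ (p / (p - 1)) ≠ ⊤ := by
    refine ne_top_of_le_ne_top (ENNReal.mul_ne_top (ENNReal.ofReal_ne_top
      (r := C₂ ^ (p / (p - 1)))) hGp) ?_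
    rw [← lintegral_const_mul' _ _ ENNReal.ofReal_ne_top]
    refine lintegral_mono_ae ((ae_restrict_iff' hDm).2 ?_)
    filter_upwards [hA] with x hx hxD
    rw [← ofReal_norm, ← ofReal_norm,
      ENNReal.ofReal_rpow_of_nonneg (norm_nonneg _) (by positivity),
      ENNReal.ofReal_rpow_of_nonneg (norm_nonneg _) (by positivity),
      ← ENNReal.ofReal_mul (by positivity)]
    apply ENNReal.ofReal_le_ofReal
    refine (rpow_le_rpow (norm_nonneg _) (hx hxD (G x)) (by positivity)).trans_eq ?_
    rw [mul_rpow hC₂ (by positivity), ← rpow_mul (norm_nonneg _), mul_div_cancel₀ _ hp1.ne']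
  have hgc : ∀ k, Continuous (gradient (logTest p d ζ (v k))) := fun k =>
    continuous_gradient (contDiff_logTest hd hζ (hv k) (hv0 k))
  have hlim2 : ∀ᵐ x ∂volume.restrict D, Filter.Tendsto
      (fun k => gradient (logTest p d ζ (v k)) x) Filter.atTop
      (𝓝 (logTestGrad p d ζ u G x)) := by
    refine (ae_restrict_iff' hDm).2 ?_
    filter_upwards [hlim, hlimG] with x h1 h2 hx
    exact tendsto_gradient_logTest hd hζ hv hv0 (hu0 x (hDu hx))
      (h1 hx) (h2 hx)
  have hgm : AEStronglyMeasurable (logTestGrad p d ζ u G) (volume.restrict D) :=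
    aestronglyMeasurable_of_tendsto_ae _ (fun k => (hgc k).aestronglyMeasurable) hlim2
  have hgM : ∀ k, ∫⁻ x in D, ‖gradient (logTest p d ζ (v k)) x‖ₑ ^ p ≤ M' := fun k =>
    hgrad _ (hv k) (hv0 k) (hvM k)
  have hint : ∀ g : En n → En n, AEStronglyMeasurable g (volume.restrict D) →
      ∫⁻ x in D, ‖g x‖ₑ ^ p ≤ M' → IntegrableOn (fun x => ⟪A x (G x), g x⟫) D := by
    intro g hg hgM
    refine ⟨hAGm.aestronglyMeasurable.inner hg, ?_⟩
    have h1 : ∫⁻ x in D, (‖A x (G x)‖ₑ ^ (p / (p - 1)) + ‖g x‖ₑ ^ p) < ⊤ := by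
      rw [lintegral_add_left' (hAGm.enorm.pow_const _)]
      exact ENNReal.add_lt_top.2 ⟨hAG.lt_top, hgM.trans_lt hM'.lt_top⟩
    refine (lintegral_mono fun x => ?_).trans_lt h1
    refine (?_ : _ ≤ ‖A x (G x)‖ₑ * ‖g x‖ₑ).trans (enn_mul_le_rpow_add hp _ _)
    simp only [← ofReal_norm]
    rw [← ENNReal.ofReal_mul (norm_nonneg _)]
    exact ENNReal.ofReal_le_ofReal (norm_inner_le_norm _ _)
  have hinf := hint _ hgm (lintegral_enorm_rpow_le_of_tendsto
    (fun k => (hgc k).aestronglyMeasurable) hgM hlim2)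
  refine ⟨hinf, ?_⟩
  have hset : ∀ k, ∫ x, ⟪A x (G x), gradient (logTest p d ζ (v k)) x⟫ =
      ∫ x in D, ⟪A x (G x), gradient (logTest p d ζ (v k)) x⟫ := fun k => by
    refine (setIntegral_eq_integral_of_forall_compl_eq_zero fun x hx => ?_).symm
    have hx2 : x ∉ tsupport ζ := fun h => hx (hQD
      (closure_minimal (fun y hy => by by_contra h; exact hy (hζQ y h)) isClosed_closedBall h))
    rw [gradient_logTest hd hζ (hv k) (hv0 k), image_eq_zero_of_notMem_tsupport hx2, gradient,
      fderiv_of_notMem_tsupport ℝ hx2]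
    simp
  simp_rw [hset]
  refine tendsto_integral_of_L1 _ hinf.1
    (.of_forall fun k => hint _ (hgc k).aestronglyMeasurable (hgM k)) ?_
  have h1 := tendsto_lintegral_mul_enorm_sub hp (hAGm.enorm)
    (fun k => (hgc k).aestronglyMeasurable) hgm hAG hM' hgM hlim2
  refine tendsto_of_tendsto_of_tendsto_of_le_of_le tendsto_const_nhds h1 (fun _ => bot_le)
    fun k => lintegral_mono fun x => ?_
  simp only [← inner_sub_right, ← ofReal_norm]
  rw [← ENNReal.ofReal_mul (norm_nonneg _)]
  exact ENNReal.ofReal_le_ofReal (norm_inner_le_norm _ _)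

/-- Pointwise coercivity of the local part tested with `a ^ p * (u + d) ^ (1 - p)`. -/
lemma inner_logTestGrad_le (hp : 1 < p) (hd : 0 < d) (hC₁ : 0 < C₁) (hC₂ : 0 ≤ C₂) (hL : 0 < L)
    (hρ : 0 < ρ) (ha : IsCutoff p L z ρ a) {x : En n} (hu0 : 0 ≤ u x)
    (hA : ∀ ξ, ‖A x ξ‖ ≤ C₂ * ‖ξ‖ ^ (p - 1)) (hA' : ∀ ξ, C₁ * ‖ξ‖ ^ p ≤ ⟪A x ξ, ξ⟫) :
    ⟪A x (G x), logTestGrad p d (fun x => a x ^ p) u G x⟫ ≤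
      (closedBall z (5 * ρ / 4)).indicator
        (fun _ => ((p - 1) * C₁ / 2) ^ (1 - p) * (C₂ * L / ρ) ^ p) x -
      (p - 1) * C₁ / 2 * (a x * ‖G x‖ / (u x + d)) ^ p := by
  have hp0 : 0 < p := by linarith
  have hp1 : 0 < p - 1 := by linarith
  have hU : 0 < u x + d := by linarith
  have ha0 := ha.nonneg x
  rw [logTestGrad, inner_add_right, inner_smul_right, inner_smul_right]
  set Y := a x * ‖G x‖ / (u x + d)
  have hY : 0 ≤ Y := by positivity
  have hYp : Y ^ p = a x ^ p * ((u x + d) ^ (-p) * ‖G x‖ ^ p) := by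
    simp only [Y]
    rw [div_rpow (by positivity) hU.le, mul_rpow ha0 (norm_nonneg _), rpow_neg hU.le]
    ring
  have hYp1 : Y ^ (p - 1) = (u x + d) ^ (1 - p) * (‖G x‖ ^ (p - 1) * a x ^ (p - 1)) := by
    simp only [Y]
    rw [div_rpow (by positivity) hU.le, mul_rpow ha0 (norm_nonneg _),
      show (1 - p) = -(p - 1) by ring, rpow_neg hU.le]
    ring
  have h2 : a x ^ p * ((1 - p) * (u x + d) ^ (-p)) * ⟪A x (G x), G x⟫ ≤
      -((p - 1) * C₁ * Y ^ p) := by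
    rw [hYp]
    have := mul_le_mul_of_nonneg_left (hA' (G x))
      (show 0 ≤ a x ^ p * ((p - 1) * (u x + d) ^ (-p)) by positivity)
    linarith
  have h1 : (u x + d) ^ (1 - p) * ⟪A x (G x), gradient (fun x => a x ^ p) x⟫ ≤
      Y ^ (p - 1) * (C₂ * L / ρ) := by
    have := (real_inner_le_norm (A x (G x)) (gradient (fun x => a x ^ p) x)).trans
      (mul_le_mul (hA (G x)) (ha.norm_gradient_le x) (norm_nonneg _) (by positivity))
    refine (mul_le_mul_of_nonneg_left this (by positivity)).trans_eq ?_
    rw [hYp1]; ring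
  by_cases hx : x ∈ closedBall z (5 * ρ / 4)
  · rw [indicator_of_mem hx]
    have := rpow_mul_le_young hp (δ := (p - 1) * C₁ / 2) (by positivity) hY
      (show 0 ≤ C₂ * L / ρ by positivity)
    linarith
  · rw [indicator_of_notMem hx]
    have hY0 : Y = 0 := by simp [Y, ha.eq_zero x hx]
    rw [hY0, zero_rpow hp1.ne', zero_mul] at h1
    rw [hY0, zero_rpow hp0.ne'] at h2 ⊢
    linarith

end LocalPart

section SourceTerm

variable {n : ℕ} {p q d : ℝ} {f φ : En n → ℝ} {x₀ z : En n} {r R ρ : ℝ}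

lemma lintegral_le_rpow_mul_measure {α : Type*} [MeasurableSpace α] {μ : Measure α} {m : ℝ}
    (hm : 1 < m) {g : α → ℝ≥0∞} (hg : AEMeasurable g μ) :
    ∫⁻ x, g x ∂μ ≤ (∫⁻ x, g x ^ m ∂μ) ^ (1 / m) * μ univ ^ (1 - 1 / m) := by
  have hm' : m - 1 ≠ 0 := by linarith
  have hpq : m.HolderConjugate (m / (m - 1)) := by
    rw [Real.holderConjugate_iff]
    refine ⟨hm, ?_⟩
    field_simp; ring
  have h := ENNReal.lintegral_mul_le_Lp_mul_Lq μ hpq hg (aemeasurable_const (b := (1 : ℝ≥0∞)))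
  have he : 1 / (m / (m - 1)) = 1 - 1 / m := by field_simp
  simpa [he] using h

lemma aemeasurable_of_integrable_rpow {α : Type*} [MeasurableSpace α] {μ : Measure α} {m : ℝ}
    (hm : 0 < m) {g : α → ℝ} (hg0 : ∀ x, 0 ≤ g x) (hg : Integrable (fun x => g x ^ m) μ) :
    AEMeasurable g μ := by
  refine (hg.aestronglyMeasurable.aemeasurable.pow_const (1 / m)).congr (.of_forall fun x => ?_)
  simp only
  rw [← rpow_mul (hg0 x), mul_one_div_cancel hm.ne', rpow_one]

/-- The source term tested with a function of size `d ^ (1 - p)` supported in a ball of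
radius comparable to `ρ`. -/
lemma abs_integral_mul_le (hn : 0 < n) (hp : 1 < p) (hpn : p < n) (hq : (n : ℝ) < q)
    (hf : IntegrableOn (fun x => |f x| ^ (q / p)) (ball x₀ R)) (hρ : 0 < ρ) (hρr : ρ ≤ r)
    (hrR : 2 * r < R) (hd : 0 < d)
    (hfd : r ^ ((p - n) / (p - 1)) * R ^ (n * (q - p) / (q * (p - 1))) *
      (normLp (q / p) f (ball x₀ R)) ^ (1 / (p - 1)) ≤ d)
    (hz : closedBall z (5 * ρ / 4) ⊆ ball x₀ R)
    (hφ : ∀ x, |φ x| ≤ d ^ (1 - p)) (hφ0 : ∀ x, x ∉ closedBall z (5 * ρ / 4) → φ x = 0) :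
    |∫ x, f x * φ x| ≤
      ((5 / 4) ^ n * (volume (ball (0 : En n) 1)).toReal) ^ (1 - p / q) * ρ ^ ((n : ℝ) - p) := by
  have hp0 : 0 < p := by linarith
  have hp1 : 0 < p - 1 := by linarith
  have hq0 : 0 < q := by linarith
  have hr : 0 < r := hρ.trans_le hρr
  have hR : 0 < R := by linarith
  have hm : 1 < q / p := by rw [one_lt_div hp0]; linarith
  have hm0 : 0 < q / p := by positivity
  have hpq : 0 < 1 - p / q := by
    rw [sub_pos, div_lt_one hq0]; linarith
  set V := (volume (ball (0 : En n) 1)).toReal with hV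
  set N := normLp (q / p) f (ball x₀ R)
  set Q := closedBall z (5 * ρ / 4)
  have hI0 : 0 ≤ ∫ x in ball x₀ R, |f x| ^ (q / p) := integral_nonneg fun x => by positivity
  have hN0 : 0 ≤ N := rpow_nonneg hI0 _
  have hfm : AEMeasurable (fun x => |f x|) (volume.restrict Q) :=
    aemeasurable_of_integrable_rpow hm0 (fun x => abs_nonneg _) (hf.mono_set hz)
  have hN : (∫⁻ x in Q, ENNReal.ofReal |f x| ^ (q / p)) ^ (1 / (q / p)) ≤ ENNReal.ofReal N := by
    simp only [N, normLp]
    rw [← ENNReal.ofReal_rpow_of_nonneg hI0 (by positivity)]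
    refine ENNReal.rpow_le_rpow ?_ (by positivity)
    rw [ofReal_integral_eq_lintegral_ofReal hf (.of_forall fun x => by positivity)]
    refine (lintegral_mono_set hz).trans_eq (lintegral_congr fun x => ?_)
    rw [ENNReal.ofReal_rpow_of_nonneg (abs_nonneg _) hm0.le]
  have hQ : volume Q = ENNReal.ofReal ((5 * ρ / 4) ^ n * V) := by
    rw [volume_closedBall_eq hn z (by positivity), ENNReal.ofReal_mul (by positivity), hV,
      ENNReal.ofReal_toReal measure_ball_lt_top.ne]
  have hV0 : 0 ≤ V := ENNReal.toReal_nonneg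
  have hpt : ∀ x, ‖f x * φ x‖ₑ ≤
      ENNReal.ofReal (d ^ (1 - p)) * Q.indicator (fun x => ENNReal.ofReal |f x|) x := fun x => by
    by_cases hx : x ∈ Q
    · rw [indicator_of_mem hx, ← ENNReal.ofReal_mul (by positivity), ← ofReal_norm, norm_mul,
        mul_comm]
      exact ENNReal.ofReal_le_ofReal (mul_le_mul_of_nonneg_right (hφ x) (abs_nonneg _))
    · simp [hφ0 x hx]
  have h1 : ENNReal.ofReal |∫ x, f x * φ x| ≤
      ENNReal.ofReal (d ^ (1 - p) * (N * ((5 * ρ / 4) ^ n * V) ^ (1 - p / q))) := by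
    have h2 := enorm_integral_le_lintegral_enorm (μ := volume) (fun x => f x * φ x)
    rw [← ofReal_norm, Real.norm_eq_abs] at h2
    refine h2.trans ((lintegral_mono hpt).trans ?_)
    rw [lintegral_const_mul' _ _ ENNReal.ofReal_ne_top,
      lintegral_indicator measurableSet_closedBall,
      ENNReal.ofReal_mul (by positivity), ENNReal.ofReal_mul hN0]
    refine mul_le_mul_right ((lintegral_le_rpow_mul_measure hm hfm.ennreal_ofReal).trans ?_) _
    rw [Measure.restrict_apply_univ, hQ, one_div_div,
      ENNReal.ofReal_rpow_of_nonneg (by positivity) hpq.le]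
    rw [one_div_div] at hN
    exact mul_le_mul_left hN _
  have h2 := (ENNReal.ofReal_le_ofReal_iff (by positivity)).1 h1
  refine h2.trans ?_
  have hNd : N * d ^ (1 - p) ≤ r ^ ((n : ℝ) - p) * R ^ (-(n * (1 - p / q))) := by
    have h3 := rpow_le_rpow (by positivity) hfd hp1.le
    rw [mul_rpow (by positivity) (by positivity), mul_rpow (by positivity) (by positivity),
      ← rpow_mul hr.le, ← rpow_mul hR.le, ← rpow_mul hN0, div_mul_cancel₀ _ hp1.ne',
      one_div_mul_cancel hp1.ne', rpow_one,
      show (n * (q - p) / (q * (p - 1)) * (p - 1)) = n * (1 - p / q) by field_simp] at h3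
    have h4 : d ^ (1 - p) = (d ^ (p - 1))⁻¹ := by rw [← rpow_neg hd.le]; congr 1; ring
    have h5 : r ^ ((n : ℝ) - p) = (r ^ (p - (n : ℝ)))⁻¹ := by
      rw [← rpow_neg hr.le]; congr 1; ring
    rw [h4, h5, rpow_neg hR.le, ← mul_inv, ← div_eq_mul_inv, div_le_iff₀ (by positivity),
      ← div_eq_inv_mul, le_div_iff₀ (by positivity)]
    linarith
  have hsplit : ((5 * ρ / 4) ^ n * V) ^ (1 - p / q) =
      ((5 / 4) ^ n * V) ^ (1 - p / q) * ρ ^ (n * (1 - p / q)) := by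
    rw [rpow_mul hρ.le, rpow_natCast, ← mul_rpow (by positivity) (by positivity)]
    congr 1
    rw [mul_div_right_comm, mul_pow]; ring
  have hfin : r ^ ((n : ℝ) - p) * R ^ (-(n * (1 - p / q))) * ρ ^ (n * (1 - p / q)) ≤
      ρ ^ ((n : ℝ) - p) := by
    have he : 0 ≤ p - n * p / q := by
      rw [sub_nonneg, div_le_iff₀ hq0, mul_comm (n : ℝ)]
      exact mul_le_mul_of_nonneg_left hq.le hp0.le
    have h3 : ρ ^ (n * (1 - p / q)) = ρ ^ ((n : ℝ) - p) * ρ ^ (p - n * p / q) := by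
      rw [← rpow_add hρ]; congr 1; ring
    have h4 : r ^ ((n : ℝ) - p) * r ^ (p - n * p / q) = r ^ (n * (1 - p / q)) := by
      rw [← rpow_add hr]; congr 1; ring
    have h5 : ρ ^ (p - n * p / q) ≤ r ^ (p - n * p / q) := rpow_le_rpow hρ.le hρr he
    have h6 : r ^ (n * (1 - p / q)) ≤ R ^ (n * (1 - p / q)) :=
      rpow_le_rpow hr.le (by linarith) (by positivity)
    calc r ^ ((n : ℝ) - p) * R ^ (-(n * (1 - p / q))) * ρ ^ (n * (1 - p / q))
        ≤ r ^ ((n : ℝ) - p) * R ^ (-(n * (1 - p / q))) *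
          (ρ ^ ((n : ℝ) - p) * r ^ (p - n * p / q)) := by rw [h3]; gcongr
      _ = R ^ (-(n * (1 - p / q))) * r ^ (n * (1 - p / q)) * ρ ^ ((n : ℝ) - p) := by
          rw [← h4]; ring
      _ ≤ R ^ (-(n * (1 - p / q))) * R ^ (n * (1 - p / q)) * ρ ^ ((n : ℝ) - p) := by gcongr
      _ = ρ ^ ((n : ℝ) - p) := by rw [← rpow_add hR]; simp
  rw [hsplit]
  calc d ^ (1 - p) * (N * (((5 / 4) ^ n * V) ^ (1 - p / q) * ρ ^ (n * (1 - p / q))))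
      = ((5 / 4) ^ n * V) ^ (1 - p / q) * ((N * d ^ (1 - p)) * ρ ^ (n * (1 - p / q))) := by ring
    _ ≤ ((5 / 4) ^ n * V) ^ (1 - p / q) *
        ((r ^ ((n : ℝ) - p) * R ^ (-(n * (1 - p / q)))) * ρ ^ (n * (1 - p / q))) := by gcongr
    _ ≤ _ := by gcongr

end SourceTerm

section NonmeasurableSolution

variable {n : ℕ} {p s Λ : ℝ} {K : En n → En n → ℝ} {u φ : En n → ℝ} {x₀ : En n} {r R : ℝ}

lemma Jp_neg_sub_lt {M m : ℝ} (hp : 1 < p) (hM : 0 < M) (hm : 0 ≤ m) :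
    Jp p (-M - m) < Jp p (M - m) := by
  have h1 : Jp p (-M - m) = -(M + m) ^ (p - 1) := by
    rw [show -M - m = -(M + m) by ring, Jp_neg, Jp_of_pos (by positivity)]
  have h2 : 0 < (M + m) ^ (p - 1) := by positivity
  rw [h1]
  rcases lt_trichotomy 0 (M - m) with h | h | h
  · rw [Jp_of_pos h]
    have : 0 < (M - m) ^ (p - 1) := by positivity
    linarith
  · rw [← h]; simp [Jp]; exact h2
  · rw [show M - m = -(m - M) by ring, Jp_neg, Jp_of_pos (by linarith)]
    exact neg_lt_neg (rpow_lt_rpow (by linarith) (by linarith) (by linarith))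

lemma continuous_one_add_norm_rpow (t : ℝ) : Continuous fun y : En n => (1 + ‖y‖) ^ t :=
  (continuous_const.add continuous_norm).rpow_const fun y =>
    Or.inl (show 1 + ‖y‖ ≠ 0 by positivity)

lemma MemTailSpace.locallyIntegrable (hut : MemTailSpace p s u) :
    LocallyIntegrable fun y : En n => |u y| ^ (p - 1) := by
  refine (locallyIntegrable_iff.2 fun k hk => ?_)
  refine (hut.integrableOn.continuousOn_mul
    (continuous_one_add_norm_rpow ((n : ℝ) + p * s)).continuousOn hk).congr (.of_forall fun y => ?_)
  have : 0 < 1 + ‖y‖ := by positivity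
  simp only
  rw [mul_comm, mul_assoc, ← rpow_add this]
  simp

lemma MemTailSpace.aemeasurable_abs (hp : 1 < p) (hut : MemTailSpace p s u) :
    AEMeasurable fun y => |u y| := by
  have h : AEMeasurable fun y => |u y| ^ (p - 1) := by
    refine (hut.aestronglyMeasurable.aemeasurable.mul
      (continuous_one_add_norm_rpow ((n : ℝ) + p * s)).aemeasurable).congr (.of_forall fun y => ?_)
    have : 0 < 1 + ‖y‖ := by positivity
    simp only [Pi.mul_apply]
    rw [mul_assoc, ← rpow_add this]
    simp
  refine (h.pow_const (1 / (p - 1))).congr (.of_forall fun x => ?_)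
  simp only
  rw [← rpow_mul (abs_nonneg _), mul_one_div_cancel (by linarith), rpow_one]

lemma integrable_Jp_sub_mul (hn : 0 < n) (hp : 1 < p) (hs0 : 0 < s) (hΛ : 0 ≤ Λ)
    (hKm : Measurable (Function.uncurry K)) (hK0 : ∀ x y, 0 ≤ K x y)
    (hut : MemTailSpace p s u) (hrR : 2 * r < R) (hr : 0 < r)
    (hφ : Continuous φ) {M : ℝ} (hφM : ∀ x, |φ x| ≤ M)
    (hφ0 : ∀ x, x ∉ closedBall x₀ (3 * r / 2) → φ x = 0) {x : En n} (hx : x ∉ ball x₀ R)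
    (hK : ∀ᵐ y, K x y ≤ Λ * ‖x - y‖ ^ (-((n : ℝ) + p * s))) (t : ℝ) :
    Integrable fun y => Jp p (t - |u y|) * φ y * K x y := by
  have hN : 0 < (n : ℝ) + p * s := by
    have : (0 : ℝ) < n := by exact_mod_cast hn
    positivity
  have hm := hut.aemeasurable_abs hp
  have hMn : 0 ≤ M := (abs_nonneg _).trans (hφM x)
  set Q := closedBall x₀ (3 * r / 2)
  have hQc : IsCompact Q := isCompact_closedBall _ _
  have hint : IntegrableOn (fun y => M * (Λ * (r / 2) ^ (-((n : ℝ) + p * s))) *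
      (2 ^ (p - 1) * (|t| ^ (p - 1) + |u y| ^ (p - 1)))) Q :=
    (((integrableOn_const hQc.measure_lt_top.ne).add
      (hut.locallyIntegrable.integrableOn_isCompact hQc)).const_mul _).const_mul _
  suffices h : IntegrableOn (fun y => Jp p (t - |u y|) * φ y * K x y) Q from
    (integrableOn_iff_integrable_of_support_subset fun y hy => by
      by_contra h; exact hy (by simp [hφ0 y h])).1 h
  refine hint.mono' ?_ ?_
  · refine AEMeasurable.aestronglyMeasurable (AEMeasurable.restrict ?_)
    exact (((measurable_Jp p).comp_aemeasurable (aemeasurable_const.sub hm)).mul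
      hφ.aemeasurable).mul (hKm.comp measurable_prodMk_left).aemeasurable
  · refine (ae_restrict_iff' measurableSet_closedBall).2 ?_
    filter_upwards [hK] with y hy hyQ
    have h1 : dist y x₀ ≤ 3 * r / 2 := hyQ
    have h2 : R ≤ dist x x₀ := by simpa using hx
    have h3 : r / 2 ≤ ‖x - y‖ := by
      rw [← dist_eq_norm]
      linarith [dist_triangle x y x₀]
    have h4 : ‖x - y‖ ^ (-((n : ℝ) + p * s)) ≤ (r / 2) ^ (-((n : ℝ) + p * s)) :=
      rpow_le_rpow_of_nonpos (by positivity) h3 (by linarith)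
    have h5 : |t - (|u y|)| ^ (p - 1) ≤ 2 ^ (p - 1) * (|t| ^ (p - 1) + |u y| ^ (p - 1)) := by
      refine (rpow_le_rpow (abs_nonneg _) (abs_sub _ _) (by linarith)).trans ?_
      rw [abs_abs]
      exact add_rpow_le_two_rpow (abs_nonneg _) (abs_nonneg _) (by linarith)
    rw [norm_mul, norm_mul, Real.norm_eq_abs, abs_Jp hp, Real.norm_eq_abs,
      Real.norm_of_nonneg (hK0 _ _)]
    calc |t - (|u y|)| ^ (p - 1) * |φ y| * K x y
        ≤ (2 ^ (p - 1) * (|t| ^ (p - 1) + |u y| ^ (p - 1))) * M *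
          (Λ * (r / 2) ^ (-((n : ℝ) + p * s))) := by
          refine mul_le_mul (mul_le_mul h5 (hφM y) (abs_nonneg _) (by positivity))
            (hy.trans (mul_le_mul_of_nonneg_left h4 hΛ)) (hK0 _ _) (by positivity)
      _ = _ := by ring

/-- The nonlocal form of a function that is nonnegative on `B_R` either comes from a measurable
function or vanishes (being the integral of a nonmeasurable function). -/
lemma integral_integral_eq_zero_of_not_aemeasurable (hn : 0 < n) (hp : 1 < p) (hs0 : 0 < s)
    (hΛ : 0 < Λ) (hKm : Measurable (Function.uncurry K)) (hK0 : ∀ x y, 0 ≤ K x y)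
    (hKl : ∀ᵐ z ∂(volume : Measure (En n × En n)),
      Λ⁻¹ * ‖z.1 - z.2‖ ^ (-((n : ℝ) + p * s)) ≤ K z.1 z.2)
    (hK : ∀ᵐ z ∂(volume : Measure (En n × En n)),
      K z.1 z.2 ≤ Λ * ‖z.1 - z.2‖ ^ (-((n : ℝ) + p * s)))
    (hu : ¬ AEMeasurable u) (hut : MemTailSpace p s u) (hu0 : ∀ x ∈ ball x₀ R, 0 ≤ u x)
    (hrR : 2 * r < R) (hr : 0 < r) (hφ : Continuous φ) (hφn : ∀ x, 0 ≤ φ x) {M : ℝ}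
    (hφM : ∀ x, φ x ≤ M) (hφ0 : ∀ x, x ∉ closedBall x₀ (3 * r / 2) → φ x = 0) :
    ∫ x, ∫ y, Jp p (u x - u y) * (φ x - φ y) * K x y = 0 := by
  by_cases hφz : φ = 0
  · simp [hφz]
  have hQR : closedBall x₀ (3 * r / 2) ⊆ ball x₀ R := closedBall_subset_ball (by linarith)
  have hm := hut.aemeasurable_abs hp
  refine integral_undef fun hint => hu ?_
  set H : En n → ℝ := fun x => ∫ y, Jp p (u x - u y) * (φ x - φ y) * K x y
  set Φ : En n → ℝ → ℝ := fun x t => ∫ y, Jp p (t - |u y|) * φ y * K x y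
  have hH : ∀ x, x ∉ ball x₀ R → H x = -Φ x (u x) := fun x hx => by
    simp only [H, Φ]
    rw [← integral_neg]
    refine integral_congr_ae (.of_forall fun y => ?_)
    simp only
    rw [hφ0 x fun h => hx (hQR h)]
    by_cases hy : y ∈ closedBall x₀ (3 * r / 2)
    · rw [abs_of_nonneg (hu0 y (hQR hy))]; ring
    · rw [hφ0 y hy]; ring
  have hΦm : AEStronglyMeasurable fun x => -Φ x |u x| := by
    have h1 : AEMeasurable fun z : En n × En n => |u z.1| := hm.comp_fst
    have h2 : AEMeasurable fun z : En n × En n => |u z.2| := hm.comp_snd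
    have h3 : AEStronglyMeasurable (fun z : En n × En n =>
        Jp p (|u z.1| - |u z.2|) * φ z.2 * K z.1 z.2) (volume.prod volume) :=
      ((((measurable_Jp p).comp_aemeasurable (h1.sub h2)).mul
        (hφ.comp continuous_snd).aemeasurable).mul hKm.aemeasurable).aestronglyMeasurable
    exact h3.integral_prod_right'.neg
  have hstrict : ∀ᵐ x, x ∉ ball x₀ R → u x < 0 → Φ x (u x) ≠ Φ x |u x| := by
    rw [Measure.volume_eq_prod] at hK hKl
    filter_upwards [Measure.ae_ae_of_ae_prod hK, Measure.ae_ae_of_ae_prod hKl] with x h1 h2 hx hux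
    have hM' : ∀ y, |φ y| ≤ M := fun y => by rw [abs_of_nonneg (hφn y)]; exact hφM y
    have hi := fun t => integrable_Jp_sub_mul hn hp hs0 hΛ.le hKm hK0 hut hrR hr hφ hM' hφ0 hx h1 t
    intro he
    have hsub : ∫ y, (Jp p (|u x| - |u y|) * φ y * K x y - Jp p (u x - |u y|) * φ y * K x y)
      = 0 := by
      rw [integral_sub (hi _) (hi _)]
      simp only [Φ] at he
      rw [he, sub_self]
    have hlt : ∀ y, Jp p (u x - |u y|) < Jp p (|u x| - |u y|) := fun y => by
      have := Jp_neg_sub_lt hp (abs_pos.2 hux.ne) (abs_nonneg (u y))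
      rwa [abs_of_neg hux, neg_neg, ← abs_of_neg hux] at this
    have hsub := (integral_eq_zero_iff_of_nonneg_ae (.of_forall fun y => ?_)
      ((hi |u x|).sub (hi (u x)))).1 hsub
    · have hφae : φ =ᵐ[volume] 0 := by
        filter_upwards [hsub, h2] with y hy hKy
        by_cases hyQ : y ∈ closedBall x₀ (3 * r / 2)
        · have hne : x ≠ y := fun h => hx (h ▸ hQR hyQ)
          have hKp : 0 < K x y := lt_of_lt_of_le (mul_pos (inv_pos.2 hΛ)
            (rpow_pos_of_pos (norm_pos_iff.2 (sub_ne_zero.2 hne)) _)) hKy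
          have h3 : (Jp p (|u x| - |u y|) - Jp p (u x - |u y|)) * φ y * K x y = 0 := by
            simp only [Pi.sub_apply, Pi.zero_apply] at hy
            linarith
          have h4 := sub_pos.2 (hlt y)
          simpa [h4.ne', hKp.ne'] using h3
        · exact hφ0 y hyQ
      exact hφz (hφ.ae_eq_iff_eq volume continuous_const |>.1 hφae)
    · have h4 := sub_pos.2 (hlt y)
      have h5 := hφn y
      have h6 := hK0 x y
      have : 0 ≤ (Jp p (|u x| - |u y|) - Jp p (u x - |u y|)) * φ y * K x y := by positivity
      simp only [Pi.sub_apply, Pi.zero_apply]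
      linarith
  set E : Set (En n) := {x | H x = -Φ x |u x|}ᶜ \ ball x₀ R
  have hE : NullMeasurableSet E :=
    (nullMeasurableSet_eq_fun hint.aestronglyMeasurable.aemeasurable hΦm.aemeasurable).compl.diff
      measurableSet_ball.nullMeasurableSet
  refine (hm.sub ((hm.const_mul 2).indicator₀ hE)).congr ?_
  filter_upwards [hstrict] with x hx
  simp only [Pi.sub_apply]
  by_cases hxE : x ∈ E
  · rw [indicator_of_mem hxE]
    have h1 := hH x hxE.2
    have h2 : u x < 0 := by
      by_contra h
      refine hxE.1 ?_
      rw [mem_ofPred_eq, h1, abs_of_nonneg (not_lt.1 h)]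
    rw [abs_of_neg h2]; ring
  · rw [indicator_of_notMem hxE, sub_zero]
    refine abs_of_nonneg ?_
    by_cases hxR : x ∈ ball x₀ R
    · exact hu0 x hxR
    · by_contra h
      refine hxE ⟨fun h1 => hx hxR (not_le.1 h) ?_, hxR⟩
      rw [mem_ofPred_eq, hH x hxR] at h1
      exact neg_injective h1

end NonmeasurableSolution

section WeakGradient

variable {n : ℕ} {p s : ℝ} {u : En n → ℝ} {G : En n → En n} {Ω : Set (En n)} {x₀ : En n} {r R : ℝ}

lemma integrableOn_of_integrableOn_norm_rpow {E : Type*} [NormedAddCommGroup E]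
    {μ : Measure (En n)} [IsFiniteMeasure μ] (hp : 1 < p) {g : En n → E}
    (hg : AEStronglyMeasurable g μ) (hgp : Integrable (fun x => ‖g x‖ ^ p) μ) : Integrable g μ := by
  refine ((integrable_const (1 : ℝ)).add hgp).mono' hg (.of_forall fun x => ?_)
  simp only [Pi.add_apply]
  rcases le_total ‖g x‖ 1 with h | h
  · have : 0 ≤ ‖g x‖ ^ p := by positivity
    linarith
  · have := rpow_le_rpow_of_exponent_le h hp.le
    rw [rpow_one] at this
    linarith

lemma MemW1pLoc.integrableOn (hp : 1 < p) (h : MemW1pLoc p u G Ω) (hu0 : ∀ x ∈ Ω, 0 ≤ u x)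
    {k : Set (En n)} (hk : IsCompact k) (hkΩ : k ⊆ Ω) : IntegrableOn u k := by
  have hi := (h.2 k hk hkΩ).1
  have : IsFiniteMeasure (volume.restrict k) := ⟨by simpa using hk.measure_lt_top⟩
  refine integrableOn_of_integrableOn_norm_rpow hp ?_ hi
  refine ((aemeasurable_of_integrable_rpow (by linarith) (fun x => abs_nonneg _) hi).congr
    ((ae_restrict_iff' hk.measurableSet).2 (.of_forall fun x hx => ?_))).aestronglyMeasurable
  exact abs_of_nonneg (hu0 x (hkΩ hx))

lemma MemW1pLoc.mono {Ω' : Set (En n)} (h : MemW1pLoc p u G Ω) (hΩ : Ω' ⊆ Ω) :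
    MemW1pLoc p u G Ω' :=
  ⟨fun φ hφ => h.1 φ ⟨hφ.1, hφ.2.1, hφ.2.2.trans hΩ⟩, fun k hk hkΩ => h.2 k hk (hkΩ.trans hΩ)⟩

lemma integrable_smul_gradient (hu : ∀ k : Set (En n), IsCompact k → k ⊆ Ω → IntegrableOn u k)
    {φ : En n → ℝ} (hφ : TestFun Ω φ) : Integrable fun x => u x • gradient φ x := by
  refine (integrableOn_iff_integrable_of_support_subset fun x hx => ?_).1
    ((hu _ hφ.2.1 hφ.2.2).smul_continuousOn (continuous_gradient hφ.1).continuousOn hφ.2.1)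
  by_contra h
  exact hx (by simp [gradient, fderiv_of_notMem_tsupport ℝ h])

/-- A (possibly nonmeasurable) weak gradient is measurable on smaller balls, unless zero is also
a weak gradient. -/
lemma aemeasurable_or_hasWeakGradOn_zero (hr : 0 < r) (hrR : r < R)
    (hG : HasWeakGradOn u G (ball x₀ R))
    (hu : ∀ k : Set (En n), IsCompact k → k ⊆ ball x₀ R → IntegrableOn u k) :
    AEMeasurable G (volume.restrict (ball x₀ r)) ∨ HasWeakGradOn u 0 (ball x₀ R) := by
  let b : ContDiffBump x₀ := ⟨r, (r + R) / 2, hr, by linarith⟩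
  have hb : TestFun (ball x₀ R) b := ⟨b.contDiff, b.hasCompactSupport, by
    rw [b.tsupport_eq]; exact closedBall_subset_ball (by change (r + R) / 2 < R; linarith)⟩
  by_cases hi : Integrable fun x => b x • G x
  · refine Or.inl ((hi.aestronglyMeasurable.aemeasurable.restrict).congr
      ((ae_restrict_iff' measurableSet_ball).2 (.of_forall fun x hx => ?_)))
    simp only
    rw [b.one_of_mem_closedBall (ball_subset_closedBall hx), one_smul]
  · refine Or.inr fun φ hφ => ?_
    simp only [Pi.zero_apply, smul_zero, integral_zero, neg_zero]
    have h0 : ∫ x, u x • gradient b x = 0 := by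
      rw [hG b hb, integral_undef hi, neg_zero]
    by_cases hφi : Integrable fun x => φ x • G x
    · have hφb : TestFun (ball x₀ R) fun x => φ x + b x := ⟨hφ.1.add hb.1, hφ.2.1.add hb.2.1,
        (tsupport_add φ b).trans (union_subset hφ.2.2 hb.2.2)⟩
      have hg : ∀ x, gradient (fun x => φ x + b x) x = gradient φ x + gradient b x := fun x => by
        rw [gradient, fderiv_fun_add (hφ.1.differentiable (by simp) x)
          (hb.1.differentiable (by simp) x), map_add]; rfl
      have hn : ¬ Integrable fun x => (φ x + b x) • G x := fun h2 =>
        hi ((h2.sub hφi).congr (.of_forall fun x => by simp [add_smul]))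
      have h1 := hG _ hφb
      rw [integral_undef hn, neg_zero] at h1
      simp_rw [hg, smul_add] at h1
      rwa [integral_add (integrable_smul_gradient hu hφ) (integrable_smul_gradient hu hb), h0,
        add_zero] at h1
    · rw [hG φ hφ, integral_undef hφi, neg_zero]

end WeakGradient

section LogEstimate

variable {n : ℕ} {p s q C₁ C₂ Λ : ℝ}

/-- The nonlocal form tested with `logTest p d ζ (v k)` is eventually dominated by a scale
invariant constant, whether or not `u` is measurable. -/
lemma exists_limit_nonlocal_le (hn : 0 < n) (hp : 1 < p) (hs0 : 0 < s) (hs1 : s < 1) {L : ℝ}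
    (hL : 0 < L) (hΛ : 1 ≤ Λ) :
    ∃ C : ℝ, 0 ≤ C ∧ ∀ (S : Setting n p s C₁ C₂ Λ) (u a : En n → ℝ) (v : ℕ → En n → ℝ)
      (x₀ z : En n) (r R ρ d : ℝ) (M : ℝ≥0∞),
      MemTailSpace p s u → (∀ x ∈ ball x₀ R, 0 ≤ u x) → 0 < ρ → ρ ≤ r → r ≤ 1 → 2 * r < R → 0 < d →
      IsCutoff p L z ρ a → closedBall z (5 * ρ / 4) ⊆ closedBall x₀ (3 * r / 2) →
      (AEMeasurable u → ∫⁻ y in (ball x₀ R)ᶜ, ENNReal.ofReal (nneg u y ^ (p - 1) *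
          ‖y - x₀‖ ^ (-((n : ℝ) + p * s))) ≤ ENNReal.ofReal (d ^ (p - 1) * r ^ (-p))) →
      (∀ k, ContDiff ℝ (⊤ : ℕ∞) (v k)) → (∀ k x, 0 ≤ v k x) →
      (∀ᵐ x, x ∈ ball x₀ (7 * r / 4) →
        Filter.Tendsto (fun k => v k x) Filter.atTop (𝓝 (u x))) →
      M ≠ ⊤ → (∀ k, ∫⁻ x in ball x₀ (7 * r / 4), ‖gradient (v k) x‖ₑ ^ p ≤ M) →
      ∃ N ≤ C * ρ ^ ((n : ℝ) - p), Filter.Tendsto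
        (fun k => ∫ x, ∫ y, Jp p (u x - u y) * (logTest p d (fun x => a x ^ p) (v k) x -
          logTest p d (fun x => a x ^ p) (v k) y) * S.K x y) Filter.atTop (𝓝 N) := by
  obtain ⟨C, hC0, hC⟩ := exists_integral_nonlocalIntegrand_logTest_le hn hp hs0 hs1 hL
    (zero_le_one.trans hΛ)
  refine ⟨C, hC0, fun S u a v x₀ z r R ρ d M hut hu0 hρ hρr hr1 hrR hd ha hz hT hv hv0 hlim
    hM hvM =>
    ?_⟩
  have hp0 : 0 < p := by linarith
  have hr : 0 < r := hρ.trans_le hρr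
  have hζ0 : ∀ x, 0 ≤ a x ^ p := fun x => rpow_nonneg (ha.nonneg x) p
  have hζ1 : ∀ x, a x ^ p ≤ 1 := fun x => rpow_le_one (ha.nonneg x) (ha.le_one x) hp0.le
  have hζQ : ∀ x, x ∉ closedBall x₀ (3 * r / 2) → a x ^ p = 0 := fun x hx => by
    rw [ha.eq_zero x fun h => hx (hz h), zero_rpow hp0.ne']
  by_cases hu : AEMeasurable u
  · obtain ⟨hi, hi', ht⟩ := tendsto_integral_nonlocalIntegrand_logTest hn hp hs0 hs1
      (zero_le_one.trans hΛ) S.hKmeas S.hKnonneg S.hKupper hu hut hr hd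
      (fun x hx => hu0 x (ball_subset_ball hrR.le hx)) hv hv0 hlim hM hvM ha.smooth hζ0 hζ1 hζQ
    refine ⟨_, hC S.K u a x₀ z r R ρ d S.hKnonneg S.hKupper hu hu0 hρ hρr hr1 hrR hd ha hz (hT hu)
      hi', ht.congr fun k => ?_⟩
    have := hi k
    rw [Measure.volume_eq_prod] at this ⊢
    exact integral_prod _ this
  · refine ⟨0, by positivity, tendsto_const_nhds.congr fun k => ?_⟩
    refine (integral_integral_eq_zero_of_not_aemeasurable hn hp hs0 (zero_lt_one.trans_le hΛ)
      S.hKmeas S.hKnonneg S.hKlower S.hKupper hu hut hu0 hrR hr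
      (contDiff_logTest hd ha.smooth (hv k) (hv0 k)).continuous
      (fun x => logTest_nonneg hd hζ0 (hv0 k x)) (M := d ^ (1 - p)) (fun x => ?_)
        fun x hx => ?_).symm
    · refine (logTest_le hp hd (hζ0 x) (hv0 k x)).trans ?_
      exact mul_le_of_le_one_left (by positivity) (hζ1 x)
    · rw [logTest, hζQ x hx, zero_mul]

/-- Logarithmic energy estimate: the gradient of `log (u + d)` lies in the Morrey space
`L^{p, n - p}`. -/
theorem exists_lintegral_log_gradient_le (hn : 0 < n) (hp : 1 < p) (hpn : p < n) (hq : (n : ℝ) < q)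
    (hs0 : 0 < s) (hs1 : s < 1) (hC₁ : 0 < C₁) (hC₂ : 0 < C₂) (hΛ : 1 ≤ Λ) :
    ∃ C : ℝ, 0 ≤ C ∧ ∀ (S : Setting n p s C₁ C₂ Λ) (u f : En n → ℝ) (G : En n → En n)
      (x₀ z : En n) (r R ρ d : ℝ),
      0 < ρ → ρ ≤ r → r ≤ 1 → 2 * r < R → 0 < d → ball x₀ R ⊆ S.Ω →
      IntegrableOn (fun x => |f x| ^ (q / p)) (ball x₀ R) → IsSupersol S f u G →
      (∀ x ∈ ball x₀ R, 0 ≤ u x) → AEMeasurable G (volume.restrict (ball x₀ (2 * r))) →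
      r ^ ((p - n) / (p - 1)) * R ^ (n * (q - p) / (q * (p - 1))) *
        (normLp (q / p) f (ball x₀ R)) ^ (1 / (p - 1)) ≤ d →
      (AEMeasurable u → ∫⁻ y in (ball x₀ R)ᶜ, ENNReal.ofReal (nneg u y ^ (p - 1) *
          ‖y - x₀‖ ^ (-((n : ℝ) + p * s))) ≤ ENNReal.ofReal (d ^ (p - 1) * r ^ (-p))) →
      closedBall z (5 * ρ / 4) ⊆ closedBall x₀ (3 * r / 2) →
      ∫⁻ x in ball z ρ, ENNReal.ofReal ((‖G x‖ / (u x + d)) ^ p) ≤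
        ENNReal.ofReal (C * ρ ^ ((n : ℝ) - p)) := by
  obtain ⟨L, hL, hcut⟩ := exists_isCutoff n hp
  obtain ⟨CN, hCN0, hCN⟩ := exists_limit_nonlocal_le (C₁ := C₁) (C₂ := C₂) hn hp hs0 hs1 hL hΛ
  have hp0 : 0 < p := by linarith
  have hp1 : 0 < p - 1 := by linarith
  set V := (volume (ball (0 : En n) 1)).toReal with hV
  have hV0 : 0 ≤ V := ENNReal.toReal_nonneg
  set CF := ((5 / 4) ^ n * V) ^ (1 - p / q)
  have hCF0 : 0 ≤ CF := by positivity
  set δ := (p - 1) * C₁ / 2 with hδ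
  have hδ0 : 0 < δ := by positivity
  set CA := δ ^ (1 - p) * (C₂ * L) ^ p * ((5 / 4) ^ n * V)
  have hCA0 : 0 ≤ CA := by positivity
  refine ⟨(CA + CN + CF) / δ, by positivity, fun S u f G x₀ z r R ρ d hρ hρr hr1 hrR hd hΩ hf hS hu0
    hGm hfd hT hz => ?_⟩
  have hr : 0 < r := hρ.trans_le hρr
  obtain ⟨hW, hut, hsup⟩ := hS
  have hW' := hW.mono hΩ
  have h2R : ball x₀ (2 * r) ⊆ ball x₀ R := ball_subset_ball hrR.le
  have hk2 : closedBall x₀ (2 * r) ⊆ ball x₀ R := closedBall_subset_ball hrR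
  have hcB : IsCompact (closedBall x₀ (2 * r)) := isCompact_closedBall _ _
  have huI : IntegrableOn u (ball x₀ (2 * r)) :=
    (hW'.integrableOn hp hu0 hcB hk2).mono_set ball_subset_closedBall
  have hGpI : IntegrableOn (fun x => ‖G x‖ ^ p) (ball x₀ (2 * r)) :=
    ((hW'.2 _ hcB hk2).2).mono_set ball_subset_closedBall
  have hfinB : IsFiniteMeasure (volume.restrict (ball x₀ (2 * r))) :=
    ⟨by simpa using measure_ball_lt_top⟩
  have hGI : IntegrableOn G (ball x₀ (2 * r)) :=
    integrableOn_of_integrableOn_norm_rpow hp hGm.aestronglyMeasurable hGpI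
  have hu02 : ∀ x ∈ ball x₀ (2 * r), 0 ≤ u x := fun x hx => hu0 x (h2R hx)
  obtain ⟨v, hv, hv0, hlim, hlimG, hvM⟩ := exists_smooth_approx (p := p) hp hr
    (hW'.mono h2R).1 huI hGI hu02
  have hM : ∫⁻ x in ball x₀ (2 * r), ‖G x‖ₑ ^ p ≠ ⊤ := by
    have h := hGpI.lintegral_lt_top
    refine ne_of_lt (lt_of_eq_of_lt (lintegral_congr fun x => ?_) h)
    rw [← ofReal_norm, ENNReal.ofReal_rpow_of_nonneg (norm_nonneg _) hp0.le]
  obtain ⟨a, ha⟩ := hcut z ρ hρ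
  obtain ⟨N, hN, hNt⟩ := hCN S u a v x₀ z r R ρ d _ hut hu0 hρ hρr hr1 hrR hd ha hz hT hv hv0 hlim
    hM hvM
  have hζ0 : ∀ x, 0 ≤ a x ^ p := fun x => rpow_nonneg (ha.nonneg x) p
  have hζ1 : ∀ x, a x ^ p ≤ 1 := fun x => rpow_le_one (ha.nonneg x) (ha.le_one x) hp0.le
  have hζz : ∀ x, x ∉ closedBall z (5 * ρ / 4) → a x ^ p = 0 := fun x hx => by
    rw [ha.eq_zero x hx, zero_rpow hp0.ne']
  have hQD : closedBall x₀ (3 * r / 2) ⊆ ball x₀ (7 * r / 4) := closedBall_subset_ball (by linarith)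
  have hD2 : ball x₀ (7 * r / 4) ⊆ ball x₀ (2 * r) := ball_subset_ball (by linarith)
  have hQR : closedBall z (5 * ρ / 4) ⊆ ball x₀ R := (hz.trans hQD).trans (hD2.trans h2R)
  set D := ball x₀ (7 * r / 4)
  have hDm : MeasurableSet D := measurableSet_ball
  obtain ⟨hIi, hIt⟩ := tendsto_integral_inner_gradient_logTest hp hd S.hAmeas S.hAcont hC₂.le
    (S.hAgrowth.mono fun x hx hxD => hx (hΩ (h2R (hD2 hxD)))) hr hu02
    (hGm.mono_measure (Measure.restrict_mono_set _ hD2))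
    (ne_top_of_le_ne_top hM (lintegral_mono_set hD2)) hv hv0 hlim hlimG hM hvM ha.smooth hζ0 hζ1
    (fun x hx => hζz x fun h => hx (hz h))
  have htest : ∀ k, TestFun S.Ω (logTest p d (fun x => a x ^ p) (v k)) := fun k => by
    have h0 : ∀ x, x ∉ closedBall z (5 * ρ / 4) → logTest p d (fun x => a x ^ p) (v k) x = 0 :=
      fun x hx => by rw [logTest, hζz x hx, zero_mul]
    refine ⟨contDiff_logTest hd ha.smooth (hv k) (hv0 k),
      HasCompactSupport.intro (isCompact_closedBall _ _) h0, ?_⟩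
    refine (closure_minimal (fun y hy => ?_) isClosed_closedBall).trans (hQR.trans hΩ)
    by_contra h
    exact hy (h0 y h)
  have hlow : -(CF * ρ ^ ((n : ℝ) - p)) ≤
      (∫ x in D, ⟪S.A x (G x), logTestGrad p d (fun x => a x ^ p) u G x⟫) + N := by
    refine ge_of_tendsto (hIt.add hNt) (.of_forall fun k => ?_)
    refine le_trans ?_ (hsup _ (htest k) fun x => logTest_nonneg hd hζ0 (hv0 k x))
    refine (abs_le.1 (abs_integral_mul_le hn hp hpn hq hf hρ hρr hrR hd hfd hQR (fun x => ?_)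
      fun x hx => ?_)).1
    · rw [abs_of_nonneg (logTest_nonneg hd hζ0 (hv0 k x))]
      exact (logTest_le hp hd (hζ0 x) (hv0 k x)).trans
        (mul_le_of_le_one_left (by positivity) (hζ1 x))
    · rw [logTest, hζz x hx, zero_mul]
  set Y : En n → ℝ := fun x => (a x * ‖G x‖ / (u x + d)) ^ p
  have hYI : IntegrableOn Y D := by
    refine ((hGpI.mono_set hD2).const_mul (d ^ (-p))).mono' ?_
      ((ae_restrict_iff' hDm).2 (.of_forall fun x hx => ?_))
    · have h1 := ((ha.continuous hL hρ).aemeasurable (μ := volume.restrict D)).mul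
        (hGm.mono_measure (Measure.restrict_mono_set _ hD2)).norm
      exact ((h1.div ((huI.mono_set hD2).aemeasurable.add_const d)).pow_const p
        ).aestronglyMeasurable
    · have hU : d ≤ u x + d := by linarith [hu02 x (hD2 hx)]
      have h0 := ha.nonneg x
      have hUd : 0 < u x + d := hd.trans_le hU
      rw [Real.norm_of_nonneg (by positivity)]
      simp only [Y]
      rw [rpow_neg hd.le, ← div_eq_inv_mul, ← div_rpow (norm_nonneg _) hd.le]
      refine rpow_le_rpow (by positivity) ?_ hp0.le
      exact div_le_div₀ (norm_nonneg _) (mul_le_of_le_one_left (norm_nonneg _) (ha.le_one x)) hd hU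
  set c := δ ^ (1 - p) * (C₂ * L / ρ) ^ p
  have hc0 : 0 ≤ c := by positivity
  have hindI : Integrable ((closedBall z (5 * ρ / 4)).indicator fun _ => c) :=
    (integrable_indicator_iff measurableSet_closedBall).2
      (integrableOn_const (measure_closedBall_lt_top.ne))
  have hQvol : (volume (closedBall z (5 * ρ / 4))).toReal = (5 * ρ / 4) ^ n * V := by
    rw [volume_closedBall_eq hn z (by positivity), ENNReal.toReal_mul,
      ENNReal.toReal_ofReal (by positivity)]
  have hcA : c * ((5 * ρ / 4) ^ n * V) = CA * ρ ^ ((n : ℝ) - p) := by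
    simp only [c, CA]
    rw [div_rpow (by positivity) hρ.le, rpow_sub hρ, rpow_natCast, mul_div_right_comm 5 ρ,
      mul_pow]
    ring
  have hup : ∫ x in D, ⟪S.A x (G x), logTestGrad p d (fun x => a x ^ p) u G x⟫ ≤
      CA * ρ ^ ((n : ℝ) - p) - δ * ∫ x in D, Y x := by
    have h1 : ∫ x in D, ⟪S.A x (G x), logTestGrad p d (fun x => a x ^ p) u G x⟫ ≤
        ∫ x in D, ((closedBall z (5 * ρ / 4)).indicator (fun _ => c) x - δ * Y x) := by
      refine integral_mono_ae hIi (hindI.integrableOn.sub (hYI.const_mul δ))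
        ((ae_restrict_iff' hDm).2 ?_)
      filter_upwards [S.hAgrowth, S.hAcoerc] with x hx1 hx2 hxD
      have hxΩ := hΩ (h2R (hD2 hxD))
      exact inner_logTestGrad_le hp hd hC₁ hC₂.le hL hρ ha (hu02 x (hD2 hxD)) (hx1 hxΩ) (hx2 hxΩ)
    refine h1.trans ?_
    rw [integral_sub hindI.integrableOn (hYI.const_mul δ), integral_const_mul, ← hcA]
    refine sub_le_sub_right ?_ _
    refine (setIntegral_le_integral hindI
      (.of_forall fun x => indicator_nonneg (fun _ _ => hc0) x)).trans_eq ?_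
    rw [integral_indicator measurableSet_closedBall, setIntegral_const, smul_eq_mul, Measure.real,
      hQvol, mul_comm]
  have hmain : ∫ x in D, Y x ≤ (CA + CN + CF) / δ * ρ ^ ((n : ℝ) - p) := by
    rw [div_mul_eq_mul_div, le_div_iff₀ hδ0]
    linarith
  have hzD : ball z ρ ⊆ D := by
    refine Subset.trans ?_ (hz.trans hQD)
    exact ball_subset_closedBall.trans (closedBall_subset_closedBall (by linarith))
  calc ∫⁻ x in ball z ρ, ENNReal.ofReal ((‖G x‖ / (u x + d)) ^ p)
      = ∫⁻ x in ball z ρ, ENNReal.ofReal (Y x) := by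
        refine setLIntegral_congr_fun measurableSet_ball fun x hx => ?_
        simp only [Y]
        rw [ha.eq_one x (ball_subset_closedBall hx), one_mul]
    _ ≤ ∫⁻ x in D, ENNReal.ofReal (Y x) := lintegral_mono_set hzD
    _ = ENNReal.ofReal (∫ x in D, Y x) := by
        refine (ofReal_integral_eq_lintegral_ofReal hYI
          ((ae_restrict_iff' hDm).2 (.of_forall fun x hx => ?_))).symm
        have h0 := ha.nonneg x
        have := hu02 x (hD2 hx)
        simp only [Pi.zero_apply, Y]
        positivity
    _ ≤ _ := ENNReal.ofReal_le_ofReal hmain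

end LogEstimate

section LogOscillation

variable {n : ℕ} {p C d : ℝ} {u : En n → ℝ} {G : En n → En n} {x₀ z : En n} {r ρ : ℝ}

lemma lintegral_ball_le_of_rpow_le (hn : 0 < n) (hp : 1 < p) (hC : 0 ≤ C) (hρ : 0 < ρ)
    {g : En n → ℝ} (hg0 : ∀ x ∈ ball z ρ, 0 ≤ g x)
    (hg : AEMeasurable g (volume.restrict (ball z ρ)))
    (h : ∫⁻ x in ball z ρ, ENNReal.ofReal (g x ^ p) ≤ ENNReal.ofReal (C * ρ ^ ((n : ℝ) - p))) :
    ∫⁻ x in ball z ρ, ENNReal.ofReal (g x) ≤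
      ENNReal.ofReal (C ^ (1 / p) * (volume (ball (0 : En n) 1)).toReal ^ (1 - 1 / p) *
        ρ ^ ((n : ℝ) - 1)) := by
  have hp0 : 0 < p := by linarith
  set V := (volume (ball (0 : En n) 1)).toReal
  have hvol : volume (ball z ρ) = ENNReal.ofReal (ρ ^ n * V) := by
    have : Nonempty (Fin n) := ⟨⟨0, hn⟩⟩
    rw [Measure.addHaar_ball _ _ hρ.le, finrank_euclideanSpace_fin,
      ENNReal.ofReal_mul (by positivity), ENNReal.ofReal_toReal (measure_ball_lt_top.ne)]
  have hp1 : 0 ≤ 1 - 1 / p := by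
    rw [sub_nonneg, div_le_one hp0]
    exact hp.le
  have hpow : ∫⁻ x in ball z ρ, ENNReal.ofReal (g x) ^ p =
      ∫⁻ x in ball z ρ, ENNReal.ofReal (g x ^ p) :=
    setLIntegral_congr_fun measurableSet_ball fun x hx =>
      ENNReal.ofReal_rpow_of_nonneg (hg0 x hx) hp0.le
  calc ∫⁻ x in ball z ρ, ENNReal.ofReal (g x)
      ≤ (∫⁻ x in ball z ρ, ENNReal.ofReal (g x) ^ p) ^ (1 / p) *
          volume.restrict (ball z ρ) univ ^ (1 - 1 / p) :=
        lintegral_le_rpow_mul_measure hp hg.ennreal_ofReal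
    _ ≤ ENNReal.ofReal (C * ρ ^ ((n : ℝ) - p)) ^ (1 / p) *
          ENNReal.ofReal (ρ ^ n * V) ^ (1 - 1 / p) := by
        rw [hpow, Measure.restrict_apply_univ, hvol]
        gcongr
    _ = _ := by
        rw [ENNReal.ofReal_rpow_of_nonneg (by positivity) (by positivity),
          ENNReal.ofReal_rpow_of_nonneg (by positivity) hp1, ← ENNReal.ofReal_mul (by positivity),
          mul_rpow hC (by positivity), mul_rpow (by positivity) (by positivity), ← rpow_natCast ρ n,
          ← rpow_mul hρ.le, ← rpow_mul hρ.le, show (n : ℝ) - 1 = (n - p) * (1 / p) +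
            n * (1 - 1 / p) by field_simp; ring, rpow_add hρ]
        congr 1
        ring

/-- The exponential integrability of `log (u + d)` obtained from its Morrey-type energy bound. -/
lemma exists_lintegral_exp_log_le (hn : 0 < n) (hp : 1 < p) (hC : 0 ≤ C) :
    ∃ a : ℝ, 0 < a ∧ ∀ (u : En n → ℝ) (G : En n → En n) (x₀ : En n) (r d : ℝ), 0 < r → 0 < d →
      HasWeakGradOn u G (ball x₀ (2 * r)) → IntegrableOn u (ball x₀ (2 * r)) →
      IntegrableOn G (ball x₀ (2 * r)) → ∫⁻ x in ball x₀ (2 * r), ‖G x‖ₑ ^ p ≠ ⊤ →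
      (∀ x ∈ ball x₀ (2 * r), 0 ≤ u x) →
      (∀ (z : En n) (ρ : ℝ), 0 < ρ → ρ ≤ r → closedBall z (5 * ρ / 4) ⊆ closedBall x₀ (3 * r / 2) →
        ∫⁻ x in ball z ρ, ENNReal.ofReal ((‖G x‖ / (u x + d)) ^ p) ≤
          ENNReal.ofReal (C * ρ ^ ((n : ℝ) - p))) →
      (∫⁻ x in ball x₀ r, ENNReal.ofReal (exp (Real.log (u x + d) / (2 * a)))) *
          (∫⁻ x in ball x₀ r, ENNReal.ofReal (exp (-(Real.log (u x + d) / (2 * a))))) ≤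
        (expConst n * volume (ball x₀ r)) * (expConst n * volume (ball x₀ r)) := by
  have hp0 : 0 < p := by linarith
  have : Nonempty (Fin n) := ⟨⟨0, hn⟩⟩
  have hn1 : (0 : ℝ) ≤ (n : ℝ) - 1 := by
    rw [sub_nonneg]
    exact_mod_cast hn
  set V := (volume (ball (0 : En n) 1)).toReal
  have hV : 0 < V := ENNReal.toReal_pos (measure_ball_pos volume _ one_pos).ne'
    measure_ball_lt_top.ne
  set C' := C ^ (1 / p) * V ^ (1 - 1 / p)
  have hC' : 0 ≤ C' := by positivity
  set a := 2 * C' * 10 ^ ((n : ℝ) - 1) / V + 1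
  have ha : 0 < a := by positivity
  have hstep : ∀ {r t ρ : ℝ}, 0 < r → 0 < t → 0 ≤ ρ → ρ ≤ 10 * r * t →
      2 * r * (C' * ρ ^ ((n : ℝ) - 1)) ≤ a * t ^ ((n : ℝ) - 1) * (r ^ n * V) := by
    intro r t ρ hr ht hρ h
    calc 2 * r * (C' * ρ ^ ((n : ℝ) - 1)) ≤ 2 * r * (C' * (10 * r * t) ^ ((n : ℝ) - 1)) := by
          gcongr
      _ = (2 * C' * 10 ^ ((n : ℝ) - 1) / V) * t ^ ((n : ℝ) - 1) * (r ^ n * V) := by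
          rw [mul_rpow (by positivity) ht.le, mul_rpow (by positivity) hr.le, rpow_sub hr,
            rpow_natCast, rpow_one]
          field_simp
      _ ≤ _ := by
          gcongr
          exact le_add_of_nonneg_right zero_le_one
  refine ⟨a, ha, fun u G x₀ r d hr hd huG hu hG hGp hu0 hen => ?_⟩
  obtain ⟨v, hv, hv0, hvl, hgl, hvM⟩ := exists_smooth_approx (p := p) hp hr huG hu hG hu0
  have hB2 : ball x₀ r ⊆ ball x₀ (2 * r) := ball_subset_ball (by linarith)
  have hB7 : ball x₀ r ⊆ ball x₀ (7 * r / 4) := ball_subset_ball (by linarith)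
  have h32 : closedBall x₀ (3 * r / 2) ⊆ ball x₀ (2 * r) := closedBall_subset_ball (by linarith)
  have hF : AEStronglyMeasurable (fun x => (u x + d)⁻¹ • G x) (volume.restrict (ball x₀ r)) :=
    ((hu.mono_set hB2).aemeasurable.add_const d).inv.aestronglyMeasurable.smul
      (hG.mono_set hB2).aestronglyMeasurable
  have hHF : ∀ᵐ x ∂volume.restrict (ball x₀ r), hF.mk _ x = (u x + d)⁻¹ • G x := hF.ae_eq_mk.symm
  have hWg : ∀ k x, gradient (fun x => Real.log (v k x + d)) x = (v k x + d)⁻¹ • gradient (v k) x :=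
    fun k x => gradient_log_add hd (hv k) (hv0 k) x
  have hWc : ∀ k, ContDiff ℝ (⊤ : ℕ∞) fun x => Real.log (v k x + d) := fun k =>
    ((hv k).add contDiff_const).log fun x => by have := hv0 k x; positivity
  refine lintegral_exp_mul_lintegral_exp_neg_le hr hWc ?_ hF.stronglyMeasurable_mk.measurable
    ?_ ha ?_
  · rw [ae_restrict_iff' measurableSet_ball]
    filter_upwards [hvl] with x hx hxB
    have := hu0 x (hB2 hxB)
    exact ((hx (hB7 hxB)).add_const d).log (by positivity)
  · have hfin : ∫⁻ _ in ball x₀ r, (1 : ℝ≥0∞) ^ (p / (p - 1)) ≠ ⊤ := by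
      simpa using measure_ball_lt_top.ne
    have h := tendsto_lintegral_mul_enorm_sub hp (μ := volume.restrict (ball x₀ r))
      (h := fun _ => 1) (F := fun k => gradient fun x => Real.log (v k x + d))
      (f := hF.mk _) aemeasurable_const
      (fun k => (continuous_gradient (hWc k)).aestronglyMeasurable)
      hF.stronglyMeasurable_mk.aestronglyMeasurable hfin
      (M := ENNReal.ofReal d⁻¹ ^ p * ∫⁻ x in ball x₀ (2 * r), ‖G x‖ₑ ^ p)
      (ENNReal.mul_ne_top (ENNReal.rpow_ne_top_of_nonneg hp0.le ENNReal.ofReal_ne_top) hGp) ?_ ?_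
    · simpa using h
    · intro k
      calc ∫⁻ x in ball x₀ r, ‖gradient (fun x => Real.log (v k x + d)) x‖ₑ ^ p
          ≤ ∫⁻ x in ball x₀ r, ENNReal.ofReal d⁻¹ ^ p * ‖gradient (v k) x‖ₑ ^ p := by
            refine lintegral_mono fun x => ?_
            have hvk := hv0 k x
            rw [hWg, enorm_smul, ENNReal.mul_rpow_of_nonneg _ _ hp0.le,
              Real.enorm_of_nonneg (by positivity)]
            gcongr
            linarith
        _ = ENNReal.ofReal d⁻¹ ^ p * ∫⁻ x in ball x₀ r, ‖gradient (v k) x‖ₑ ^ p :=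
            lintegral_const_mul' _ _
              (ENNReal.rpow_ne_top_of_nonneg hp0.le ENNReal.ofReal_ne_top)
        _ ≤ _ := mul_le_mul_right ((lintegral_mono_set hB7).trans (hvM k)) _
    · filter_upwards [hHF, ae_restrict_of_ae hvl, ae_restrict_of_ae hgl,
        ae_restrict_mem measurableSet_ball] with x hx1 hx2 hx3 hxB
      have := hu0 x (hB2 hxB)
      simp only [hWg]
      rw [hx1]
      exact (((hx2 (hB7 hxB)).add_const d).inv₀ (by positivity)).smul (hx3 (hB7 hxB))
  · have hball : ∀ (z : En n) (ρ : ℝ), 0 < ρ → ρ ≤ r →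
        closedBall z (5 * ρ / 4) ⊆ closedBall x₀ (3 * r / 2) → ∀ s, s ⊆ ball x₀ r →
        MeasurableSet s → s ⊆ ball z ρ → ∫⁻ y in s, ‖hF.mk _ y‖ₑ ≤
          ENNReal.ofReal (C' * ρ ^ ((n : ℝ) - 1)) := by
      intro z ρ hρ hρr hz s hs hsm hsz
      have hz2 : ball z ρ ⊆ ball x₀ (2 * r) := by
        refine Subset.trans ?_ (hz.trans h32)
        exact ball_subset_closedBall.trans (closedBall_subset_closedBall (by linarith))
      have hpos : ∀ x ∈ ball z ρ, 0 < u x + d := fun x hx => by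
        have := hu0 x (hz2 hx)
        positivity
      calc ∫⁻ y in s, ‖hF.mk _ y‖ₑ = ∫⁻ y in s, ENNReal.ofReal (‖G y‖ / (u y + d)) := by
            refine lintegral_congr_ae ?_
            filter_upwards [ae_restrict_of_ae_restrict_of_subset hs hHF,
              ae_restrict_mem hsm] with y hy hys
            rw [hy, ← ofReal_norm, norm_smul, norm_inv,
              Real.norm_of_nonneg (hpos y (hsz hys)).le, inv_mul_eq_div]
        _ ≤ ∫⁻ y in ball z ρ, ENNReal.ofReal (‖G y‖ / (u y + d)) := lintegral_mono_set hsz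
        _ ≤ _ := lintegral_ball_le_of_rpow_le hn hp hC hρ
            (fun x hx => div_nonneg (norm_nonneg _) (hpos x hx).le)
            ((hG.mono_set hz2).aestronglyMeasurable.norm.aemeasurable.div
              ((hu.mono_set hz2).aemeasurable.add_const d)) (hen z ρ hρ hρr hz)
    intro x hx t ht
    have hvol : volume (ball x₀ r) = ENNReal.ofReal (r ^ n * V) := by
      rw [Measure.addHaar_ball _ _ hr.le, finrank_euclideanSpace_fin,
        ENNReal.ofReal_mul (by positivity), ENNReal.ofReal_toReal (measure_ball_lt_top.ne)]
    have ht0 : 0 < t := ht.1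
    obtain ⟨ρ, z, hρ, hρr, hz, hsz, hρt⟩ : ∃ (ρ : ℝ) (z : En n), 0 < ρ ∧ ρ ≤ r ∧
        closedBall z (5 * ρ / 4) ⊆ closedBall x₀ (3 * r / 2) ∧
        ball x₀ r ∩ ball x (2 * r * t) ⊆ ball z ρ ∧ ρ ≤ 10 * r * t := by
      rcases le_or_gt t (1 / 5) with h | h
      · have hrt : r * t ≤ r * (1 / 5) := by gcongr
        refine ⟨2 * r * t, x, by positivity, by linarith, ?_, inter_subset_right, by nlinarith⟩
        refine closedBall_subset_closedBall' ?_
        have := mem_ball.1 hx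
        linarith
      · have hrt : r * (1 / 5) ≤ r * t := by gcongr
        exact ⟨r, x₀, hr, le_rfl, closedBall_subset_closedBall (by linarith), inter_subset_left,
          by linarith⟩
    rw [hvol, ← ENNReal.ofReal_mul (by positivity)]
    calc ENNReal.ofReal (2 * r) * ∫⁻ y in ball x₀ r ∩ ball x (2 * r * t), ‖hF.mk _ y‖ₑ
        ≤ ENNReal.ofReal (2 * r) * ENNReal.ofReal (C' * ρ ^ ((n : ℝ) - 1)) := by
          gcongr
          exact hball z ρ hρ hρr hz _ inter_subset_left
            (measurableSet_ball.inter measurableSet_ball) hsz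
      _ = ENNReal.ofReal (2 * r * (C' * ρ ^ ((n : ℝ) - 1))) :=
          (ENNReal.ofReal_mul (by positivity)).symm
      _ ≤ _ := ENNReal.ofReal_le_ofReal (hstep hr ht0 hρ.le hρt)

end LogOscillation

section Crossover

variable {n : ℕ} {p s q C₁ C₂ Λ d : ℝ} {u f : En n → ℝ} {x₀ : En n} {r R : ℝ}

lemma integrableOn_nneg_tail (hn : 0 < n) (hp : 1 < p) (hs0 : 0 < s) (hu : AEMeasurable u)
    (hut : MemTailSpace p s u) (hR : 0 < R) :
    IntegrableOn (fun y => |nneg u y| ^ (p - 1) * ‖y - x₀‖ ^ (-((n : ℝ) + p * s)))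
      (ball x₀ R)ᶜ := by
  have hN : 0 < (n : ℝ) + p * s := by positivity
  set N := (n : ℝ) + p * s
  set c := 1 + (1 + ‖x₀‖) / R
  have hc : 0 < c := by positivity
  have hm : AEMeasurable fun y => |nneg u y| ^ (p - 1) * ‖y - x₀‖ ^ (-N) :=
    ((hu.neg.max aemeasurable_const).norm.pow_const _).mul
      ((measurable_id.sub_const x₀).norm.pow_const _).aemeasurable
  refine (hut.const_mul (c ^ N)).integrableOn.mono' hm.restrict.aestronglyMeasurable
    ((ae_restrict_iff' measurableSet_ball.compl).2 (.of_forall fun y hy => ?_))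
  have hy' : R ≤ ‖y - x₀‖ := by simpa [dist_eq_norm] using hy
  have hy0 : 0 < ‖y - x₀‖ := hR.trans_le hy'
  have h1 : 1 + ‖y‖ ≤ c * ‖y - x₀‖ := by
    have h2 : ‖y‖ ≤ ‖y - x₀‖ + ‖x₀‖ := by simpa using norm_add_le (y - x₀) x₀
    have h3 : 1 + ‖x₀‖ ≤ (1 + ‖x₀‖) / R * ‖y - x₀‖ := by
      rw [div_mul_eq_mul_div, le_div_iff₀ hR]
      gcongr
    simp only [c]
    linarith
  have h4 : ‖y - x₀‖ ^ (-N) ≤ c ^ N * (1 + ‖y‖) ^ (-N) := by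
    have h5 : (c * ‖y - x₀‖) ^ (-N) ≤ (1 + ‖y‖) ^ (-N) :=
      rpow_le_rpow_of_nonpos (by positivity) h1 (by linarith)
    rw [mul_rpow hc.le hy0.le, rpow_neg hc.le, inv_mul_le_iff₀ (by positivity)] at h5
    exact h5
  have h6 : |nneg u y| ≤ |u y| := by
    rw [nneg, abs_of_nonneg (le_max_right _ _)]
    exact max_le (neg_le_abs _) (abs_nonneg _)
  rw [Real.norm_of_nonneg (by positivity)]
  calc |nneg u y| ^ (p - 1) * ‖y - x₀‖ ^ (-N)
      ≤ |u y| ^ (p - 1) * (c ^ N * (1 + ‖y‖) ^ (-N)) := by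
        have : 0 ≤ p - 1 := by linarith
        gcongr
    _ = _ := by ring

lemma tail_nonneg (hR : 0 < R) (v : En n → ℝ) : 0 ≤ Tail n p s v x₀ R :=
  rpow_nonneg (mul_nonneg (rpow_nonneg hR.le _) (integral_nonneg fun _ => by positivity)) _

lemma lintegral_nneg_tail_le (hn : 0 < n) (hp : 1 < p) (hs0 : 0 < s) (hu : AEMeasurable u)
    (hut : MemTailSpace p s u) (hr : 0 < r) (hR : 0 < R)
    (h : r ^ (p / (p - 1)) * R ^ (-(p / (p - 1))) * Tail n p s (nneg u) x₀ R ≤ d) :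
    ∫⁻ y in (ball x₀ R)ᶜ, ENNReal.ofReal (nneg u y ^ (p - 1) *
      ‖y - x₀‖ ^ (-((n : ℝ) + p * s))) ≤ ENNReal.ofReal (d ^ (p - 1) * r ^ (-p)) := by
  have hi := integrableOn_nneg_tail (x₀ := x₀) hn hp hs0 hu hut hR
  have hp1 : p - 1 ≠ 0 := by linarith
  set I := ∫ y in (ball x₀ R)ᶜ, |nneg u y| ^ (p - 1) * ‖y - x₀‖ ^ (-((n : ℝ) + p * s)) with hI
  have hI0 : 0 ≤ I := integral_nonneg fun _ => by positivity
  have hpow : r ^ p * I ≤ d ^ (p - 1) := by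
    have hT0 := tail_nonneg (p := p) (s := s) (x₀ := x₀) hR (nneg u)
    have h1 := rpow_le_rpow (by positivity) h (by linarith : 0 ≤ p - 1)
    rw [mul_rpow (by positivity) hT0, mul_rpow (by positivity) (by positivity),
      ← rpow_mul hr.le, ← rpow_mul hR.le, Tail, ← hI, ← rpow_mul (by positivity),
      one_div_mul_cancel hp1, rpow_one, neg_mul, div_mul_cancel₀ _ hp1, rpow_neg hR.le] at h1
    have hRp : 0 < R ^ p := by positivity
    calc r ^ p * I = r ^ p * (R ^ p)⁻¹ * (R ^ p * I) := by field_simp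
      _ ≤ _ := h1
  calc ∫⁻ y in (ball x₀ R)ᶜ, ENNReal.ofReal (nneg u y ^ (p - 1) * ‖y - x₀‖ ^ (-((n : ℝ) + p * s)))
      = ∫⁻ y in (ball x₀ R)ᶜ, ENNReal.ofReal (|nneg u y| ^ (p - 1) *
          ‖y - x₀‖ ^ (-((n : ℝ) + p * s))) := by
        refine lintegral_congr fun y => ?_
        rw [abs_of_nonneg (show 0 ≤ nneg u y from le_max_right _ _)]
    _ = ENNReal.ofReal I :=
        (ofReal_integral_eq_lintegral_ofReal hi (.of_forall fun _ => by
          simp only [Pi.zero_apply]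
          positivity)).symm
    _ ≤ _ := by
        refine ENNReal.ofReal_le_ofReal ?_
        rw [rpow_neg hr.le, ← div_eq_mul_inv, le_div_iff₀ (by positivity), mul_comm]
        exact hpow

lemma rpow_setAverage_le {α : Type*} [MeasurableSpace α] {μ : Measure α} {B : Set α}
    (hB : MeasurableSet B) (hB0 : μ B ≠ 0) (hBt : μ B ≠ ⊤) {g : α → ℝ}
    (hg : AEMeasurable g (μ.restrict B)) (hg0 : ∀ x ∈ B, 0 < g x) {ε : ℝ} (hε : 0 < ε)
    {E : ℝ≥0∞} (hE : E ≠ ⊤)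
    (h : (∫⁻ x in B, ENNReal.ofReal (g x ^ ε) ∂μ) * (∫⁻ x in B, ENNReal.ofReal (g x ^ (-ε)) ∂μ) ≤
      (E * μ B) * (E * μ B)) :
    (⨍ x in B, g x ^ ε ∂μ) ^ (1 / ε) ≤
      (E.toReal ^ 2 + 1) ^ (1 / ε) * (⨍ x in B, g x ^ (-ε) ∂μ) ^ (-(1 / ε)) := by
  have havg : ∀ t : ℝ, ⨍ x in B, g x ^ t ∂μ =
      (μ B).toReal⁻¹ * (∫⁻ x in B, ENNReal.ofReal (g x ^ t) ∂μ).toReal := fun t => by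
    rw [setAverage_eq, smul_eq_mul, integral_eq_lintegral_of_nonneg_ae
      ((ae_restrict_iff' hB).2 (.of_forall fun x hx => rpow_nonneg (hg0 x hx).le t))
      (hg.pow_const t).aestronglyMeasurable, Measure.real]
  have hne : ∀ t : ℝ, ∫⁻ x in B, ENNReal.ofReal (g x ^ t) ∂μ ≠ 0 := fun t h0 => by
    rw [lintegral_eq_zero_iff' (hg.pow_const t).ennreal_ofReal, Filter.EventuallyEq,
      ae_restrict_iff' hB] at h0
    refine hB0 (measure_mono_null (fun x hx => ?_) (ae_iff.1 h0))
    have := rpow_pos_of_pos (hg0 x hx) t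
    simpa [hx] using this
  have hb : 0 < (μ B).toReal := ENNReal.toReal_pos hB0 hBt
  rw [havg, havg]
  have hP0 := hne ε
  have hN0 := hne (-ε)
  set P := ∫⁻ x in B, ENNReal.ofReal (g x ^ ε) ∂μ
  set N := ∫⁻ x in B, ENNReal.ofReal (g x ^ (-ε)) ∂μ
  have hfin : (E * μ B) * (E * μ B) ≠ ⊤ :=
    ENNReal.mul_ne_top (ENNReal.mul_ne_top hE hBt) (ENNReal.mul_ne_top hE hBt)
  have hNt : N ≠ ⊤ := fun hN => hfin (top_le_iff.1 (by rwa [hN, ENNReal.mul_top hP0] at h))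
  have hNpos : 0 < N.toReal := ENNReal.toReal_pos hN0 hNt
  have hPN : P.toReal * N.toReal ≤ (E.toReal * (μ B).toReal) * (E.toReal * (μ B).toReal) := by
    rw [← ENNReal.toReal_mul, ← ENNReal.toReal_mul, ← ENNReal.toReal_mul]
    exact ENNReal.toReal_mono hfin h
  rw [rpow_neg (by positivity), ← inv_rpow (by positivity),
    ← mul_rpow (by positivity) (by positivity)]
  refine rpow_le_rpow (by positivity) ?_ (by positivity)
  rw [mul_inv, inv_inv, inv_mul_le_iff₀ hb]
  calc P.toReal = P.toReal * N.toReal * N.toReal⁻¹ := by field_simp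
    _ ≤ (E.toReal * (μ B).toReal) * (E.toReal * (μ B).toReal) * N.toReal⁻¹ := by gcongr
    _ = (μ B).toReal * (E.toReal ^ 2 * ((μ B).toReal * N.toReal⁻¹)) := by ring
    _ ≤ _ := by
        gcongr
        exact le_add_of_nonneg_right zero_le_one

end Crossover

/-- **Crossover estimate** (Step 1 of the proof of Theorem 1.1). -/
theorem crossover_estimate
    (n : ℕ) (p s q C₁ C₂ Λ : ℝ)
    (hs0 : 0 < s) (hs1 : s < 1) (hp : 1 < p) (hpn : p < n) (hq : (n : ℝ) < q) :
    ∃ ε c : ℝ, 0 < ε ∧ 0 < c ∧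
      ∀ (S : Setting n p s C₁ C₂ Λ) (u f : En n → ℝ) (G : En n → En n)
        (x₀ : En n) (r R d : ℝ),
        0 < r → r ≤ 1 → r < R / 2 →
        ball x₀ R ⊆ S.Ω →
        IntegrableOn (fun x => |f x| ^ (q / p)) (ball x₀ R) →
        IsSupersol S f u G →
        (∀ x ∈ ball x₀ R, 0 ≤ u x) →
        dBound n p s q u f x₀ r R < d →
        (⨍ x in ball x₀ r, (u x + d) ^ ε) ^ (1 / ε) ≤
          c * (⨍ x in ball x₀ r, (u x + d) ^ (-ε)) ^ (-(1 / ε)) := by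
  have hn : 0 < n := by
    have : (0 : ℝ) < n := by linarith
    exact_mod_cast this
  have hp0 : 0 < p := by linarith
  by_cases hC : 0 < C₁ ∧ 0 < C₂ ∧ 1 ≤ Λ
  swap
  · exact ⟨1, 1, one_pos, one_pos, fun S => absurd ⟨S.hC₁, S.hC₂, S.hΛ⟩ hC⟩
  obtain ⟨C, hC0, hen⟩ := exists_lintegral_log_gradient_le (C₁ := C₁) (C₂ := C₂) (Λ := Λ)
    hn hp hpn hq hs0 hs1 hC.1 hC.2.1 hC.2.2
  obtain ⟨a, ha, hexp⟩ := exists_lintegral_exp_log_le hn hp hC0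
  refine ⟨1 / (2 * a), ((expConst n).toReal ^ 2 + 1) ^ (1 / (1 / (2 * a))), by positivity,
    by positivity, fun S u f G x₀ r R d hr hr1 hrR hΩ hf hsup hu0 hdB => ?_⟩
  have h2R : 2 * r < R := by linarith
  have hR : 0 < R := by linarith
  have hT0 : 0 ≤ r ^ (p / (p - 1)) * R ^ (-(p / (p - 1))) * Tail n p s (nneg u) x₀ R :=
    mul_nonneg (by positivity) (tail_nonneg hR _)
  have hF0 : 0 ≤ r ^ ((p - n) / (p - 1)) * R ^ (n * (q - p) / (q * (p - 1))) *
      (normLp (q / p) f (ball x₀ R)) ^ (1 / (p - 1)) :=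
    mul_nonneg (by positivity) (rpow_nonneg (rpow_nonneg (integral_nonneg fun _ => by
      positivity) _) _)
  rw [dBound] at hdB
  have hd : 0 < d := by linarith
  have hW := hsup.1.mono hΩ
  have hui : ∀ k : Set (En n), IsCompact k → k ⊆ ball x₀ R → IntegrableOn u k :=
    fun k hk hkR => hW.integrableOn hp hu0 hk hkR
  have hQ : IsCompact (closedBall x₀ (2 * r)) := isCompact_closedBall _ _
  have hQR : closedBall x₀ (2 * r) ⊆ ball x₀ R := closedBall_subset_ball h2R
  have hu2 : IntegrableOn u (ball x₀ (2 * r)) := (hui _ hQ hQR).mono_set ball_subset_closedBall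
  have hu02 : ∀ x ∈ ball x₀ (2 * r), 0 ≤ u x := fun x hx => hu0 x (ball_subset_ball h2R.le hx)
  have hBB : ball x₀ r ⊆ ball x₀ (2 * r) := ball_subset_ball (by linarith)
  have hweak : ∀ H, HasWeakGradOn u H (ball x₀ R) → HasWeakGradOn u H (ball x₀ (2 * r)) :=
    fun H hH φ hφ => hH φ ⟨hφ.1, hφ.2.1, hφ.2.2.trans (ball_subset_ball h2R.le)⟩
  have key : (∫⁻ x in ball x₀ r, ENNReal.ofReal (exp (Real.log (u x + d) / (2 * a)))) *
      (∫⁻ x in ball x₀ r, ENNReal.ofReal (exp (-(Real.log (u x + d) / (2 * a))))) ≤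
      (expConst n * volume (ball x₀ r)) * (expConst n * volume (ball x₀ r)) := by
    rcases aemeasurable_or_hasWeakGradOn_zero (by positivity : 0 < 2 * r) h2R hW.1 hui with hG | hG
    · have hGp : IntegrableOn (fun x => ‖G x‖ ^ p) (ball x₀ (2 * r)) :=
        (hW.2 _ hQ hQR).2.mono_set ball_subset_closedBall
      have : IsFiniteMeasure (volume.restrict (ball x₀ (2 * r))) :=
        ⟨by simpa using measure_ball_lt_top⟩
      refine hexp u G x₀ r d hr hd (hweak G hW.1) hu2
        (integrableOn_of_integrableOn_norm_rpow hp hG.aestronglyMeasurable hGp) ?_ hu02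
        fun z ρ hρ hρr hz => hen S u f G x₀ z r R ρ d hρ hρr hr1 h2R hd hΩ hf hsup hu0 hG
          (by linarith) (fun hu => lintegral_nneg_tail_le hn hp hs0 hu hsup.2.1 hr hR (by linarith))
          hz
      convert hGp.lintegral_lt_top.ne using 1
      refine lintegral_congr fun x => ?_
      rw [← ofReal_norm, ENNReal.ofReal_rpow_of_nonneg (norm_nonneg _) hp0.le]
    · refine hexp u 0 x₀ r d hr hd (hweak 0 hG) hu2 integrableOn_zero ?_ hu02
        fun z ρ _ _ _ => ?_
      · simp [ENNReal.zero_rpow_of_pos hp0]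
      · simp [zero_rpow hp0.ne']
  obtain ⟨hB0, hBt⟩ := volume_ball_pos_lt_top (x₀ := x₀) hr
  have hpos : ∀ x ∈ ball x₀ r, 0 < u x + d := fun x hx => by
    have := hu02 x (hBB hx)
    positivity
  refine rpow_setAverage_le measurableSet_ball hB0 hBt
    ((hu2.mono_set hBB).aemeasurable.add_const d) hpos (by positivity) (expConst_ne_top n) ?_
  convert key using 2 <;>
    refine setLIntegral_congr_fun measurableSet_ball fun x hx => ?_ <;>
    simp only [rpow_def_of_pos (hpos x hx), mul_neg, mul_one_div]

end
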